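/- Let X ⊂ ℂ be a non-separating continuum and h : Bd(X) × [0,1] → ℂ an isotopy with h^0 = id. Let U^t be the unbounded component of ℂ \ h^t(Bd(X)), X^t = ℂ \ U^t, and φ^t : 𝔻 → U^t ∪ {∞} the normalized Riemann map. Then there exists a continuous map α : ∂𝔻 × [0,1] → ∂𝔻 with each α^t := α(·,t) injective and α^0 = id_{∂𝔻}, such that whenever the conformal external ray of X^0 at a point e^{iθ} ∈ ∂𝔻 lands on a point x ∈ Bd(X), the conformal external ray of X^t at the point α^t(e^{iθ}) lands on h^t(x), for every t ∈ [0,1]. -/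

import Mathlib

open Set Metric Topology Filter



/-- The union of the unbounded connected components of the complement of `K`;
for compact `K` this is the (unique) unbounded component of `ℂ \ K`. -/
def unbddComp (K : Set ℂ) : Set ℂ :=
  {z : ℂ | z ∈ Kᶜ ∧ ¬ Bornology.IsBounded (connectedComponentIn Kᶜ z)}

/-- The normalized Riemann map `φ : 𝔻 → U ∪ {∞}`, `φ(0) = ∞`, encoded by its finite
part `f` on the punctured disk: `f` is an injective holomorphic map of `𝔻 \ {0}` onto
`U`, with a simple pole at `0` with positive "derivative": `z·f(z) → c > 0` as `z → 0`. -/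
def IsNormalizedRiemannMap (U : Set ℂ) (f : ℂ → ℂ) : Prop :=
  DifferentiableOn ℂ f (Metric.ball 0 1 \ {0}) ∧
  Set.InjOn f (Metric.ball 0 1 \ {0}) ∧
  f '' (Metric.ball 0 1 \ {0}) = U ∧
  ∃ c : ℝ, 0 < c ∧ Filter.Tendsto (fun z : ℂ => z * f z) (𝓝[≠] 0) (𝓝 (c : ℂ))


theorem sector_lemma {Z : Type*} [TopologicalSpace Z] {S : Set Z} (hS : IsPreconnected S)
    {G : Z → ℂ} (hG : ContinuousOn G S) (θ : ℝ)
    (hpos : ∀ z ∈ S, 0 < (Complex.exp (-(θ * Complex.I)) * Complex.exp (G z)).re)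
    {z0 : Z} (hz0 : z0 ∈ S) (h0 : |(G z0).im - θ| < Real.pi / 2) :
    ∀ z ∈ S, |(G z).im - θ| < Real.pi / 2 := by
  have hcos : ∀ z ∈ S, 0 < Real.cos ((G z).im - θ) := by
    intro z hz
    have h1 := hpos z hz
    rw [← Complex.exp_add, Complex.exp_re] at h1
    have h2 := (pos_iff_pos_of_mul_pos h1).1 (Real.exp_pos _)
    simpa [neg_add_eq_sub] using h2
  have him : IsPreconnected ((fun z => (G z).im - θ) '' S) :=
    hS.image _ (by fun_prop)
  intro z hz
  by_contra hcon
  push Not at hcon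
  have hoc := him.ordConnected
  have hz0' := abs_lt.1 h0
  have m0 : (G z0).im - θ ∈ ((fun z => (G z).im - θ) '' S) := ⟨z0, hz0, rfl⟩
  have m1 : (G z).im - θ ∈ ((fun z => (G z).im - θ) '' S) := ⟨z, hz, rfl⟩
  rcases le_abs.1 hcon with h | h
  · obtain ⟨w, hw, hw'⟩ := hoc.out m0 m1 ⟨hz0'.2.le, h⟩
    have := hcos w hw
    simp only at hw'
    rw [hw', Real.cos_pi_div_two] at this
    exact lt_irrefl _ this
  · obtain ⟨w, hw, hw'⟩ := hoc.out m1 m0 (show -(Real.pi/2) ∈ _ from ⟨by linarith, by linarith⟩)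
    have := hcos w hw
    simp only at hw'
    rw [hw', Real.cos_neg, Real.cos_pi_div_two] at this
    exact lt_irrefl _ this

theorem exp_eq_im_lt {a b : ℂ} (h : Complex.exp a = Complex.exp b)
    (hab : |a.im - b.im| < 2 * Real.pi) : a = b := by
  obtain ⟨n, hn⟩ := Complex.exp_eq_exp_iff_exists_int.1 h
  have h1 : a.im - b.im = n * (2 * Real.pi) := by
    rw [hn]; simp
  rw [h1, abs_mul, abs_of_pos Real.two_pi_pos] at hab
  have h2 : |(n:ℝ)| < 1 := by
    by_contra h'
    push Not at h'
    nlinarith [Real.two_pi_pos]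
  have h3 : n = 0 := by
    have : |n| < 1 := by exact_mod_cast h2
    exact Int.abs_lt_one_iff.1 this
  rw [hn, h3]; simp

theorem log_unique {Z : Type*} [TopologicalSpace Z] {S : Set Z} (hS : IsPreconnected S)
    {G₁ G₂ : Z → ℂ} (h1 : ContinuousOn G₁ S) (h2 : ContinuousOn G₂ S)
    (hexp : ∀ z ∈ S, Complex.exp (G₁ z) = Complex.exp (G₂ z))
    {z0 : Z} (hz0 : z0 ∈ S) (h0 : G₁ z0 = G₂ z0) : ∀ z ∈ S, G₁ z = G₂ z := by
  intro z hz
  have := sector_lemma hS (G := fun z => G₁ z - G₂ z) (h1.sub h2) 0 (by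
    intro z hz
    simp [Complex.exp_sub, hexp z hz]) hz0 (by simp [h0, Real.pi_pos]) z hz
  refine exp_eq_im_lt (hexp z hz) ?_
  simp at this
  linarith [Real.pi_pos]

theorem lift_log {Z : Type*} [TopologicalSpace Z] (W : Set (Z × ℝ)) (τ₀ : ℝ)
    (hW : ∀ z τ, (z, τ) ∈ W → ∀ s ∈ Icc (0:ℝ) 1, (z, τ₀ + s * (τ - τ₀)) ∈ W)
    (F : Z × ℝ → ℂ) (hF : ContinuousOn F W) (hF0 : ∀ p ∈ W, F p ≠ 0)
    (G₀ : Z → ℂ) (hG₀ : ContinuousOn G₀ {z | (z, τ₀) ∈ W})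
    (hG : ∀ z, (z, τ₀) ∈ W → Complex.exp (G₀ z) = F (z, τ₀)) :
    ∃ G : Z × ℝ → ℂ, ContinuousOn G W ∧ (∀ p ∈ W, Complex.exp (G p) = F p) ∧
      ∀ z, (z, τ₀) ∈ W → G (z, τ₀) = G₀ z := by
  classical
  have cov := Complex.isCoveringMap_exp
  have hW0 : ∀ p : W, (p.1.1, τ₀) ∈ W := fun p => by
    have := hW p.1.1 p.1.2 p.2 0 (by simp)
    simpa using this
  let c : unitInterval × W → W := fun q =>
    ⟨(q.2.1.1, τ₀ + (q.1 : ℝ) * (q.2.1.2 - τ₀)), hW _ _ q.2.2 _ q.1.2⟩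
  have hc : Continuous c := by
    refine Continuous.subtype_mk ?_ _
    fun_prop
  have hFr : Continuous (fun p : W => (⟨F p.1, hF0 _ p.2⟩ : {z : ℂ // z ≠ 0})) :=
    Continuous.subtype_mk (continuousOn_iff_continuous_domRestrict.1 hF) _
  let Hh : C(unitInterval × W, {z : ℂ // z ≠ 0}) := ⟨_, hFr.comp hc⟩
  have hf : Continuous (fun p : W => G₀ p.1.1) := by
    have h1 := continuousOn_iff_continuous_domRestrict.1 hG₀
    have h2 : Continuous (fun p : W => (⟨p.1.1, hW0 p⟩ : {z | (z, τ₀) ∈ W})) :=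
      Continuous.subtype_mk (by fun_prop) _
    exact h1.comp h2
  let f : C(W, ℂ) := ⟨_, hf⟩
  have H0 : ∀ a, Hh (0, a) = (fun z : ℂ ↦ (⟨_, z.exp_ne_zero⟩ : {z : ℂ // z ≠ 0})) (f a) := by
    intro a
    apply Subtype.ext
    show F _ = Complex.exp (G₀ a.1.1)
    rw [hG _ (hW0 a)]
    simp [c]
  let L := cov.liftHomotopy Hh f H0
  have hL : ∀ q, Complex.exp (L q) = F (c q).1 := by
    intro q
    have := congr_fun (cov.liftHomotopy_lifts Hh f H0) q
    exact congrArg Subtype.val this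
  refine ⟨fun p => if hp : p ∈ W then L (1, ⟨p, hp⟩) else 0, ?_, ?_, ?_⟩
  · rw [continuousOn_iff_continuous_domRestrict]
    have : W.domRestrict (fun p => if hp : p ∈ W then L (1, ⟨p, hp⟩) else 0)
        = fun p : W => L (1, p) := by
      ext p; simp
    rw [this]
    fun_prop
  · intro p hp
    simp only [hp, dif_pos]
    rw [hL]
    simp [c]
  · intro z hz
    simp only [hz, dif_pos]
    let a : W := ⟨(z, τ₀), hz⟩
    have h1 := log_unique (Z := unitInterval) (S := univ) isPreconnected_univ
      (G₁ := fun s => L (s, a)) (G₂ := fun _ => G₀ z) (by fun_prop) (by fun_prop)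
      (z0 := 0) (by
        intro s _
        rw [hL, hG z hz]
        simp [c, a]) (mem_univ _) (cov.liftHomotopy_zero Hh f H0 a)
    exact h1 1 (mem_univ _)


theorem inj_nhds {p : ℂ → ℂ} {U : Set ℂ} (hU : IsOpen U) (hp : DifferentiableOn ℂ p U)
    (hi : InjOn p U) {z : ℂ} (hz : z ∈ U) : 𝓝 (p z) ≤ map p (𝓝 z) := by
  have ha : AnalyticAt ℂ p z := hp.analyticAt (hU.mem_nhds hz)
  rcases ha.eventually_constant_or_nhds_le_map_nhds with h | h
  · exfalso
    have h1 : ∀ᶠ w in 𝓝[≠] z, p w = p z ∧ w ∈ U :=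
      nhdsWithin_le_nhds (h.and (hU.mem_nhds hz))
    obtain ⟨w, ⟨hw, hwU⟩, hne⟩ := (h1.and self_mem_nhdsWithin).exists
    exact hne (hi hwU hz hw)
  · exact h

theorem inj_isOpen_image {p : ℂ → ℂ} {U : Set ℂ} (hU : IsOpen U) (hp : DifferentiableOn ℂ p U)
    (hi : InjOn p U) {V : Set ℂ} (hV : IsOpen V) (hVU : V ⊆ U) : IsOpen (p '' V) := by
  rw [isOpen_iff_mem_nhds]
  rintro _ ⟨z, hz, rfl⟩
  exact inj_nhds hU hp hi (hVU hz) (image_mem_map (hV.mem_nhds hz))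

theorem inv_continuousAt {p : ℂ → ℂ} {U : Set ℂ} (hU : IsOpen U) (hp : DifferentiableOn ℂ p U)
    (hi : InjOn p U) {z : ℂ} (hz : z ∈ U) : ContinuousAt (Function.invFunOn p U) (p z) := by
  have hinv : ∀ w ∈ U, Function.invFunOn p U (p w) = w := fun w hw =>
    hi.leftInvOn_invFunOn hw
  rw [ContinuousAt, hinv z hz]
  refine Tendsto.mono_left ?_ (inj_nhds hU hp hi hz)
  rw [tendsto_map'_iff]
  refine tendsto_id.congr' ?_
  filter_upwards [hU.mem_nhds hz] with w hw
  exact (hinv w hw).symm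

theorem inv_differentiableOn {p : ℂ → ℂ} {U : Set ℂ} (hU : IsOpen U)
    (hp : DifferentiableOn ℂ p U) (hi : InjOn p U) :
    DifferentiableOn ℂ (Function.invFunOn p U) (p '' U) := by
  rintro _ ⟨z, hz, rfl⟩
  apply DifferentiableAt.differentiableWithinAt
  have hinv : ∀ w ∈ U, Function.invFunOn p U (p w) = w := fun w hw =>
    hi.leftInvOn_invFunOn hw
  refine (Complex.analyticAt_of_differentiable_on_punctured_nhds_of_continuousAt ?_
    (inv_continuousAt hU hp hi hz)).differentiableAt
  have ha : AnalyticAt ℂ p z := hp.analyticAt (hU.mem_nhds hz)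
  have hne : ∀ᶠ w in 𝓝[≠] z, deriv p w ≠ 0 := by
    rcases ha.deriv.eventually_eq_zero_or_eventually_ne_zero with h | h
    · exfalso
      obtain ⟨ε, hε, hb⟩ := Metric.eventually_nhds_iff_ball.1 (h.and (hU.mem_nhds hz))
      have hc : ∀ w ∈ ball z ε, p w = p z := by
        intro w hw
        refine (convex_ball z ε).is_const_of_fderivWithin_eq_zero (𝕜 := ℂ)
          (hp.mono fun y hy => (hb y hy).2) ?_ hw (mem_ball_self hε)
        intro y hy
        rw [fderivWithin_of_isOpen isOpen_ball hy]
        ext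
        have := (hb y hy).1
        simpa using this
      have h1 : ∀ᶠ w in 𝓝[≠] z, w ∈ ball z ε := nhdsWithin_le_nhds (ball_mem_nhds z hε)
      obtain ⟨w, hw, hne⟩ := (h1.and self_mem_nhdsWithin).exists
      exact hne (hi (hb w hw).2 hz (hc w hw))
    · exact h
  rw [eventually_nhdsWithin_iff]
  refine inj_nhds hU hp hi hz ?_
  rw [eventually_nhdsWithin_iff] at hne
  rw [mem_map]
  filter_upwards [hne, hU.mem_nhds hz] with w hw hwU hwz
  have hwz' : w ≠ z := fun h => hwz (by rw [h]; rfl)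
  have hd : HasDerivAt p (deriv p w) (Function.invFunOn p U (p w)) := by
    rw [hinv w hwU]
    exact (hp.differentiableAt (hU.mem_nhds hwU)).hasDerivAt
  refine (HasDerivAt.of_local_left_inverse (inv_continuousAt hU hp hi hwU) hd
    (hw hwz') ?_).differentiableAt
  filter_upwards [(inj_isOpen_image hU hp hi hU Subset.rfl).mem_nhds (mem_image_of_mem p hwU)]
  rintro _ ⟨y, hy, rfl⟩
  rw [hinv y hy]

theorem unbddComp_of_mem {K A : Set ℂ} (hA : IsPreconnected A) (hAK : A ⊆ Kᶜ)
    (hub : ¬ Bornology.IsBounded A) : A ⊆ unbddComp K := by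
  intro z hz
  exact ⟨hAK hz, fun h => hub (h.subset (hA.subset_connectedComponentIn hz hAK))⟩

theorem unbddComp_isOpen {K : Set ℂ} (hK : IsClosed K) : IsOpen (unbddComp K) := by
  rw [isOpen_iff_mem_nhds]
  intro z hz
  have h1 := hK.isOpen_compl.connectedComponentIn (x := z)
  filter_upwards [h1.mem_nhds (mem_connectedComponentIn hz.1)] with w hw
  refine ⟨connectedComponentIn_subset _ _ hw, ?_⟩
  rw [← connectedComponentIn_eq hw]
  exact hz.2

theorem unbddComp_closure {K : Set ℂ} (hK : IsClosed K) {w : ℂ}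
    (hw : w ∈ closure (unbddComp K)) (hwK : w ∉ K) : w ∈ unbddComp K := by
  have h1 := hK.isOpen_compl.connectedComponentIn (x := w)
  obtain ⟨y, hy, hyU⟩ := mem_closure_iff_nhds.1 hw _ (h1.mem_nhds (mem_connectedComponentIn hwK))
  refine ⟨hwK, ?_⟩
  rw [connectedComponentIn_eq hy]
  exact hyU.2

theorem preconnected_norm_gt {M : ℝ} (hM : 0 < M) : IsPreconnected {w : ℂ | M < ‖w‖} := by
  have : {w : ℂ | M < ‖w‖} = Complex.exp '' {w : ℂ | Real.log M < w.re} := by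
    ext w
    constructor
    · intro hw
      have hw' : M < ‖w‖ := hw
      have h0 : w ≠ 0 := norm_pos_iff.1 (hM.trans hw')
      refine ⟨Complex.log w, ?_, Complex.exp_log h0⟩
      simp only [mem_setOf_eq, Complex.log_re]
      exact Real.log_lt_log hM hw'
    · rintro ⟨w, hw, rfl⟩
      simp only [mem_setOf_eq, Complex.norm_exp] at *
      rwa [← Real.log_lt_iff_lt_exp hM]
  rw [this]
  exact (convex_halfSpace_re_gt _).isPreconnected.image _ (by fun_prop)

/-- Riemann map data for one fixed time. -/
structure RM (K : Set ℂ) (f : ℂ → ℂ) (M : ℝ) : Prop where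
  cpt : IsCompact K
  ne : K.Nonempty
  pos : 0 < M
  bd : ∀ k ∈ K, ‖k‖ ≤ M
  nrm : IsNormalizedRiemannMap (unbddComp K) f

/-- `z f(z)` with its value at the origin filled in. -/
noncomputable def Qf (f : ℂ → ℂ) : ℂ → ℂ :=
  Function.update (fun z => z * f z) 0 (limUnder (𝓝[≠] 0) (fun z => z * f z))

theorem Qf_ne {f : ℂ → ℂ} {z : ℂ} (hz : z ≠ 0) : Qf f z = z * f z := by
  simp [Qf, hz]

namespace RM
variable {K : Set ℂ} {f : ℂ → ℂ} {M : ℝ} (h : RM K f M)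
include h

theorem Q_zero : ∃ c : ℝ, 0 < c ∧ Qf f 0 = c := by
  obtain ⟨_, _, _, c, hc, ht⟩ := h.nrm
  exact ⟨c, hc, by simp [Qf, ht.limUnder_eq]⟩

theorem Q_cont0 : ContinuousAt (Qf f) 0 := by
  obtain ⟨_, _, _, c, hc, ht⟩ := h.nrm
  rw [Qf, continuousAt_update_same, ht.limUnder_eq]
  exact ht

theorem Q_diff : DifferentiableOn ℂ (Qf f) (ball 0 1) := by
  obtain ⟨hd, _, _, c, hc, ht⟩ := h.nrm
  have h1 : DifferentiableOn ℂ (Qf f) (ball 0 1 \ {0}) := by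
    have : DifferentiableOn ℂ (fun z => z * f z) (ball 0 1 \ {0}) := by fun_prop
    exact this.congr fun z hz => Qf_ne hz.2
  exact (Complex.differentiableOn_compl_singleton_and_continuousAt_iff
    (isOpen_ball.mem_nhds (by simp))).1 ⟨h1, h.Q_cont0⟩

theorem f_mem {z : ℂ} (hz : z ∈ ball (0:ℂ) 1) (h0 : z ≠ 0) : f z ∈ unbddComp K := by
  rw [← h.nrm.2.2.1]
  exact ⟨z, ⟨hz, h0⟩, rfl⟩

theorem f_ne {z : ℂ} (hz : z ∈ ball (0:ℂ) 1) (h0 : z ≠ 0) {k : ℂ} (hk : k ∈ K) : f z ≠ k :=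
  fun he => (h.f_mem hz h0).1 (he ▸ hk)

theorem Q_ne {z : ℂ} (hz : z ∈ ball (0:ℂ) 1) {k : ℂ} (hk : k ∈ K) : Qf f z - z * k ≠ 0 := by
  by_cases h0 : z = 0
  · obtain ⟨c, hc, hc'⟩ := h.Q_zero
    simp [h0, hc', hc.ne']
  · rw [Qf_ne h0, ← mul_sub]
    exact mul_ne_zero h0 (sub_ne_zero.2 (h.f_ne hz h0 hk))

end RM

/-- the function `1/(f-k)` -/
noncomputable def pf (f : ℂ → ℂ) (k : ℂ) (z : ℂ) : ℂ := z / (Qf f z - z * k)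

namespace RM
variable {K : Set ℂ} {f : ℂ → ℂ} {M : ℝ} (h : RM K f M)
include h

omit h in
theorem p_zero (k : ℂ) : pf f k 0 = 0 := by simp [pf]

omit h in
theorem p_ne {z : ℂ} (h0 : z ≠ 0) (k : ℂ) : pf f k z = (f z - k)⁻¹ := by
  rw [pf, Qf_ne h0, ← mul_sub]
  field_simp

theorem p_diff {k : ℂ} (hk : k ∈ K) : DifferentiableOn ℂ (pf f k) (ball 0 1) := by
  have := h.Q_diff
  unfold pf
  exact differentiableOn_id.div (by fun_prop) fun z hz => h.Q_ne hz hk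

theorem p_inj {k : ℂ} (hk : k ∈ K) : InjOn (pf f k) (ball 0 1) := by
  intro z hz w hw he
  by_cases hz0 : z = 0
  · by_contra hne
    have hw0 : w ≠ 0 := fun h' => hne (hz0.trans h'.symm)
    rw [hz0, p_zero, p_ne hw0] at he
    exact sub_ne_zero.2 (h.f_ne hw hw0 hk) (inv_eq_zero.1 he.symm)
  · by_cases hw0 : w = 0
    · rw [hw0, p_zero, p_ne hz0] at he
      exact absurd (inv_eq_zero.1 he) (sub_ne_zero.2 (h.f_ne hz hz0 hk))
    · rw [p_ne hz0, p_ne hw0, inv_inj, sub_left_inj] at he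
      exact h.nrm.2.1 ⟨hz, hz0⟩ ⟨hw, hw0⟩ he

theorem p_mem {k : ℂ} {ζ : ℂ} (hζ : ζ ≠ 0) :
    ζ ∈ pf f k '' ball 0 1 ↔ ∃ w ∈ unbddComp K, ζ = (w - k)⁻¹ := by
  constructor
  · rintro ⟨z, hz, rfl⟩
    have h0 : z ≠ 0 := by
      rintro rfl
      exact hζ (p_zero k)
    exact ⟨f z, h.f_mem hz h0, p_ne h0 k⟩
  · rintro ⟨w, hw, rfl⟩
    rw [← h.nrm.2.2.1] at hw
    obtain ⟨z, hz, rfl⟩ := hw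
    exact ⟨z, hz.1, p_ne hz.2 k⟩

/-- properness -/
theorem proper {k : ℂ} (hk : k ∈ K) {L : Set ℂ} (hL : IsCompact L) (hLp : L ⊆ pf f k '' ball 0 1) :
    ∃ r < 1, ∀ z ∈ ball (0:ℂ) 1, pf f k z ∈ L → ‖z‖ ≤ r := by
  have hc : IsCompact (Function.invFunOn (pf f k) (ball 0 1) '' L) := by
    apply hL.image_of_continuousOn
    intro ζ hζ
    obtain ⟨z, hz, rfl⟩ := hLp hζ
    exact (inv_continuousAt isOpen_ball (h.p_diff hk) (h.p_inj hk) hz).continuousWithinAt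
  have hsub : Function.invFunOn (pf f k) (ball 0 1) '' L ⊆ ball 0 1 := by
    rintro _ ⟨ζ, hζ, rfl⟩
    exact Function.invFunOn_mem (hLp hζ)
  obtain ⟨r, hr, hr'⟩ := exists_lt_subset_ball hc.isClosed hsub
  refine ⟨r, hr, fun z hz hzL => ?_⟩
  have := hr' ⟨_, hzL, (h.p_inj hk).leftInvOn_invFunOn hz⟩
  exact (mem_ball_zero_iff.1 this).le

theorem mem_of_norm_gt {w : ℂ} (hw : M < ‖w‖) : w ∈ unbddComp K := by
  refine unbddComp_of_mem (preconnected_norm_gt h.pos) ?_ ?_ (show w ∈ {w : ℂ | M < ‖w‖} from hw)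
  · intro z hz hzK
    exact absurd (h.bd z hzK) (not_le.2 hz)
  · intro hb
    obtain ⟨R, hR⟩ := hb.exists_norm_le
    have h1 := hR ((|R| + M + 1 : ℝ) : ℂ) (by
      show M < ‖((|R| + M + 1 : ℝ) : ℂ)‖
      rw [Complex.norm_real, Real.norm_eq_abs]
      have := le_abs_self (|R| + M + 1)
      have := abs_nonneg R
      linarith)
    rw [Complex.norm_real, Real.norm_eq_abs] at h1
    have := le_abs_self (|R| + M + 1)
    have := le_abs_self R
    linarith [h.pos]

theorem outer {ε : ℝ} (hε : 0 < ε) : ∃ r < 1, ∀ z ∈ ball (0:ℂ) 1, r < ‖z‖ → z ≠ 0 → ‖f z‖ ≤ M + ε := by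
  obtain ⟨k, hk⟩ := h.ne
  have hkM := h.bd k hk
  let L : Set ℂ := {ζ | (M + ε) * ‖ζ‖ ≤ ‖ζ * k + 1‖}
  have key : ∀ ζ ∈ L, ‖ζ‖ ≤ 1 / ε := by
    intro ζ hζ
    have h1 : (M + ε) * ‖ζ‖ ≤ ‖ζ * k + 1‖ := hζ
    have h2 : ‖ζ * k + 1‖ ≤ ‖ζ‖ * M + 1 := by
      refine (norm_add_le _ _).trans ?_
      rw [norm_mul, norm_one]
      gcongr
    rw [le_div_iff₀ hε]
    nlinarith
  have hL : IsCompact L := by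
    refine Metric.isCompact_of_isClosed_isBounded (isClosed_le (by fun_prop) (by fun_prop)) ?_
    exact isBounded_iff_forall_norm_le.2 ⟨_, key⟩
  have hLp : L ⊆ pf f k '' ball 0 1 := by
    intro ζ hζ
    by_cases h0 : ζ = 0
    · exact ⟨0, by simp, by rw [h0, p_zero]⟩
    · rw [h.p_mem h0]
      refine ⟨k + ζ⁻¹, h.mem_of_norm_gt ?_, by simp⟩
      have h1 : (M + ε) * ‖ζ‖ ≤ ‖ζ * k + 1‖ := hζ
      have h2 : ζ * k + 1 = ζ * (k + ζ⁻¹) := by field_simp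
      rw [h2, norm_mul, mul_comm] at h1
      have := le_of_mul_le_mul_left h1 (norm_pos_iff.2 h0)
      linarith
  obtain ⟨r, hr, hr'⟩ := h.proper hk hL hLp
  refine ⟨r, hr, fun z hz hrz h0 => ?_⟩
  by_contra hcon
  push Not at hcon
  refine absurd (hr' z hz ?_) (not_le.2 hrz)
  show (M + ε) * ‖pf f k z‖ ≤ ‖pf f k z * k + 1‖
  have hne := sub_ne_zero.2 (h.f_ne hz h0 hk)
  have h2 : pf f k z * k + 1 = pf f k z * f z := by
    rw [p_ne h0]; field_simp; ring
  rw [h2, norm_mul, mul_comm]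
  gcongr

theorem Q_le {z : ℂ} (hz : z ∈ ball (0:ℂ) 1) : ‖Qf f z‖ ≤ M := by
  refine le_of_forall_pos_le_add fun ε hε => ?_
  obtain ⟨r, hr, hr'⟩ := h.outer hε
  have hz1 : ‖z‖ < 1 := mem_ball_zero_iff.1 hz
  obtain ⟨ρ, hρ, hρ1⟩ := exists_between (max_lt (max_lt hr hz1) one_pos)
  simp only [max_lt_iff] at hρ
  obtain ⟨⟨h1, h2⟩, h3⟩ := hρ
  have hd : DiffContOnCl ℂ (Qf f) (ball 0 ρ) := by
    apply DifferentiableOn.diffContOnCl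
    rw [closure_ball _ h3.ne']
    exact h.Q_diff.mono (closedBall_subset_ball hρ1)
  refine Complex.norm_le_of_forall_mem_frontier_norm_le isBounded_ball hd (C := M + ε) ?_
    (subset_closure (mem_ball_zero_iff.2 h2))
  intro w hw
  rw [frontier_ball _ h3.ne', mem_sphere_zero_iff_norm] at hw
  have hw0 : w ≠ 0 := norm_pos_iff.1 (hw ▸ h3)
  have hw1 : w ∈ ball (0:ℂ) 1 := mem_ball_zero_iff.2 (hw ▸ hρ1)
  rw [Qf_ne hw0, norm_mul, hw]
  have := hr' w hw1 (hw ▸ h1) hw0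
  nlinarith [norm_nonneg (f w)]

theorem f_le {z : ℂ} (hz : z ∈ ball (0:ℂ) 1) (h0 : z ≠ 0) : ‖f z‖ ≤ M / ‖z‖ := by
  have := h.Q_le hz
  rw [Qf_ne h0, norm_mul] at this
  rw [le_div_iff₀ (norm_pos_iff.2 h0)]
  linarith

/-- boundary values lie in `K` -/
theorem bdry {ι : Type*} {l : Filter ι} [l.NeBot] {z : ι → ℂ} {w : ℂ}
    (hz : ∀ᶠ i in l, z i ∈ ball (0:ℂ) 1 \ {0}) (hz1 : Tendsto (fun i => ‖z i‖) l (𝓝 1))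
    (hw : Tendsto (fun i => f (z i)) l (𝓝 w)) : w ∈ K := by
  by_contra hwK
  have hcl : w ∈ closure (unbddComp K) := by
    refine mem_closure_of_tendsto hw ?_
    filter_upwards [hz] with i hi using h.f_mem hi.1 hi.2
  have hwU := unbddComp_closure h.cpt.isClosed hcl hwK
  obtain ⟨k, hk⟩ := h.ne
  have hwk : w - k ≠ 0 := sub_ne_zero.2 fun he => hwK (he ▸ hk)
  have hmem : (w - k)⁻¹ ∈ pf f k '' ball 0 1 := (h.p_mem (inv_ne_zero hwk)).2 ⟨w, hwU, rfl⟩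
  have ho := inj_isOpen_image isOpen_ball (h.p_diff hk) (h.p_inj hk) isOpen_ball Subset.rfl
  obtain ⟨L, hL, hmL, hLs⟩ := exists_compact_subset ho hmem
  obtain ⟨r, hr, hr'⟩ := h.proper hk hL hLs
  have ht : Tendsto (fun i => (f (z i) - k)⁻¹) l (𝓝 (w - k)⁻¹) :=
    (hw.sub_const k).inv₀ hwk
  have h1 := ht.eventually (isOpen_interior.mem_nhds hmL)
  have h2 := hz1.eventually (lt_mem_nhds hr)
  obtain ⟨i, ⟨hi, hi1⟩, hi2⟩ := ((hz.and h1).and h2).exists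
  refine absurd (hr' (z i) hi.1 ?_) (not_le.2 hi2)
  rw [p_ne hi.2]
  exact interior_subset hi1
end RM


/-- logarithmic coordinates -/
noncomputable def psi (f : ℂ → ℂ) (w : ℂ) : ℂ := f (Complex.exp (-w))

theorem exp_mem {w : ℂ} (hw : 0 < w.re) : Complex.exp (-w) ∈ ball (0:ℂ) 1 := by
  rw [mem_ball_zero_iff, Complex.norm_exp]
  simpa using hw

theorem isOpen_hp : IsOpen {w : ℂ | 0 < w.re} := isOpen_lt continuous_const Complex.continuous_re

theorem hasDerivAt_hor (u c : ℝ) : HasDerivAt (fun u : ℝ => (⟨u, c⟩ : ℂ)) 1 u := by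
  have : (fun u : ℝ => (⟨u, c⟩ : ℂ)) = fun u : ℝ => (u : ℂ) + c * Complex.I := by
    ext u; apply Complex.ext <;> simp
  rw [this]
  exact (Complex.ofRealCLM.hasDerivAt).add_const _

theorem hasDerivAt_ver (u c : ℝ) : HasDerivAt (fun c : ℝ => (⟨u, c⟩ : ℂ)) Complex.I c := by
  have : (fun c : ℝ => (⟨u, c⟩ : ℂ)) = fun c : ℝ => (u : ℂ) + c * Complex.I := by
    ext c; apply Complex.ext <;> simp
  rw [this]
  have := (Complex.ofRealCLM.hasDerivAt (x := c)).mul_const Complex.I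
  simpa using this.const_add (u : ℂ)

theorem continuous_mk : Continuous (fun p : ℝ × ℝ => (⟨p.1, p.2⟩ : ℂ)) := by
  exact Complex.equivRealProdCLM.symm.continuous

theorem continuous_hor (c : ℝ) : Continuous (fun u : ℝ => (⟨u, c⟩ : ℂ)) := by
  have : Continuous (fun u : ℝ => (u, c)) := by fun_prop
  exact continuous_mk.comp this

theorem continuous_ver (u : ℝ) : Continuous (fun c : ℝ => (⟨u, c⟩ : ℂ)) := by
  have : Continuous (fun c : ℝ => (u, c)) := by fun_prop
  exact continuous_mk.comp this

/-- derivative size in coordinates -/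
noncomputable def spd (f : ℂ → ℂ) (p : ℝ × ℝ) : ENNReal := ‖deriv (psi f) ⟨p.1, p.2⟩‖ₑ

theorem spd_meas (f : ℂ → ℂ) : Measurable (spd f) :=
  ((measurable_deriv (psi f)).comp continuous_mk.measurable).enorm

/-- The ray at height `c` lands at `p`. -/
def Lands (f : ℂ → ℂ) (c : ℝ) (p : ℂ) : Prop :=
  Tendsto (fun u : ℝ => psi f ⟨u, c⟩) (𝓝[>] 0) (𝓝 p)

/-- uniform area bound -/
noncomputable def areaBd (M : ℝ) : ENNReal := MeasureTheory.volume (closedBall (0:ℂ) (M * Real.exp 1))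

theorem areaBd_lt (M : ℝ) : areaBd M < ⊤ := by
  unfold areaBd
  exact (isCompact_closedBall _ _).measure_lt_top

namespace RM
variable {K : Set ℂ} {f : ℂ → ℂ} {M : ℝ} (h : RM K f M)
include h

theorem psi_diff : DifferentiableOn ℂ (psi f) {w | 0 < w.re} := by
  refine h.nrm.1.comp (by fun_prop) ?_
  intro w hw
  exact ⟨exp_mem hw, Complex.exp_ne_zero _⟩

theorem psi_diffAt {w : ℂ} (hw : 0 < w.re) : DifferentiableAt ℂ (psi f) w :=
  h.psi_diff.differentiableAt (isOpen_hp.mem_nhds hw)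

theorem psi_mem {w : ℂ} (hw : 0 < w.re) : psi f w ∈ unbddComp K :=
  h.f_mem (exp_mem hw) (Complex.exp_ne_zero _)

theorem psi_ne {w : ℂ} (hw : 0 < w.re) {k : ℂ} (hk : k ∈ K) : psi f w ≠ k :=
  h.f_ne (exp_mem hw) (Complex.exp_ne_zero _) hk

theorem psi_le {w : ℂ} (hw : 0 < w.re) : ‖psi f w‖ ≤ M * Real.exp w.re := by
  have := h.f_le (exp_mem hw) (Complex.exp_ne_zero _)
  rw [Complex.norm_exp, Complex.neg_re, Real.exp_neg, div_inv_eq_mul] at this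
  exact this

theorem psi_inj {w w' : ℂ} (hw : 0 < w.re) (hw' : 0 < w'.re) (he : psi f w = psi f w') :
    ∃ n : ℤ, w = w' + n * (2 * Real.pi * Complex.I) := by
  have := h.nrm.2.1 ⟨exp_mem hw, Complex.exp_ne_zero _⟩ ⟨exp_mem hw', Complex.exp_ne_zero _⟩ he
  obtain ⟨n, hn⟩ := Complex.exp_eq_exp_iff_exists_int.1 this
  refine ⟨-n, ?_⟩
  push_cast
  linear_combination -hn

theorem psi_asym {ε : ℝ} (hε : 0 < ε) : ∃ R > 0, ∀ w : ℂ, R < w.re →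
    ‖Complex.exp (-w) * psi f w - Qf f 0‖ < ε := by
  obtain ⟨δ, hδ, hd⟩ := Metric.continuousAt_iff.1 h.Q_cont0 ε hε
  refine ⟨max 1 (-Real.log δ), by positivity, fun w hw => ?_⟩
  have h1 := (max_lt_iff.1 hw).2
  have := @hd (Complex.exp (-w)) (by
    rw [dist_zero_right, Complex.norm_exp, Complex.neg_re]
    rw [← Real.lt_log_iff_exp_lt hδ]
    linarith)
  rwa [Qf_ne (Complex.exp_ne_zero _), dist_eq_norm] at this

theorem psi_bdry {ι : Type*} {l : Filter ι} [l.NeBot] {z : ι → ℂ} {w : ℂ}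
    (hz : ∀ᶠ i in l, 0 < (z i).re) (hz1 : Tendsto (fun i => (z i).re) l (𝓝 0))
    (hw : Tendsto (fun i => psi f (z i)) l (𝓝 w)) : w ∈ K := by
  refine h.bdry (z := fun i => Complex.exp (-(z i))) ?_ ?_ hw
  · filter_upwards [hz] with i hi
    exact ⟨exp_mem hi, Complex.exp_ne_zero _⟩
  · simp only [Complex.norm_exp, Complex.neg_re]
    have : Tendsto (fun i => Real.exp (-(z i).re)) l (𝓝 (Real.exp (-0))) :=
      (Real.continuous_exp.tendsto _).comp hz1.neg
    simpa using this

theorem lands_mem {c : ℝ} {p : ℂ} (hl : Lands f c p) : p ∈ K := by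
  refine h.psi_bdry (l := 𝓝[>] (0:ℝ)) (z := fun u : ℝ => ⟨u, c⟩) ?_ ?_ hl
  · filter_upwards [self_mem_nhdsWithin] with u hu using hu
  · exact tendsto_nhdsWithin_of_tendsto_nhds tendsto_id

omit h in
theorem det_smulRight (a : ℂ) :
    ((ContinuousLinearMap.toSpanSingleton ℂ a).restrictScalars ℝ : ℂ →L[ℝ] ℂ).det = ‖a‖ ^ 2 := by
  rw [← Complex.normSq_eq_norm_sq, ← Algebra.norm_complex_apply, Algebra.norm_apply,
    ContinuousLinearMap.det]
  congr 1
  ext <;> simp [mul_comm]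

theorem area (c0 : ℝ) : ∫⁻ p in Ioo (0:ℝ) 1 ×ˢ Ioo c0 (c0 + 2 * Real.pi), spd f p ^ 2 ≤ areaBd M := by
  let R : Set ℂ := Complex.measurableEquivRealProd ⁻¹' (Ioo (0:ℝ) 1 ×ˢ Ioo c0 (c0 + 2 * Real.pi))
  have hR : MeasurableSet R :=
    Complex.measurableEquivRealProd.measurable (measurableSet_Ioo.prod measurableSet_Ioo)
  have hRm : ∀ w : ℂ, w ∈ R ↔ (0 < w.re ∧ w.re < 1) ∧ (c0 < w.im ∧ w.im < c0 + 2 * Real.pi) := by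
    intro w
    simp [R, Complex.measurableEquivRealProd_apply]
  have h1 := MeasureTheory.lintegral_abs_det_fderiv_eq_addHaar_image MeasureTheory.volume hR
    (f := psi f) (f' := fun w => (ContinuousLinearMap.toSpanSingleton ℂ (deriv (psi f) w)).restrictScalars ℝ)
    (by
      intro w hw
      have := (h.psi_diffAt ((hRm w).1 hw).1.1).hasDerivAt.hasFDerivAt
      exact (this.restrictScalars ℝ).hasFDerivWithinAt)
    (by
      intro w hw w' hw' he
      rw [hRm] at hw hw'
      obtain ⟨n, hn⟩ := h.psi_inj hw.1.1 hw'.1.1 he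
      refine exp_eq_im_lt (by rw [hn, Complex.exp_add, Complex.exp_int_mul_two_pi_mul_I, mul_one]) ?_
      rw [abs_lt]
      constructor <;> linarith [hw.2.1, hw.2.2, hw'.2.1, hw'.2.2])
  have h2 : ∫⁻ p in Ioo (0:ℝ) 1 ×ˢ Ioo c0 (c0 + 2 * Real.pi), spd f p ^ 2
      = ∫⁻ w in R, ‖deriv (psi f) w‖ₑ ^ 2 := by
    rw [← Complex.volume_preserving_equiv_real_prod.setLIntegral_comp_preimage_emb
      Complex.measurableEquivRealProd.measurableEmbedding]
    rfl
  rw [h2]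
  have h3 : ∀ w, ENNReal.ofReal |((ContinuousLinearMap.toSpanSingleton ℂ (deriv (psi f) w)).restrictScalars ℝ
      : ℂ →L[ℝ] ℂ).det| = ‖deriv (psi f) w‖ₑ ^ 2 := by
    intro w
    rw [det_smulRight, abs_of_nonneg (by positivity), ENNReal.ofReal_pow (norm_nonneg _),
      ofReal_norm]
  simp only [h3] at h1
  rw [h1]
  refine MeasureTheory.measure_mono ?_
  rintro _ ⟨w, hw, rfl⟩
  rw [hRm] at hw
  rw [mem_closedBall_zero_iff]
  refine (h.psi_le hw.1.1).trans ?_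
  have := h.pos
  gcongr
  exact hw.1.2.le

theorem var_hor {c u₀ u₁ : ℝ} (h0 : 0 < u₀) (h1 : u₀ ≤ u₁) :
    ‖psi f ⟨u₁, c⟩ - psi f ⟨u₀, c⟩‖ₑ ≤ ∫⁻ u in Icc u₀ u₁, spd f (u, c) := by
  have hd : ∀ u : ℝ, 0 < u → HasDerivAt (fun u : ℝ => psi f ⟨u, c⟩) (deriv (psi f) ⟨u, c⟩) u := by
    intro u hu
    have := (h.psi_diffAt (w := ⟨u, c⟩) hu).hasDerivAt.scomp u (hasDerivAt_hor u c)
    simpa using! this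
  have hcd : ContDiffOn ℝ 1 (fun u : ℝ => psi f ⟨u, c⟩) (Icc u₀ u₁) := by
    have h2 : ContDiffOn ℝ 1 (psi f) {w | 0 < w.re} :=
      (h.psi_diff.contDiffOn isOpen_hp).restrict_scalars ℝ
    refine h2.comp (t := {w : ℂ | 0 < w.re}) (g := psi f) (f := fun u : ℝ => (⟨u, c⟩ : ℂ)) ?_ ?_
    · have : (fun u : ℝ => (⟨u, c⟩ : ℂ)) = fun u : ℝ => (u : ℂ) + c * Complex.I := by
        ext u; apply Complex.ext <;> simp
      rw [this]
      exact (Complex.ofRealCLM.contDiff.add contDiff_const).contDiffOn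
    · intro u hu
      exact h0.trans_le hu.1
  refine (enorm_sub_le_lintegral_deriv_of_contDiffOn_Icc hcd h1).trans_eq ?_
  refine MeasureTheory.setLIntegral_congr_fun measurableSet_Icc ?_
  intro u hu
  simp only [(hd u (h0.trans_le hu.1)).deriv, spd]

theorem var_ver {u c₀ c₁ : ℝ} (h0 : 0 < u) (h1 : c₀ ≤ c₁) :
    ‖psi f ⟨u, c₁⟩ - psi f ⟨u, c₀⟩‖ₑ ≤ ∫⁻ c in Icc c₀ c₁, spd f (u, c) := by
  have hd : ∀ c : ℝ, HasDerivAt (fun c : ℝ => psi f ⟨u, c⟩) (Complex.I * deriv (psi f) ⟨u, c⟩) c := by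
    intro c
    have := (h.psi_diffAt (w := ⟨u, c⟩) h0).hasDerivAt.scomp c (hasDerivAt_ver u c)
    simpa using! this
  have hcd : ContDiffOn ℝ 1 (fun c : ℝ => psi f ⟨u, c⟩) (Icc c₀ c₁) := by
    have h2 : ContDiffOn ℝ 1 (psi f) {w | 0 < w.re} :=
      (h.psi_diff.contDiffOn isOpen_hp).restrict_scalars ℝ
    refine h2.comp (t := {w : ℂ | 0 < w.re}) (g := psi f) (f := fun c : ℝ => (⟨u, c⟩ : ℂ)) ?_ ?_
    · have : (fun c : ℝ => (⟨u, c⟩ : ℂ)) = fun c : ℝ => (u : ℂ) + Complex.ofRealCLM c * Complex.I := by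
        ext c; apply Complex.ext <;> simp
      rw [this]
      exact (contDiff_const.add (Complex.ofRealCLM.contDiff.mul contDiff_const)).contDiffOn
    · intro c hc
      exact h0
  refine (enorm_sub_le_lintegral_deriv_of_contDiffOn_Icc hcd h1).trans_eq ?_
  refine MeasureTheory.setLIntegral_congr_fun measurableSet_Icc ?_
  intro c hc
  have hI : ‖Complex.I‖ₑ = 1 := by rw [← ofReal_norm]; simp
  simp only [(hd c).deriv, spd, enorm_mul, hI, one_mul]

end RM


/-- length of the image of the initial segment of the ray -/
noncomputable def len (f : ℂ → ℂ) (c u₁ : ℝ) : ENNReal := ∫⁻ u in Ioo 0 u₁, spd f (u, c)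

theorem len_meas (f : ℂ → ℂ) (u₁ : ℝ) : Measurable (fun c => len f c u₁) := by
  unfold len
  exact Measurable.lintegral_prod_left' (spd_meas f)

theorem len_mono (f : ℂ → ℂ) (c : ℝ) {u u' : ℝ} (h : u ≤ u') : len f c u ≤ len f c u' :=
  MeasureTheory.lintegral_mono_set (Ioo_subset_Ioo_right h)

theorem len_tendsto {f : ℂ → ℂ} {c u₁ : ℝ} (hu : 0 < u₁) (h : len f c u₁ < ⊤) :
    Tendsto (fun u => len f c u) (𝓝[>] 0) (𝓝 0) := by
  have h1 := MeasureTheory.tendsto_setLIntegral_zero (μ := MeasureTheory.volume.restrict (Ioo 0 u₁))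
    (f := fun u => spd f (u, c)) (l := 𝓝[>] (0:ℝ)) (s := fun u => Ioo 0 u) h.ne (by
      have h2 : Tendsto (fun u : ℝ => MeasureTheory.volume (Ioo 0 u)) (𝓝[>] 0) (𝓝 0) := by
        simp only [Real.volume_Ioo, sub_zero]
        have : Tendsto ENNReal.ofReal (𝓝[>] 0) (𝓝 (ENNReal.ofReal 0)) :=
          tendsto_nhdsWithin_of_tendsto_nhds (ENNReal.continuous_ofReal.tendsto 0)
        simpa using this
      exact tendsto_of_tendsto_of_tendsto_of_le_of_le tendsto_const_nhds h2
        (fun _ => zero_le) (fun u => MeasureTheory.Measure.restrict_apply_le _ _))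
  refine h1.congr' ?_
  filter_upwards [Ioo_mem_nhdsGT hu] with u hu'
  rw [MeasureTheory.Measure.restrict_restrict measurableSet_Ioo, len,
    inter_eq_left.2 (Ioo_subset_Ioo_right hu'.2.le)]

theorem cs_lintegral (f : ℂ → ℂ) (E : Set (ℝ × ℝ)) :
    ∫⁻ p in E, spd f p ≤ (∫⁻ p in E, spd f p ^ 2) ^ (1/2 : ℝ) * (MeasureTheory.volume E) ^ (1/2 : ℝ) := by
  have := ENNReal.lintegral_mul_le_Lp_mul_Lq (MeasureTheory.volume.restrict E)
    (p := 2) (q := 2) Real.HolderConjugate.two_two (f := spd f) (g := fun _ => 1)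
    (spd_meas f).aemeasurable (by fun_prop)
  simpa using this

theorem fubini_len (f : ℂ → ℂ) (u₁ : ℝ) (I : Set ℝ) :
    ∫⁻ c in I, len f c u₁ = ∫⁻ p in Ioo 0 u₁ ×ˢ I, spd f p := by
  rw [MeasureTheory.Measure.volume_eq_prod, ← MeasureTheory.Measure.prod_restrict]
  unfold len
  rw [MeasureTheory.lintegral_prod_symm' _ (spd_meas f)]

namespace RM
variable {K : Set ℂ} {f : ℂ → ℂ} {M : ℝ} (h : RM K f M)
include h

theorem var_len {c u₀ u₁ u₂ : ℝ} (h0 : 0 < u₀) (h1 : 0 < u₁) (h02 : u₀ < u₂) (h12 : u₁ < u₂) :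
    edist (psi f ⟨u₁, c⟩) (psi f ⟨u₀, c⟩) ≤ len f c u₂ := by
  wlog hle : u₀ ≤ u₁ generalizing u₀ u₁
  · rw [edist_comm]
    exact this h1 h0 h12 h02 (not_le.1 hle).le
  rw [edist_eq_enorm_sub]
  refine (h.var_hor h0 hle).trans ?_
  refine MeasureTheory.lintegral_mono_set ?_
  exact fun u hu => ⟨h0.trans_le hu.1, hu.2.trans_lt h12⟩

theorem lands_of_len {c u₁ : ℝ} (hu : 0 < u₁) (hl : len f c u₁ < ⊤) : ∃ p, Lands f c p := by
  refine cauchy_map_iff_exists_tendsto.1 ?_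
  rw [EMetric.cauchy_iff]
  refine ⟨NeBot.ne inferInstance, fun ε hε => ?_⟩
  have h1 := ((len_tendsto hu hl).eventually (gt_mem_nhds hε)).and (Ioo_mem_nhdsGT hu)
  obtain ⟨u₂, h2, h3⟩ := h1.exists
  refine ⟨(fun u : ℝ => psi f ⟨u, c⟩) '' Ioo 0 u₂, image_mem_map (Ioo_mem_nhdsGT h3.1), ?_⟩
  rintro _ ⟨u, hu, rfl⟩ _ ⟨v, hv, rfl⟩
  exact (h.var_len hv.1 hu.1 hv.2 hu.2).trans_lt h2

theorem lands_dist {c u u₁ : ℝ} {p : ℂ} (hp : Lands f c p) (h0 : 0 < u) (h1 : u < u₁) :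
    edist (psi f ⟨u, c⟩) p ≤ len f c u₁ := by
  have h2 : Tendsto (fun v : ℝ => edist (psi f ⟨u, c⟩) (psi f ⟨v, c⟩)) (𝓝[>] 0)
      (𝓝 (edist (psi f ⟨u, c⟩) p)) := tendsto_const_nhds.edist hp
  refine le_of_tendsto h2 ?_
  filter_upwards [Ioo_mem_nhdsGT (h0.trans h1)] with v hv
  exact h.var_len hv.1 h0 hv.2 h1

theorem lint_lt_top (c0 : ℝ) :
    ∫⁻ p in Ioo (0:ℝ) 1 ×ˢ Ioo c0 (c0 + 2 * Real.pi), spd f p < ⊤ := by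
  refine (cs_lintegral f _).trans_lt (ENNReal.mul_lt_top ?_ ?_)
  · exact ENNReal.rpow_lt_top_of_nonneg (by norm_num) ((h.area c0).trans_lt (areaBd_lt M)).ne
  · refine ENNReal.rpow_lt_top_of_nonneg (by norm_num) ?_
    rw [MeasureTheory.Measure.volume_eq_prod, MeasureTheory.Measure.prod_prod]
    simp [Real.volume_Ioo, ENNReal.mul_eq_top]

theorem ae_len : ∀ᵐ c : ℝ, len f c 1 < ⊤ := by
  have h1 : ∀ k : ℤ, ∀ᵐ c : ℝ, c ∈ Ioo (k : ℝ) (k + 2 * Real.pi) → len f c 1 < ⊤ := by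
    intro k
    rw [← MeasureTheory.ae_restrict_iff' measurableSet_Ioo]
    refine MeasureTheory.ae_lt_top (len_meas f 1) ?_
    rw [fubini_len]
    exact (h.lint_lt_top k).ne
  rw [← MeasureTheory.ae_all_iff] at h1
  filter_upwards [h1] with c hc
  refine hc (⌈c⌉ - 1) ⟨?_, ?_⟩
  · push_cast
    have := Int.ceil_lt_add_one c
    linarith
  · push_cast
    have := Int.le_ceil c
    have := Real.pi_gt_three
    linarith

theorem ae_not_lands {k : ℂ} (hk : k ∈ K) : ∀ᵐ c : ℝ, ¬ Lands f c k := by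
  let q : ℂ → ℂ := fun z => Qf f z - z * k
  have hqd : DifferentiableOn ℂ q (ball 0 1) := by
    have := h.Q_diff
    fun_prop
  have hq0 : ∀ z ∈ ball (0:ℂ) 1, q z ≠ 0 := fun z hz => h.Q_ne hz hk
  have hqb : ∀ z ∈ ball (0:ℂ) 1, ‖q z‖ ≤ 2 * M := by
    intro z hz
    refine (norm_sub_le _ _).trans ?_
    rw [norm_mul]
    have h1 := h.Q_le hz
    have h2 := h.bd k hk
    have h3 : ‖z‖ < 1 := mem_ball_zero_iff.1 hz
    nlinarith [norm_nonneg k, norm_nonneg z]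
  let L := Real.log (2 * M)
  let r : ℕ → ℝ := fun n => Real.exp (-(1 / ((n:ℝ) + 1)))
  have hupos : ∀ n : ℕ, 0 < 1 / ((n:ℝ) + 1) := fun n => Nat.one_div_pos_of_nat
  have hr : ∀ n, 0 < r n ∧ r n < 1 := fun n =>
    ⟨Real.exp_pos _, Real.exp_lt_one_iff.2 (by linarith [hupos n])⟩
  have hmem : ∀ n θ, circleMap 0 (r n) θ ∈ ball (0:ℂ) 1 := by
    intro n θ
    rw [mem_ball_zero_iff, norm_circleMap_zero, abs_of_pos (hr n).1]
    exact (hr n).2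
  let v : ℕ → ℝ → ℝ := fun n θ => L - Real.log ‖q (circleMap 0 (r n) θ)‖
  have hvc : ∀ n, Continuous (v n) := by
    intro n
    have : Continuous fun θ => q (circleMap 0 (r n) θ) :=
      hqd.continuousOn.comp_continuous (continuous_circleMap _ _) (hmem n)
    exact continuous_const.sub (this.norm.log fun θ => norm_ne_zero_iff.2 (hq0 _ (hmem n θ)))
  have hv0 : ∀ n θ, 0 ≤ v n θ := by
    intro n θ
    have := Real.log_le_log (norm_pos_iff.2 (hq0 _ (hmem n θ))) (hqb _ (hmem n θ))
    simp only [v, L]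
    linarith
  have hInteg : ∀ n, ∫ θ in (0:ℝ)..2 * Real.pi, v n θ = 2 * Real.pi * (L - Real.log ‖q 0‖) := by
    intro n
    have h1 : Real.circleAverage (fun z => Real.log ‖q z‖) 0 (r n) = Real.log ‖q 0‖ := by
      apply InnerProductSpace.HarmonicOnNhd.circleAverage_eq
      intro z hz
      have hz' : z ∈ ball (0:ℂ) 1 := by
        rw [abs_of_pos (hr n).1, mem_closedBall_zero_iff] at hz
        exact mem_ball_zero_iff.2 (hz.trans_lt (hr n).2)
      exact AnalyticAt.harmonicAt_log_norm (hqd.analyticAt (isOpen_ball.mem_nhds hz')) (hq0 z hz')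
    rw [Real.circleAverage_def, smul_eq_mul, inv_mul_eq_iff_eq_mul₀ Real.two_pi_pos.ne'] at h1
    have hc2 : Continuous fun θ => Real.log ‖q (circleMap 0 (r n) θ)‖ := by
      have : Continuous fun θ => q (circleMap 0 (r n) θ) :=
        hqd.continuousOn.comp_continuous (continuous_circleMap _ _) (hmem n)
      exact this.norm.log fun θ => norm_ne_zero_iff.2 (hq0 _ (hmem n θ))
    simp only [v]
    rw [intervalIntegral.integral_sub (by simp) (hc2.intervalIntegrable _ _), h1]
    simp
    ring
  have hF : ∀ n, ∫⁻ θ in Ioc 0 (2 * Real.pi), ENNReal.ofReal (v n θ)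
      = ENNReal.ofReal (2 * Real.pi * (L - Real.log ‖q 0‖)) := by
    intro n
    rw [← hInteg n, intervalIntegral.integral_of_le Real.two_pi_pos.le,
      MeasureTheory.ofReal_integral_eq_lintegral_ofReal]
    · exact (hvc n).integrableOn_Ioc
    · exact Eventually.of_forall (hv0 n)
  have hfat := MeasureTheory.lintegral_liminf_le (μ := MeasureTheory.volume.restrict (Ioc 0 (2 * Real.pi)))
    (f := fun n θ => ENNReal.ofReal (v n θ)) (u := atTop)
    (fun n => (hvc n).measurable.ennreal_ofReal)
  simp only [hF] at hfat
  have hae := MeasureTheory.ae_lt_top (Measurable.liminf fun n => (hvc n).measurable.ennreal_ofReal)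
    (hfat.trans_lt (by simp)).ne
  rw [MeasureTheory.ae_restrict_iff' measurableSet_Ioc] at hae
  -- transport
  have key : ∀ (m : ℤ), ∀ᵐ c : ℝ, (m * (2 * Real.pi) - c) ∈ Ioc 0 (2 * Real.pi) → ¬ Lands f c k := by
    intro m
    have h1 := (MeasureTheory.Measure.measurePreserving_sub_left
      (MeasureTheory.volume : MeasureTheory.Measure ℝ) (m * (2 * Real.pi))).quasiMeasurePreserving.ae hae
    filter_upwards [h1] with c hc hcm hl
    have hlt := hc hcm
    refine hlt.ne ?_
    refine Tendsto.liminf_eq ?_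
    have hu0 : Tendsto (fun n : ℕ => 1 / ((n:ℝ) + 1)) atTop (𝓝[>] 0) :=
      tendsto_nhdsWithin_iff.2 ⟨tendsto_one_div_add_atTop_nhds_zero_nat, Eventually.of_forall hupos⟩
    have hl2 := (hl.comp hu0)
    have hz : ∀ n, circleMap 0 (r n) (m * (2 * Real.pi) - c)
        = Complex.exp (-(⟨1 / ((n:ℝ) + 1), c⟩ : ℂ)) := by
      intro n
      simp only [circleMap, zero_add, r, Complex.ofReal_exp]
      rw [← Complex.exp_add, Complex.exp_eq_exp_iff_exists_int]
      refine ⟨m, ?_⟩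
      generalize 1 / ((n:ℝ) + 1) = a
      apply Complex.ext <;> simp
      ring
    have hq : Tendsto (fun n => q (circleMap 0 (r n) (m * (2 * Real.pi) - c))) atTop (𝓝 0) := by
      rw [tendsto_zero_iff_norm_tendsto_zero]
      have h3 : Tendsto (fun n : ℕ => ‖psi f ⟨1 / ((n:ℝ) + 1), c⟩ - k‖) atTop (𝓝 0) := by
        have := (hl2.sub_const k).norm
        simpa using this
      refine squeeze_zero (fun _ => norm_nonneg _) (fun n => ?_) h3
      have hz1 := hmem n (m * (2 * Real.pi) - c)
      rw [hz n] at hz1 ⊢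
      simp only [q, Qf_ne (Complex.exp_ne_zero _), ← mul_sub, norm_mul]
      exact mul_le_of_le_one_left (norm_nonneg _) (mem_ball_zero_iff.1 hz1).le
    have hlog : Tendsto (fun n => Real.log ‖q (circleMap 0 (r n) (m * (2 * Real.pi) - c))‖) atTop atBot := by
      refine Real.tendsto_log_nhdsGT_zero.comp (tendsto_nhdsWithin_iff.2 ⟨?_, ?_⟩)
      · simpa using hq.norm
      · exact Eventually.of_forall fun n => norm_pos_iff.2 (hq0 _ (hmem n _))
    refine ENNReal.tendsto_ofReal_atTop.comp ?_
    simp only [v, sub_eq_add_neg]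
    exact tendsto_const_nhds.add_atTop (tendsto_neg_atBot_atTop.comp hlog)
  rw [← MeasureTheory.ae_all_iff] at key
  filter_upwards [key] with c hc
  obtain ⟨m, hm⟩ := existsUnique_add_zsmul_mem_Ioc Real.two_pi_pos (-c) 0 |>.exists
  refine hc m ?_
  simpa [sub_eq_add_neg, add_comm] using hm

end RM


theorem hurwitz {ι : Type*} {l : Filter ι} [l.NeBot] {F : ι → ℂ → ℂ} {G : ℂ → ℂ}
    (hF : ∀ i, DifferentiableOn ℂ (F i) (ball 0 1)) (hne : ∀ i, ∀ z ∈ ball (0:ℂ) 1, F i z ≠ 0)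
    (hlim : TendstoLocallyUniformlyOn F G l (ball 0 1)) :
    (∀ z ∈ ball (0:ℂ) 1, G z ≠ 0) ∨ (∀ z ∈ ball (0:ℂ) 1, G z = 0) := by
  have hG : DifferentiableOn ℂ G (ball 0 1) :=
    hlim.differentiableOn (Eventually.of_forall hF) isOpen_ball
  by_contra hcon
  push Not at hcon
  obtain ⟨⟨z₀, hz₀, hGz⟩, ⟨z₁, hz₁, hG1⟩⟩ := hcon
  rcases (hG.analyticOnNhd isOpen_ball z₀ hz₀).eventually_eq_zero_or_eventually_ne_zero with h | h
  · exact hG1 ((hG.analyticOnNhd isOpen_ball).eqOn_zero_of_preconnected_of_eventuallyEq_zero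
      (convex_ball _ _).isPreconnected hz₀ h hz₁)
  · rw [eventually_nhdsWithin_iff] at h
    obtain ⟨r, hr, hr'⟩ := Metric.nhds_basis_closedBall.eventually_iff.1
      (h.and (isOpen_ball.mem_nhds hz₀))
    have hsub : closedBall z₀ r ⊆ ball 0 1 := fun z hz => (hr' hz).2
    have hs : IsCompact (sphere z₀ r) := isCompact_sphere _ _
    have hsn : (sphere z₀ r).Nonempty := NormedSpace.sphere_nonempty.2 hr.le
    obtain ⟨w, hw, hmin⟩ := hs.exists_isMinOn hsn
      ((hG.continuousOn.mono (sphere_subset_closedBall.trans hsub)).norm)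
    have hm : 0 < ‖G w‖ := norm_pos_iff.2 ((hr' (sphere_subset_closedBall hw)).1
      (ne_of_mem_sphere hw hr.ne'))
    have hu : TendstoUniformlyOn F G l (closedBall z₀ r) :=
      (tendstoLocallyUniformlyOn_iff_tendstoUniformlyOn_of_compact (isCompact_closedBall _ _)).1
        (hlim.mono hsub)
    obtain ⟨i, hi⟩ := (Metric.tendstoUniformlyOn_iff.1 hu (‖G w‖ / 3) (by positivity)).exists
    have hd : DiffContOnCl ℂ (fun z => (F i z)⁻¹) (ball z₀ r) := by
      apply DifferentiableOn.diffContOnCl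
      rw [closure_ball _ hr.ne']
      exact ((hF i).mono hsub).inv fun z hz => hne i z (hsub hz)
    have hb := Complex.norm_le_of_forall_mem_frontier_norm_le isBounded_ball hd
      (C := (2 * ‖G w‖ / 3)⁻¹) (fun z hz => by
        rw [frontier_ball _ hr.ne'] at hz
        have h1 := hi z (sphere_subset_closedBall hz)
        have h2 : ‖G w‖ ≤ ‖G z‖ := hmin hz
        rw [norm_inv]
        gcongr
        rw [dist_eq_norm] at h1
        have := norm_sub_norm_le (G z) (F i z)
        linarith) (subset_closure (mem_ball_self hr))
    have h1 := hi z₀ (mem_closedBall_self hr.le)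
    rw [hGz, dist_zero_left] at h1
    rw [norm_inv] at hb
    have h3 := norm_pos_iff.2 (hne i z₀ hz₀)
    have := (inv_le_inv₀ h3 (by positivity)).1 hb
    linarith

theorem equi_lip {F : ℂ → ℂ} {M : ℝ} (hF : DifferentiableOn ℂ F (ball 0 1))
    (hb : ∀ z ∈ ball (0:ℂ) 1, ‖F z‖ ≤ M) {z w : ℂ} (hz : z ∈ ball (0:ℂ) 1)
    (hw : w ∈ ball z (1 - ‖z‖)) : dist (F w) (F z) ≤ 2 * M / (1 - ‖z‖) * dist w z := by
  have hsub : ball z (1 - ‖z‖) ⊆ ball 0 1 := by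
    apply ball_subset_ball'
    simp
  refine Complex.dist_le_div_mul_dist_of_mapsTo_ball (hF.mono hsub) ?_ hw
  intro x hx
  rw [mem_closedBall, dist_eq_norm]
  have := norm_sub_le (F x) (F z)
  linarith [hb x (hsub hx), hb z hz]

theorem montel {ι : Type*} (u : Ultrafilter ι) {F : ι → ℂ → ℂ} {M : ℝ}
    (hF : ∀ i, DifferentiableOn ℂ (F i) (ball 0 1)) (hb : ∀ i, ∀ z ∈ ball (0:ℂ) 1, ‖F i z‖ ≤ M) :
    ∃ G, TendstoLocallyUniformlyOn F G u (ball 0 1) := by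
  have h1 : ∀ z, ∃ g, z ∈ ball (0:ℂ) 1 → Tendsto (fun i => F i z) u (𝓝 g) := by
    intro z
    by_cases hz : z ∈ ball (0:ℂ) 1
    · obtain ⟨g, _, hg⟩ := (isCompact_closedBall (0:ℂ) M).ultrafilter_le_nhds (u.map fun i => F i z)
        (by
          rw [le_principal_iff]
          exact Eventually.of_forall (f := (u : Filter ι)) fun i => mem_closedBall_zero_iff.2 (hb i z hz))
      exact ⟨g, fun _ => hg⟩
    · exact ⟨0, fun h => absurd h hz⟩
  choose G hG using h1
  refine ⟨G, ?_⟩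
  rw [Metric.tendstoLocallyUniformlyOn_iff]
  intro ε hε z hz
  have hz1 : 0 < 1 - ‖z‖ := by
    have := mem_ball_zero_iff.1 hz
    linarith
  have hM : 0 ≤ M := (norm_nonneg _).trans (hb (nonempty_of_neBot (u : Filter ι)).some z hz)
  let δ := min (1 - ‖z‖) (ε / 3 / (2 * M / (1 - ‖z‖) + 1))
  have hδ : 0 < δ := lt_min hz1 (by positivity)
  have hsub : ball z δ ⊆ ball 0 1 := by
    apply ball_subset_ball'
    have : δ ≤ 1 - ‖z‖ := min_le_left _ _
    simp
    linarith
  have key : ∀ i, ∀ w ∈ ball z δ, dist (F i w) (F i z) ≤ ε / 3 := by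
    intro i w hw
    refine (equi_lip (hF i) (hb i) hz (ball_subset_ball (min_le_left _ _) hw)).trans ?_
    have h2 : dist w z ≤ ε / 3 / (2 * M / (1 - ‖z‖) + 1) :=
      (mem_ball.1 hw).le.trans (min_le_right _ _)
    rw [le_div_iff₀ (by positivity)] at h2
    have := dist_nonneg (x := w) (y := z)
    nlinarith
  have key2 : ∀ w ∈ ball z δ, dist (G w) (G z) ≤ ε / 3 := fun w hw =>
    le_of_tendsto ((hG w (hsub hw)).dist (hG z hz)) (Eventually.of_forall fun i => key i w hw)
  refine ⟨ball z δ, mem_nhdsWithin_of_mem_nhds (ball_mem_nhds _ hδ), ?_⟩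
  filter_upwards [(hG z hz).eventually (ball_mem_nhds _ (show 0 < ε / 3 by positivity))] with i hi w hw
  have h2 := key i w hw
  have h3 := key2 w hw
  have h4 : dist (F i z) (G z) < ε / 3 := hi
  have := dist_triangle4 (G w) (G z) (F i z) (F i w)
  rw [dist_comm (G z), dist_comm (F i z) (F i w)] at this
  linarith

theorem preconn_punct {ρ : ℝ} (hρ : 0 < ρ) : IsPreconnected (ball (0:ℂ) ρ \ {0}) := by
  have h1 : ball (0:ℂ) ρ \ {0} = Complex.exp '' {w : ℂ | w.re < Real.log ρ} := by
    ext z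
    constructor
    · rintro ⟨h1, h2⟩
      have h2 : z ≠ 0 := h2
      refine ⟨Complex.log z, ?_, Complex.exp_log h2⟩
      show (Complex.log z).re < _
      rw [Complex.log_re]
      exact Real.log_lt_log (norm_pos_iff.2 h2) (mem_ball_zero_iff.1 h1)
    · rintro ⟨w, hw, rfl⟩
      refine ⟨?_, Complex.exp_ne_zero _⟩
      rw [mem_ball_zero_iff, Complex.norm_exp]
      exact (Real.lt_log_iff_exp_lt hρ).1 hw
  rw [h1]
  exact (convex_halfSpace_re_lt _).isPreconnected.image _ Complex.continuous_exp.continuousOn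

namespace RM
variable {K : Set ℂ} {f : ℂ → ℂ} {M : ℝ} (h : RM K f M)
include h

theorem sub_schwarz {ρ : ℝ} (hρ : 0 < ρ) {q : ℂ → ℂ} (hq : DifferentiableOn ℂ q (ball 0 ρ))
    (hne : ∀ k ∈ K, ∀ z ∈ ball (0:ℂ) ρ, q z - z * k ≠ 0) {k : ℂ} (hk : k ∈ K) :
    ∃ F : ℂ → ℂ, DifferentiableOn ℂ F (ball 0 ρ) ∧ MapsTo F (ball 0 ρ) (ball 0 1) ∧ F 0 = 0 ∧
      HasDerivAt F (Qf f 0 / q 0) 0 ∧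
      ∀ z ∈ ball (0:ℂ) ρ, F z * (q z - z * k) = z * (Qf f (F z) - F z * k) := by
  have hq0 : q 0 ≠ 0 := by simpa using hne k hk 0 (mem_ball_self hρ)
  have hqc : ContinuousAt q 0 := (hq.continuousOn).continuousAt (ball_mem_nhds _ hρ)
  have hA : (fun z => q z / z) '' (ball (0:ℂ) ρ \ {0}) ⊆ unbddComp K := by
    apply unbddComp_of_mem
    · apply (preconn_punct hρ).image
      exact (hq.continuousOn.mono sdiff_subset).div continuousOn_id fun z hz => hz.2
    · rintro _ ⟨z, hz, rfl⟩ hk'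
      have hz0 : z ≠ 0 := hz.2
      apply hne _ hk' z hz.1
      field_simp
      simp
    · intro hb
      obtain ⟨R, hR⟩ := hb.exists_norm_le
      have h1 : Tendsto (fun z => ‖q z‖) (𝓝[≠] 0) (𝓝 ‖q 0‖) :=
        (hqc.norm.tendsto).mono_left nhdsWithin_le_nhds
      have h2 : Tendsto (fun z : ℂ => R * ‖z‖) (𝓝[≠] 0) (𝓝 (R * ‖(0:ℂ)‖)) :=
        (Continuous.tendsto (by fun_prop) 0).mono_left nhdsWithin_le_nhds
      have h3 : ‖q 0‖ ≤ R * ‖(0:ℂ)‖ := by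
        refine le_of_tendsto_of_tendsto h1 h2 ?_
        filter_upwards [self_mem_nhdsWithin, mem_nhdsWithin_of_mem_nhds (ball_mem_nhds (0:ℂ) hρ)]
          with z hz0 hz
        have h4 := hR _ ⟨z, ⟨hz, hz0⟩, rfl⟩
        simp only [norm_div] at h4
        rwa [div_le_iff₀ (norm_pos_iff.2 hz0)] at h4
      rw [norm_zero, mul_zero] at h3
      exact hq0 (norm_le_zero_iff.1 h3)
  let p : ℂ → ℂ := fun z => z / (q z - z * k)
  have hpd : DifferentiableOn ℂ p (ball 0 ρ) :=
    differentiableOn_id.div (by fun_prop) fun z hz => hne k hk z hz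
  have hpm : ∀ z ∈ ball (0:ℂ) ρ, p z ∈ pf f k '' ball 0 1 := by
    intro z hz
    by_cases hz0 : z = 0
    · exact ⟨0, by simp, by simp [p, hz0, p_zero]⟩
    · rw [h.p_mem (div_ne_zero hz0 (hne k hk z hz))]
      refine ⟨_, hA ⟨z, ⟨hz, hz0⟩, rfl⟩, ?_⟩
      have := hne k hk z hz
      simp only [p]
      field_simp
  let F : ℂ → ℂ := fun z => Function.invFunOn (pf f k) (ball 0 1) (p z)
  have hFd : DifferentiableOn ℂ F (ball 0 ρ) :=
    (inv_differentiableOn isOpen_ball (h.p_diff hk) (h.p_inj hk)).comp hpd hpm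
  have hFm : MapsTo F (ball 0 ρ) (ball 0 1) := fun z hz => Function.invFunOn_mem (hpm z hz)
  have hFe : ∀ z ∈ ball (0:ℂ) ρ, pf f k (F z) = p z := fun z hz => Function.invFunOn_eq (hpm z hz)
  have hF0 : F 0 = 0 := by
    have : p 0 = pf f k 0 := by simp [p, p_zero]
    simp only [F, this]
    exact (h.p_inj hk).leftInvOn_invFunOn (mem_ball_self one_pos)
  have hFQ : ∀ z ∈ ball (0:ℂ) ρ, F z * (q z - z * k) = z * (Qf f (F z) - F z * k) := by
    intro z hz
    have h1 := hFe z hz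
    have h2 := hne k hk z hz
    have h3 := h.Q_ne (hFm hz) hk
    simp only [pf, p] at h1
    rwa [div_eq_div_iff h3 h2] at h1
  refine ⟨F, hFd, hFm, hF0, ?_, hFQ⟩
  rw [hasDerivAt_iff_tendsto_slope_zero]
  have hFc : ContinuousAt F 0 := hFd.continuousOn.continuousAt (ball_mem_nhds _ hρ)
  have hQc : ContinuousAt (Qf f) (F 0) := by
    rw [hF0]
    exact h.Q_diff.continuousOn.continuousAt (ball_mem_nhds _ one_pos)
  have hQF : ContinuousAt (fun z => Qf f (F z)) 0 := ContinuousAt.comp (f := F) hQc hFc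
  have hc : ContinuousAt (fun z => (Qf f (F z) - F z * k) / (q z - z * k)) 0 := by
    refine ContinuousAt.div ?_ ?_ (by simpa using hq0)
    · fun_prop
    · fun_prop
  have h1 := hc.tendsto.mono_left (nhdsWithin_le_nhds (s := {0}ᶜ))
  simp only [hF0, zero_mul, sub_zero] at h1
  refine h1.congr' ?_
  filter_upwards [self_mem_nhdsWithin, mem_nhdsWithin_of_mem_nhds (ball_mem_nhds (0:ℂ) hρ)]
    with z hz0 hz
  have hz0 : z ≠ 0 := hz0
  have h2 := hne k hk z hz
  have h3 := hFQ z hz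
  simp only [zero_add, hF0, sub_zero, smul_eq_mul]
  rw [div_eq_iff h2, mul_assoc, h3]
  field_simp
end RM


/-- An isotopy together with the normalized Riemann maps. -/
structure Sys (Y : Type*) [TopologicalSpace Y] where
  H : ℝ → Y → ℂ
  φ : ℝ → ℂ → ℂ
  M : ℝ
  cont : Continuous (fun p : ℝ × Y => H p.1 p.2)
  inj : ∀ t, Function.Injective (H t)
  pos : 0 < M
  bdd : ∀ t y, ‖H t y‖ ≤ M
  riem : ∀ t, IsNormalizedRiemannMap (unbddComp (range (H t))) (φ t)

namespace Sys
variable {Y : Type*} [TopologicalSpace Y] [CompactSpace Y] [Nontrivial Y] (S : Sys Y)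

theorem contY (t : ℝ) : Continuous (S.H t) :=
  S.cont.comp (Continuous.prodMk_right t)

theorem rm (t : ℝ) : RM (range (S.H t)) (S.φ t) S.M where
  cpt := isCompact_range (S.contY t)
  ne := range_nonempty _
  pos := S.pos
  bd := by
    rintro _ ⟨y, rfl⟩
    exact S.bdd t y
  nrm := S.riem t

theorem carath (s : ℝ) {z : ℂ} (hz : z ∈ ball (0:ℂ) 1) :
    Tendsto (fun t => Qf (S.φ t) z) (𝓝 s) (𝓝 (Qf (S.φ s) z)) := by
  rw [tendsto_iff_ultrafilter]
  intro u hu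
  obtain ⟨G, hG⟩ := montel u (F := fun t => Qf (S.φ t)) (M := S.M) (fun t => (S.rm t).Q_diff)
    (fun t z hz => (S.rm t).Q_le hz)
  have hGd : DifferentiableOn ℂ G (ball 0 1) :=
    hG.differentiableOn (Eventually.of_forall fun t => (S.rm t).Q_diff) isOpen_ball
  have hGt : ∀ z ∈ ball (0:ℂ) 1, Tendsto (fun t => Qf (S.φ t) z) u (𝓝 (G z)) := fun z hz =>
    hG.tendsto_at hz
  suffices ∀ z ∈ ball (0:ℂ) 1, G z = Qf (S.φ s) z by
    rw [← this z hz]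
    exact hGt z hz
  have h0 : (0:ℂ) ∈ ball (0:ℂ) 1 := mem_ball_self one_pos
  -- nonvanishing
  have hur : ∀ y, (∀ z ∈ ball (0:ℂ) 1, G z - z * S.H s y ≠ 0) ∨
      (∀ z ∈ ball (0:ℂ) 1, G z - z * S.H s y = 0) := by
    intro y
    refine hurwitz (l := (u : Filter ℝ)) (F := fun t z => Qf (S.φ t) z - z * S.H t y) ?_ ?_ ?_
    · intro t
      have := (S.rm t).Q_diff
      fun_prop
    · exact fun t z hz => (S.rm t).Q_ne hz (mem_range_self y)
    · have hHy : Tendsto (fun t => S.H t y) u (𝓝 (S.H s y)) :=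
        ((S.cont.comp (Continuous.prodMk_left y)).tendsto s).mono_left hu
      rw [Metric.tendstoLocallyUniformlyOn_iff] at hG ⊢
      intro ε hε x hx
      obtain ⟨t, ht, h1⟩ := hG (ε / 2) (by positivity) x hx
      refine ⟨t ∩ ball 0 1, inter_mem ht self_mem_nhdsWithin, ?_⟩
      filter_upwards [h1, hHy.eventually (ball_mem_nhds _ (half_pos hε))] with τ h2 h3 w hw
      have h4 := h2 w hw.1
      have h5 : dist (S.H τ y) (S.H s y) < ε / 2 := h3
      rw [dist_eq_norm] at h4 h5 ⊢
      have h6 : G w - w * S.H s y - (Qf (S.φ τ) w - w * S.H τ y)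
          = (G w - Qf (S.φ τ) w) + w * (S.H τ y - S.H s y) := by ring
      rw [h6]
      have h7 := norm_add_le (G w - Qf (S.φ τ) w) (w * (S.H τ y - S.H s y))
      rw [norm_mul] at h7
      have h8 := mem_ball_zero_iff.1 hw.2
      nlinarith [norm_nonneg w, norm_nonneg (S.H τ y - S.H s y)]
  have hGne : ∀ k ∈ range (S.H s), ∀ z ∈ ball (0:ℂ) 1, G z - z * k ≠ 0 := by
    rintro _ ⟨y, rfl⟩
    rcases hur y with h1 | h1
    · exact h1
    · exfalso
      have hG0 : G 0 = 0 := by simpa using h1 0 h0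
      obtain ⟨y', hy'⟩ := exists_ne y
      rcases hur y' with h2 | h2
      · exact h2 0 h0 (by simp [hG0])
      · apply hy'
        apply S.inj s
        have hh : (1/2 : ℂ) ∈ ball (0:ℂ) 1 := by
          rw [mem_ball_zero_iff]; norm_num
        have h3 := h1 _ hh
        have h4 := h2 _ hh
        have h5 : (1/2 : ℂ) * (S.H s y' - S.H s y) = 0 := by linear_combination h3 - h4
        simpa [sub_eq_zero] using h5
  obtain ⟨y⟩ : Nonempty Y := inferInstance
  have hk := mem_range_self (f := S.H s) y
  obtain ⟨Cs, hCs, hCs'⟩ := (S.rm s).Q_zero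
  have hG0 : G 0 ≠ 0 := by simpa using hGne _ hk 0 h0
  obtain ⟨F, hFd, hFm, hF0, hF', hFQ⟩ := (S.rm s).sub_schwarz one_pos hGd hGne hk
  have hle1 : Cs ≤ ‖G 0‖ := by
    have := Complex.norm_deriv_le_div_of_mapsTo_ball (R₂ := 1) hFd
      (by rw [hF0]; exact hFm.mono_right ball_subset_closedBall) one_pos
    rw [hF'.deriv, hCs', norm_div, Complex.norm_real, Real.norm_of_nonneg hCs.le, div_one,
      div_le_one (norm_pos_iff.2 hG0)] at this
    exact this
  -- reverse
  have hrev : ∀ ρ ∈ Ioo (0:ℝ) 1, ρ * ‖G 0‖ ≤ Cs := by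
    intro ρ hρ
    have hev : ∀ᶠ t in 𝓝 s, ∀ p ∈ (closedBall (0:ℂ) ρ) ×ˢ (univ : Set Y),
        Qf (S.φ s) p.1 - p.1 * S.H t p.2 ≠ 0 := by
      refine IsCompact.eventually_forall_of_forall_eventually
        ((isCompact_closedBall _ _).prod isCompact_univ) ?_
      rintro ⟨w, y'⟩ ⟨hw, -⟩
      have hw1 : w ∈ ball (0:ℂ) 1 := closedBall_subset_ball hρ.2 hw
      have hQc : ContinuousAt (Qf (S.φ s)) w :=
        (S.rm s).Q_diff.continuousOn.continuousAt (isOpen_ball.mem_nhds hw1)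
      have hc : ContinuousAt (fun q : ℝ × ℂ × Y => Qf (S.φ s) q.2.1 - q.2.1 * S.H q.1 q.2.2)
          (s, w, y') := by
        have h1 : ContinuousAt (fun q : ℝ × ℂ × Y => Qf (S.φ s) q.2.1) (s, w, y') :=
          ContinuousAt.comp (f := fun q : ℝ × ℂ × Y => q.2.1) hQc (by fun_prop)
        have h2 : Continuous (fun q : ℝ × ℂ × Y => S.H q.1 q.2.2) :=
          S.cont.comp (by fun_prop : Continuous fun q : ℝ × ℂ × Y => (q.1, q.2.2))
        exact h1.sub (ContinuousAt.mul (by fun_prop) h2.continuousAt)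
      exact hc.eventually_ne ((S.rm s).Q_ne hw1 (mem_range_self y'))
    have hlim : Tendsto (fun t => ρ * ‖Qf (S.φ t) 0‖) u (𝓝 (ρ * ‖G 0‖)) :=
      ((hGt 0 h0).norm).const_mul ρ
    refine le_of_tendsto hlim ?_
    filter_upwards [hu hev] with t ht
    obtain ⟨F, hFd, hFm, hF0, hF', -⟩ := (S.rm t).sub_schwarz hρ.1
      ((S.rm s).Q_diff.mono (ball_subset_ball hρ.2.le))
      (by
        rintro _ ⟨y', rfl⟩ w hw
        exact ht (w, y') ⟨ball_subset_closedBall hw, mem_univ _⟩) (mem_range_self y)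
    have := Complex.norm_deriv_le_div_of_mapsTo_ball (R₂ := 1) hFd
      (by rw [hF0]; exact hFm.mono_right ball_subset_closedBall) hρ.1
    rw [hF'.deriv, hCs', norm_div, Complex.norm_real, Real.norm_of_nonneg hCs.le,
      div_le_div_iff₀ hCs hρ.1] at this
    linarith
  have hle2 : ‖G 0‖ ≤ Cs := by
    have h1 : Tendsto (fun ρ : ℝ => ρ * ‖G 0‖) (𝓝[<] 1) (𝓝 (1 * ‖G 0‖)) :=
      (Continuous.tendsto (by fun_prop) 1).mono_left nhdsWithin_le_nhds
    rw [one_mul] at h1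
    refine le_of_tendsto h1 ?_
    filter_upwards [Ioo_mem_nhdsLT (zero_lt_one (α := ℝ))] with ρ hρ using hrev ρ hρ
  -- `G 0` is a nonnegative real
  have hGr : G 0 = (Cs : ℂ) := by
    have h1 : Tendsto (fun t => Qf (S.φ t) 0 - ‖Qf (S.φ t) 0‖) u (𝓝 (G 0 - ‖G 0‖)) :=
      (hGt 0 h0).sub ((Complex.continuous_ofReal.tendsto _).comp (hGt 0 h0).norm)
    have h2 : (fun t => Qf (S.φ t) 0 - ‖Qf (S.φ t) 0‖) = fun _ => (0:ℂ) := by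
      ext t
      obtain ⟨c, hc, hc'⟩ := (S.rm t).Q_zero
      rw [hc', Complex.norm_real, Real.norm_of_nonneg hc.le, sub_self]
    rw [h2] at h1
    have h3 := tendsto_nhds_unique h1 tendsto_const_nhds
    rw [sub_eq_zero.1 h3, le_antisymm hle2 hle1]
  have hF1 : deriv F 0 = 1 := by
    rw [hF'.deriv, hCs', hGr, div_self]
    exact_mod_cast hCs.ne'
  have haff := Complex.affine_of_mapsTo_ball_of_norm_dslope_eq_div (R₂ := 1) hFd
    (by rw [hF0]; exact hFm.mono_right ball_subset_closedBall) h0 (by rw [dslope_same, hF1]; simp)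
  intro z hz
  by_cases hz0 : z = 0
  · rw [hz0, hGr, hCs']
  · have h1 := haff hz
    simp only [hF0, dslope_same, hF1, sub_zero, smul_eq_mul, mul_one, zero_add] at h1
    have h2 := hFQ z hz
    rw [h1] at h2
    have h3 := mul_left_cancel₀ hz0 h2
    linear_combination h3

theorem Q_joint : ContinuousOn (fun p : ℝ × ℂ => Qf (S.φ p.1) p.2) (univ ×ˢ ball 0 1) := by
  rintro ⟨s, z⟩ ⟨-, hz⟩
  apply ContinuousAt.continuousWithinAt
  have hz1 : 0 < 1 - ‖z‖ := by
    have := mem_ball_zero_iff.1 hz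
    linarith
  rw [Metric.continuousAt_iff']
  intro ε hε
  have hc := Metric.tendsto_nhds.1 (S.carath s hz) (ε / 2) (half_pos hε)
  have h2 : ∀ᶠ w in 𝓝 z, 2 * S.M / (1 - ‖z‖) * dist w z < ε / 2 := by
    have : Tendsto (fun w => 2 * S.M / (1 - ‖z‖) * dist w z) (𝓝 z)
        (𝓝 (2 * S.M / (1 - ‖z‖) * dist z z)) := Continuous.tendsto (by fun_prop) z
    rw [dist_self, mul_zero] at this
    exact this.eventually (gt_mem_nhds (half_pos hε))
  have h3 := h2.and (ball_mem_nhds z hz1)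
  rw [nhds_prod_eq]
  filter_upwards [hc.prod_mk h3] with p hp
  have h4 := equi_lip (S.rm p.1).Q_diff (fun z hz => (S.rm p.1).Q_le hz) hz hp.2.2
  have := dist_triangle (Qf (S.φ p.1) p.2) (Qf (S.φ p.1) z) (Qf (S.φ s) z)
  linarith [hp.1, hp.2.1]
end Sys


/-- the right half plane -/
def HP : Set ℂ := {w | 0 < w.re}

namespace Sys
variable {Y : Type*} [TopologicalSpace Y] [CompactSpace Y] [Nontrivial Y] (S : Sys Y)

/-- a choice of logarithm of `ψ_t - H_t x` in logarithmic coordinates -/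
structure IsCore (x : Y) (Φ : ℝ → ℂ → ℂ) : Prop where
  cont : ContinuousOn (fun p : ℝ × ℂ => Φ p.1 p.2) (univ ×ˢ HP)
  exp : ∀ t, ∀ w ∈ HP, Complex.exp (Φ t w) = psi (S.φ t) w - S.H t x
  per : ∀ t, ∀ w ∈ HP, Φ t (w + 2 * Real.pi * Complex.I) = Φ t w + 2 * Real.pi * Complex.I
  asym : ∀ t, ∃ L : ℝ, ∀ ε > 0, ∃ R > 0, ∀ w : ℂ, R < w.re → ‖Φ t w - w - L‖ < ε

theorem exists_core (x : Y) : ∃ Φ, S.IsCore x Φ := by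
  let W : Set ((ℝ × ℂ) × ℝ) := {p | p.1.2 ∈ ball (0:ℂ) 1 ∧ p.2 ∈ Icc (0:ℝ) 1}
  let F : (ℝ × ℂ) × ℝ → ℂ := fun p =>
    Qf (S.φ p.1.1) (p.2 * p.1.2) - p.2 * p.1.2 * S.H p.1.1 x
  have hmem : ∀ p ∈ W, (p.2 : ℂ) * p.1.2 ∈ ball (0:ℂ) 1 := by
    rintro p ⟨h1, h2⟩
    rw [mem_ball_zero_iff] at h1 ⊢
    rw [norm_mul, Complex.norm_real, Real.norm_of_nonneg h2.1]
    nlinarith [norm_nonneg p.1.2, h2.2]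
  have hF : ContinuousOn F W := by
    have h1 : ContinuousOn (fun p : (ℝ × ℂ) × ℝ => Qf (S.φ p.1.1) (p.2 * p.1.2)) W :=
      S.Q_joint.comp (f := fun p : (ℝ × ℂ) × ℝ => (p.1.1, (p.2 : ℂ) * p.1.2))
        (by fun_prop) (fun p hp => ⟨mem_univ _, hmem p hp⟩)
    have h2 : Continuous (fun p : (ℝ × ℂ) × ℝ => S.H p.1.1 x) :=
      S.cont.comp (by fun_prop : Continuous fun p : (ℝ × ℂ) × ℝ => (p.1.1, x))
    exact h1.sub (by fun_prop)
  have hF0 : ∀ p ∈ W, F p ≠ 0 := fun p hp => (S.rm p.1.1).Q_ne (hmem p hp) (mem_range_self x)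
  let C : ℝ → ℝ := fun t => ‖Qf (S.φ t) 0‖
  have hC : ∀ t, 0 < C t ∧ Qf (S.φ t) 0 = C t := by
    intro t
    obtain ⟨c, hc, hc'⟩ := (S.rm t).Q_zero
    have : C t = c := by simp only [C]; rw [hc', Complex.norm_real, Real.norm_of_nonneg hc.le]
    rw [this]
    exact ⟨hc, hc'⟩
  have hCc : Continuous C := by
    have := S.Q_joint.comp_continuous (f := fun t : ℝ => (t, (0:ℂ))) (by fun_prop)
      (fun t => ⟨mem_univ _, mem_ball_self one_pos⟩)
    exact this.norm
  let G₀ : ℝ × ℂ → ℂ := fun p => (Real.log (C p.1) : ℂ)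
  obtain ⟨G, hGc, hGe, hG0⟩ := lift_log W 0 (by
      rintro z τ ⟨h1, h2⟩ s hs
      refine ⟨h1, ?_⟩
      simp only [zero_add, sub_zero]
      exact ⟨mul_nonneg hs.1 h2.1, mul_le_one₀ hs.2 h2.1 h2.2⟩) F hF hF0 G₀ (by
      apply Continuous.continuousOn
      have : Continuous fun p : ℝ × ℂ => Real.log (C p.1) :=
        (hCc.comp continuous_fst).log fun p => (hC p.1).1.ne'
      exact Complex.continuous_ofReal.comp this) (by
      intro z hz
      simp only [G₀, F]
      rw [← Complex.ofReal_exp, Real.exp_log (hC _).1, ← (hC _).2]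
      simp)
  let g : ℝ → ℂ → ℂ := fun t z => G ((t, z), 1)
  have hgc : ContinuousOn (fun p : ℝ × ℂ => g p.1 p.2) (univ ×ˢ ball 0 1) :=
    hGc.comp (f := fun p : ℝ × ℂ => (p, (1:ℝ))) (by fun_prop)
      (fun p hp => ⟨hp.2, by simp⟩)
  have hge : ∀ t, ∀ z ∈ ball (0:ℂ) 1, Complex.exp (g t z) = Qf (S.φ t) z - z * S.H t x := by
    intro t z hz
    have := hGe ((t, z), 1) ⟨hz, by simp⟩
    simpa [F] using this
  have hg0 : ∀ t, g t 0 = (Real.log (C t) : ℂ) := by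
    intro t
    refine log_unique (S := Icc (0:ℝ) 1) (G₁ := fun τ => G ((t, 0), τ))
      (G₂ := fun _ => (Real.log (C t) : ℂ)) isPreconnected_Icc ?_ ?_ ?_
      (left_mem_Icc.2 zero_le_one) ?_ 1 (right_mem_Icc.2 zero_le_one)
    · exact hGc.comp (f := fun τ : ℝ => ((t, (0:ℂ)), τ)) (by fun_prop)
        (fun τ hτ => ⟨mem_ball_self one_pos, hτ⟩)
    · exact continuousOn_const
    · intro τ hτ
      rw [hGe _ ⟨mem_ball_self one_pos, hτ⟩, ← Complex.ofReal_exp, Real.exp_log (hC _).1,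
        ← (hC _).2]
      simp [F]
    · exact hG0 (t, 0) ⟨mem_ball_self one_pos, by simp⟩
  have hem : ∀ w ∈ HP, Complex.exp (-w) ∈ ball (0:ℂ) 1 := by
    intro w hw
    have hw : 0 < w.re := hw
    rw [mem_ball_zero_iff, Complex.norm_exp, Complex.neg_re, Real.exp_lt_one_iff]
    linarith
  refine ⟨fun t w => w + g t (Complex.exp (-w)), ?_, ?_, ?_, ?_⟩
  · refine continuousOn_snd.add ?_
    exact hgc.comp (f := fun p : ℝ × ℂ => (p.1, Complex.exp (-p.2))) (by fun_prop)
      (fun p hp => ⟨mem_univ _, hem _ hp.2⟩)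
  · intro t w hw
    rw [Complex.exp_add, hge t _ (hem w hw), Qf_ne (Complex.exp_ne_zero _), ← mul_sub, ← mul_assoc,
      ← Complex.exp_add]
    simp [psi]
  · intro t w hw
    have : Complex.exp (-(w + 2 * Real.pi * Complex.I)) = Complex.exp (-w) := by
      rw [neg_add, Complex.exp_add, Complex.exp_neg (2 * Real.pi * Complex.I),
        Complex.exp_two_pi_mul_I]
      simp
    rw [this]
    ring
  · intro t
    refine ⟨Real.log (C t), fun ε hε => ?_⟩
    have hc : ContinuousAt (g t) 0 := by
      have h1 : ContinuousOn (g t) (ball 0 1) :=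
        hgc.comp (f := fun z : ℂ => (t, z)) (by fun_prop) (fun z hz => ⟨mem_univ _, hz⟩)
      exact h1.continuousAt (ball_mem_nhds _ one_pos)
    obtain ⟨δ, hδ, hδ'⟩ := Metric.continuousAt_iff.1 hc ε hε
    refine ⟨max 1 (-Real.log δ), by positivity, fun w hw => ?_⟩
    have h1 : dist (Complex.exp (-w)) 0 < δ := by
      rw [dist_zero_right, Complex.norm_exp, ← Real.lt_log_iff_exp_lt hδ, Complex.neg_re]
      have := (le_max_right 1 (-Real.log δ)).trans_lt hw
      linarith
    have := hδ' h1
    rw [dist_eq_norm, hg0] at this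
    simpa using this

end Sys


/-- branch of the logarithm on the half plane in direction `θ` -/
noncomputable def blog (θ : ℝ) (z : ℂ) : ℂ :=
  θ * Complex.I + Complex.log (Complex.exp (-(θ * Complex.I)) * z)

theorem blog_exp {θ : ℝ} {z : ℂ} (hz : 0 < (Complex.exp (-(θ * Complex.I)) * z).re) :
    Complex.exp (blog θ z) = z := by
  rw [blog, Complex.exp_add, Complex.exp_log, ← mul_assoc, ← Complex.exp_add]
  · simp
  · rintro h
    simp [h] at hz

theorem blog_im {θ : ℝ} {z : ℂ} (hz : 0 < (Complex.exp (-(θ * Complex.I)) * z).re) :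
    |(blog θ z).im - θ| < Real.pi / 2 := by
  have : (blog θ z).im - θ = Complex.arg (Complex.exp (-(θ * Complex.I)) * z) := by
    simp [blog, Complex.log_im]
  rw [this, Complex.abs_arg_lt_pi_div_two_iff]
  exact Or.inl hz

theorem blog_cont {Z : Type*} [TopologicalSpace Z] {A : Set Z} {g : Z → ℂ} {θ : ℝ}
    (hg : ContinuousOn g A) (hz : ∀ a ∈ A, 0 < (Complex.exp (-(θ * Complex.I)) * g a).re) :
    ContinuousOn (fun a => blog θ (g a)) A := by
  unfold blog
  exact continuousOn_const.add ((continuousOn_const.mul hg).clog fun a ha => Or.inl (hz a ha))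

namespace Sys
variable {Y : Type*} [TopologicalSpace Y] [CompactSpace Y] [Nontrivial Y] (S : Sys Y)

/-- displacement from the reference path -/
noncomputable def E (x : Y) (γ : ℝ → ℂ) (p : Y × ℝ) : ℂ :=
  S.H (max p.2 0) p.1 - (S.H (max p.2 0) x - S.H 0 x + γ (max (-p.2) 0))

/-- the data for a ray landing at `x` at time zero -/
structure Ray (x : Y) (c T : ℝ) (γ : ℝ → ℂ) (lam : Y × ℝ → ℂ) : Prop where
  γ_cont : Continuous γ
  γ_zero : ∀ u ≤ 0, γ u = S.H 0 x
  γ_pos : ∀ u > 0, γ u = psi (S.φ 0) ⟨u, c⟩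
  Tpos : 0 < T
  kT : ∀ u, 0 ≤ u → u < T → (Complex.exp (-((c + Real.pi : ℝ) * Complex.I)) * γ T).re
    < (Complex.exp (-((c + Real.pi : ℝ) * Complex.I)) * γ u).re
  kM : ∀ u ≥ T, (Complex.exp (-((c + Real.pi : ℝ) * Complex.I)) * γ u).re < -S.M
  lam_cont : ContinuousOn lam {p | p.1 ≠ x ∨ p.2 < 0}
  lam_exp : ∀ p : Y × ℝ, (p.1 ≠ x ∨ p.2 < 0) → Complex.exp (lam p) = S.E x γ p
  lam_base : ∀ y, |(lam (y, -T)).im - (c + Real.pi)| < Real.pi / 2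

omit [CompactSpace Y] [Nontrivial Y] in
theorem E_nonneg {x : Y} {γ : ℝ → ℂ} (h0 : ∀ u ≤ 0, γ u = S.H 0 x) {y : Y} {τ : ℝ} (hτ : 0 ≤ τ) :
    S.E x γ (y, τ) = S.H τ y - S.H τ x := by
  simp only [E, max_eq_left hτ, max_eq_right (neg_nonpos.2 hτ), h0 0 le_rfl]
  ring

omit [CompactSpace Y] [Nontrivial Y] in
theorem E_nonpos {x : Y} {γ : ℝ → ℂ} {y : Y} {τ : ℝ} (hτ : τ ≤ 0) :
    S.E x γ (y, τ) = S.H 0 y - γ (-τ) := by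
  simp only [E, max_eq_right hτ, max_eq_left (neg_nonneg.2 hτ)]
  ring

omit [CompactSpace Y] [Nontrivial Y] in
theorem E_cont {x : Y} {γ : ℝ → ℂ} (hγ : Continuous γ) : Continuous (S.E x γ) := by
  have h1 : Continuous (fun p : Y × ℝ => S.H (max p.2 0) p.1) :=
    S.cont.comp (by fun_prop : Continuous fun p : Y × ℝ => (max p.2 0, p.1))
  have h2 : Continuous (fun p : Y × ℝ => S.H (max p.2 0) x) :=
    S.cont.comp (by fun_prop : Continuous fun p : Y × ℝ => (max p.2 0, x))
  unfold E
  fun_prop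

omit [CompactSpace Y] [Nontrivial Y] in
theorem E_inj {x : Y} {γ : ℝ → ℂ} {y y' : Y} {τ : ℝ} (h : S.E x γ (y, τ) = S.E x γ (y', τ)) :
    y = y' := by
  simp only [E, sub_left_inj] at h
  exact S.inj _ h

theorem exists_ray {x : Y} {c : ℝ} (hl : Lands (S.φ 0) c (S.H 0 x)) :
    ∃ T γ lam, S.Ray x c T γ lam := by
  let γ : ℝ → ℂ := fun u => if 0 < u then psi (S.φ 0) ⟨u, c⟩ else S.H 0 x
  have hγ0 : ∀ u ≤ 0, γ u = S.H 0 x := fun u hu => if_neg (not_lt.2 hu)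
  have hγ1 : ∀ u > 0, γ u = psi (S.φ 0) ⟨u, c⟩ := fun u hu => if_pos hu
  have h := S.rm 0
  have hγc : Continuous γ := by
    rw [continuous_iff_continuousAt]
    intro u
    rcases lt_trichotomy u 0 with hu | hu | hu
    · refine (continuousAt_const (y := S.H 0 x)).congr ?_
      filter_upwards [gt_mem_nhds hu] with v hv using (hγ0 v hv.le).symm
    · subst hu
      rw [continuousAt_iff_continuous_left'_right']
      constructor
      · refine (continuousWithinAt_const (b := S.H 0 x)).congr (fun v hv => hγ0 v (le_of_lt hv)) (hγ0 0 le_rfl)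
      · rw [ContinuousWithinAt, hγ0 0 le_rfl]
        refine hl.congr' ?_
        filter_upwards [self_mem_nhdsWithin] with v hv using (hγ1 v hv).symm
    · have : ContinuousAt (fun u : ℝ => psi (S.φ 0) ⟨u, c⟩) u :=
        ContinuousAt.comp (f := fun u : ℝ => (⟨u, c⟩ : ℂ)) (h.psi_diffAt (w := ⟨u, c⟩) hu).continuousAt
          (continuous_hor c).continuousAt
      refine this.congr ?_
      filter_upwards [lt_mem_nhds hu] with v hv using (hγ1 v hv).symm
  have hγne : ∀ u > 0, ∀ y, S.H 0 y ≠ γ u := by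
    intro u hu y
    rw [hγ1 u hu]
    exact (h.psi_ne (w := ⟨u, c⟩) hu (mem_range_self y)).symm
  let e : ℂ := Complex.exp (-((c + Real.pi : ℝ) * Complex.I))
  let k : ℝ → ℝ := fun u => (e * γ u).re
  have hkc : Continuous k := Complex.continuous_re.comp (continuous_const.mul hγc)
  have hk : Tendsto k atTop atBot := by
    obtain ⟨C, hC, hC'⟩ := h.Q_zero
    obtain ⟨R, hR, hR'⟩ := h.psi_asym (half_pos hC)
    have h1 : ∀ u > R, k u ≤ -(C / 2) * Real.exp u := by
      intro u hu
      have h2 := hR' ⟨u, c⟩ hu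
      rw [hC'] at h2
      have h3 := (abs_le.1 (Complex.abs_re_le_norm (Complex.exp (-⟨u, c⟩) * psi (S.φ 0) ⟨u, c⟩ - C))).1
      have h4 : e * γ u = -(Real.exp u : ℂ) * (Complex.exp (-⟨u, c⟩) * psi (S.φ 0) ⟨u, c⟩) := by
        rw [hγ1 u (hR.trans hu)]
        rw [← mul_assoc]
        congr 1
        have h5 : (⟨u, c⟩ : ℂ) = u + c * Complex.I := by apply Complex.ext <;> simp
        simp only [e]
        rw [h5, Complex.ofReal_exp, neg_mul, ← Complex.exp_add]
        have h6 : -(((c + Real.pi : ℝ) : ℂ) * Complex.I) = -(c * Complex.I) + -(Real.pi * Complex.I) := by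
          push_cast; ring
        rw [h6, Complex.exp_add, Complex.exp_neg (Real.pi * Complex.I), Complex.exp_pi_mul_I]
        norm_num
      simp only [k]
      rw [h4, neg_mul, Complex.neg_re, Complex.re_ofReal_mul]
      simp only [Complex.sub_re, Complex.ofReal_re] at h3
      have := Real.exp_pos u
      nlinarith
    have h2 : Tendsto (fun u => -(C / 2) * Real.exp u) atTop atBot :=
      Real.tendsto_exp_atTop.const_mul_atTop_of_neg (by linarith)
    refine tendsto_atBot_mono' _ ?_ h2
    filter_upwards [eventually_gt_atTop R] with u hu using h1 u hu
  obtain ⟨U1, hU1⟩ := (hk.eventually (eventually_lt_atBot (-S.M))).exists_forall_of_atTop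
  obtain ⟨m0, hm0⟩ := (isCompact_Icc (a := (0:ℝ)) (b := U1)).bddBelow_image hkc.continuousOn
  let m := min m0 (k 0) - 1
  let A : Set ℝ := Ici 0 ∩ {u | k u ≤ m}
  have hA : IsClosed A := isClosed_Ici.inter (isClosed_le hkc continuous_const)
  have hAne : A.Nonempty := by
    obtain ⟨u, h1, h2⟩ := ((hk.eventually (eventually_le_atBot m)).and (eventually_ge_atTop 0)).exists
    exact ⟨u, h2, h1⟩
  have hAb : BddBelow A := ⟨0, fun u hu => hu.1⟩
  obtain ⟨hT0, hTm⟩ := hA.csInf_mem hAne hAb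
  set T := sInf A with hTdef
  have hT0 : 0 ≤ T := hT0
  have hTm : k T ≤ m := hTm
  have hTpos : 0 < T := by
    rcases hT0.lt_or_eq with h1 | h1
    · exact h1
    · rw [← h1] at hTm
      have : min m0 (k 0) ≤ k 0 := min_le_right _ _
      simp only [m] at hTm
      linarith
  have hkT : ∀ u, 0 ≤ u → u < T → k T < k u := by
    intro u hu huT
    by_contra hcon
    have : u ∈ A := ⟨hu, (not_lt.1 hcon).trans hTm⟩
    exact absurd (csInf_le hAb this) (not_le.2 huT)
  have hTU : U1 < T := by
    by_contra hcon
    have h1 : m0 ≤ k T := hm0 ⟨T, ⟨hT0, not_lt.1 hcon⟩, rfl⟩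
    have : min m0 (k 0) ≤ m0 := min_le_left _ _
    simp only [m] at hTm
    linarith
  have hkM : ∀ u ≥ T, k u < -S.M := fun u hu => hU1 u (hTU.le.trans hu)
  -- base logarithm
  have hEne : ∀ p ∈ {p : Y × ℝ | p.1 ≠ x ∨ p.2 < 0}, S.E x γ p ≠ 0 := by
    rintro ⟨y, τ⟩ hp
    rcases lt_or_ge τ 0 with hτ | hτ
    · rw [S.E_nonpos hτ.le]
      exact sub_ne_zero.2 (hγne _ (neg_pos.2 hτ) y)
    · rw [S.E_nonneg hγ0 hτ]
      rcases hp with hp | hp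
      · exact sub_ne_zero.2 fun he => hp (S.inj τ he)
      · exact absurd hτ (not_le.2 hp)
  have hbase : ∀ y, 0 < (e * S.E x γ (y, -T)).re := by
    intro y
    rw [S.E_nonpos (by linarith), neg_neg, mul_sub, Complex.sub_re]
    have h1 := hkM T le_rfl
    have h2 := Complex.abs_re_le_norm (e * S.H 0 y)
    have h3 : ‖e‖ = 1 := by
      simp only [e]
      rw [Complex.norm_exp]
      simp
    rw [norm_mul, h3, one_mul] at h2
    have h4 := S.bdd 0 y
    have h5 := neg_abs_le (e * S.H 0 y).re
    simp only [k] at h1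
    linarith
  obtain ⟨lam, hl1, hl2, hl3⟩ := lift_log {p : Y × ℝ | p.1 ≠ x ∨ p.2 < 0} (-T) (by
      rintro y τ hp s hs
      rcases hp with hp | hp
      · exact Or.inl hp
      · refine Or.inr ?_
        have hp : τ < 0 := hp
        show -T + s * (τ - -T) < 0
        rcases hs.1.lt_or_eq with h1 | h1
        · nlinarith [hs.2]
        · rw [← h1]
          linarith) (S.E x γ) (S.E_cont hγc).continuousOn hEne
      (fun y => blog (c + Real.pi) (S.E x γ (y, -T)))
      (blog_cont (Continuous.continuousOn ((S.E_cont hγc).comp (Continuous.prodMk_left _)))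
        fun y _ => hbase y)
      (fun y _ => blog_exp (hbase y))
  refine ⟨T, γ, lam, hγc, hγ0, hγ1, hTpos, hkT, hkM, hl1, hl2, fun y => ?_⟩
  rw [hl3 y (Or.inr (neg_lt_zero.2 hTpos))]
  exact blog_im (hbase y)

end Sys


theorem arg_sector {σ θ : ℝ} (hσ : σ = 1 ∧ θ = 0 ∨ σ = -1 ∧ θ = Real.pi) {D : ℂ} (hi : 0 < D.im)
    (hr : 0 < σ * D.re) : |D.arg - θ| < Real.pi / 2 := by
  rcases hσ with ⟨rfl, rfl⟩ | ⟨rfl, rfl⟩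
  · rw [sub_zero, Complex.abs_arg_lt_pi_div_two_iff]
    exact Or.inl (by linarith)
  · have h1 : D.arg ≤ Real.pi := Complex.arg_le_pi D
    have h2 : 0 ≤ D.arg := Complex.arg_nonneg_iff.2 hi.le
    have h3 : ¬ |D.arg| ≤ Real.pi / 2 := by
      rw [Complex.abs_arg_le_pi_div_two_iff]
      linarith
    rw [abs_of_nonneg h2] at h3
    rw [abs_lt]
    constructor <;> linarith [Real.pi_pos]

theorem sigma_exp {σ θ : ℝ} (hσ : σ = 1 ∧ θ = 0 ∨ σ = -1 ∧ θ = Real.pi) (D : ℂ) :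
    (Complex.exp (-(θ * Complex.I)) * D).re = σ * D.re := by
  rcases hσ with ⟨rfl, rfl⟩ | ⟨rfl, rfl⟩
  · simp
  · rw [Complex.exp_neg, Complex.exp_pi_mul_I]
    norm_num

theorem sigma_ne {σ : ℝ} (hσ : σ = 1 ∨ σ = -1) {a b : ℂ} (hab : Complex.exp a ≠ Complex.exp b) :
    (σ : ℂ) * (a - b) + 2 * Real.pi * Complex.I ≠ 0 := by
  intro h
  apply hab
  rw [Complex.exp_eq_exp_iff_exists_int]
  rcases hσ with rfl | rfl
  · refine ⟨-1, ?_⟩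
    push_cast at h ⊢
    linear_combination h
  · refine ⟨1, ?_⟩
    push_cast at h ⊢
    linear_combination -h

theorem re_of_exp {a e : ℂ} (h : Complex.exp a = e) : a.re = Real.log ‖e‖ := by
  rw [← h, Complex.norm_exp, Real.log_exp]

theorem sigma_re {σ : ℝ} (hσ : σ = 1 ∨ σ = -1) {a b ea eb : ℂ} (ha : Complex.exp a = ea)
    (hb : Complex.exp b = eb) (hlt : ‖eb‖ < ‖ea‖) :
    0 < σ * ((σ : ℂ) * (a - b) + 2 * Real.pi * Complex.I).re := by
  have hb0 : 0 < ‖eb‖ := by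
    rw [← hb]
    exact norm_pos_iff.2 (Complex.exp_ne_zero _)
  have h1 := Real.log_lt_log hb0 hlt
  rw [← re_of_exp ha, ← re_of_exp hb] at h1
  rcases hσ with rfl | rfl <;> simp <;> linarith

theorem sigma_im {σ θ : ℝ} (hσ : σ = 1 ∨ σ = -1) {a b : ℂ} (ha : |a.im - θ| < Real.pi / 2)
    (hb : |b.im - θ| < Real.pi / 2) : 0 < ((σ : ℂ) * (a - b) + 2 * Real.pi * Complex.I).im := by
  rw [abs_lt] at ha hb
  have := Real.pi_pos
  rcases hσ with rfl | rfl <;> simp <;> linarith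

theorem log_im_mem {D : ℂ} (hD : 0 < D.im) : (Complex.log D).im ∈ Icc 0 Real.pi := by
  rw [Complex.log_im]
  exact ⟨Complex.arg_nonneg_iff.2 hD.le, Complex.arg_le_pi D⟩

namespace Sys
variable {Y : Type*} [TopologicalSpace Y] [CompactSpace Y] [Nontrivial Y] {S : Sys Y}

theorem Ray.sigma {x : Y} {c T : ℝ} {γ : ℝ → ℂ} {lam : Y × ℝ → ℂ} (R : S.Ray x c T γ lam)
    {σ θ : ℝ} (hσ : σ = 1 ∧ θ = 0 ∨ σ = -1 ∧ θ = Real.pi) {y : Y} (hy : y ≠ x)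
    {B : Y × ℝ → ℂ} (hBc : ContinuousOn B {p | p.1 ≠ x ∨ p.2 < 0})
    (hBe : ∀ p : Y × ℝ, (p.1 ≠ x ∨ p.2 < 0) →
      Complex.exp (B p) = σ * (lam (y, p.2) - lam p) + 2 * Real.pi * Complex.I)
    (hB0 : ∀ y', (B (y', -T)).im ∈ Icc 0 Real.pi) {t : ℝ} (ht : 0 ≤ t) :
    ∀ᶠ y' in 𝓝[≠] x, |(B (y', t)).im - θ| < Real.pi / 2 := by
  have hσ' : σ = 1 ∨ σ = -1 := hσ.imp And.left And.left
  have h := S.rm 0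
  have hT := R.Tpos
  have hγne : ∀ u > 0, ∀ y, S.H 0 y ≠ γ u := by
    intro u hu y
    rw [R.γ_pos u hu]
    exact (h.psi_ne (w := ⟨u, c⟩) hu (mem_range_self y)).symm
  have hγinj : ∀ u v, 0 ≤ u → u < v → γ u ≠ γ v := by
    intro u v hu huv
    rcases hu.lt_or_eq with h0 | h0
    · rw [R.γ_pos u h0, R.γ_pos v (h0.trans huv)]
      intro he
      obtain ⟨n, hn⟩ := h.psi_inj (w := ⟨u, c⟩) (w' := ⟨v, c⟩) h0 (h0.trans huv) he
      have := congrArg Complex.re hn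
      simp at this
      exact huv.ne this
    · rw [← h0, R.γ_zero 0 le_rfl]
      exact hγne v (hu.trans_lt huv) x
  have hlamu : ContinuousOn (fun u : ℝ => lam (y, -u)) univ :=
    R.lam_cont.comp (f := fun u : ℝ => (y, -u)) (by fun_prop) fun u _ => Or.inl hy
  have hlame : ∀ u ≥ 0, Complex.exp (lam (y, -u)) = S.H 0 y - γ u := by
    intro u hu
    rw [R.lam_exp _ (Or.inl hy), S.E_nonpos (neg_nonpos.2 hu), neg_neg]
  -- the auxiliary logarithm
  let W : Set (ℝ × ℝ) := {p | (0 ≤ p.1 ∧ p.1 < 1) ∧ 0 < p.2 ∧ p.2 ≤ T}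
  have hWstar : ∀ z τ, (z, τ) ∈ W → ∀ s ∈ Icc (0:ℝ) 1, (z, T + s * (τ - T)) ∈ W := by
    rintro z τ ⟨h1, h2, h3⟩ s hs
    refine ⟨h1, ?_, ?_⟩
    · show 0 < T + s * (τ - T)
      have h2 : 0 < τ := h2
      have h3 : τ ≤ T := h3
      nlinarith [hs.1, hs.2]
    · show T + s * (τ - T) ≤ T
      have h3 : τ ≤ T := h3
      nlinarith [hs.1]
  have hbase : ∀ s, (s, T) ∈ W →
      0 < (Complex.exp (-((c + Real.pi : ℝ) * Complex.I)) * (γ (s * T) - γ T)).re := by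
    rintro s ⟨⟨h1, h2⟩, h3, h4⟩
    have h1 : 0 ≤ s := h1
    have h2 : s < 1 := h2
    have := R.kT (s * T) (by positivity) (by nlinarith)
    rw [mul_sub, Complex.sub_re]
    linarith
  have hγc := R.γ_cont
  obtain ⟨μ, hμc, hμe, hμ0⟩ := lift_log W T hWstar (fun p => γ (p.1 * p.2) - γ p.2)
    (by fun_prop) (by
      rintro ⟨s, u⟩ ⟨⟨h1, h2⟩, h3, h4⟩
      have h1 : 0 ≤ s := h1
      have h2 : s < 1 := h2
      have h3 : 0 < u := h3
      exact sub_ne_zero.2 (hγinj _ _ (by positivity) (by nlinarith)))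
    (fun s => blog (c + Real.pi) (γ (s * T) - γ T))
    (blog_cont (by fun_prop) hbase) (fun s hs => blog_exp (hbase s hs))
  have hμim : ∀ s, (s, T) ∈ W → |(μ (s, T)).im - (c + Real.pi)| < Real.pi / 2 := by
    intro s hs
    rw [hμ0 s hs]
    exact blog_im (hbase s hs)
  let D : ℝ × ℝ → ℂ := fun p => σ * (lam (y, -p.2) - μ p) + 2 * Real.pi * Complex.I
  have hDc : ContinuousOn D W := by
    have h1 : ContinuousOn (fun p : ℝ × ℝ => lam (y, -p.2)) W :=
      hlamu.comp continuousOn_snd fun _ _ => mem_univ _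
    exact (continuousOn_const.mul (h1.sub hμc)).add continuousOn_const
  have hDne : ∀ p ∈ W, D p ≠ 0 := by
    rintro ⟨s, u⟩ hp
    have hp' := hp
    obtain ⟨⟨h1, h2⟩, h3, h4⟩ := hp
    have h1 : 0 ≤ s := h1
    have h3 : 0 < u := h3
    refine sigma_ne hσ' ?_
    rw [hlame u h3.le, hμe _ hp']
    simp only [ne_eq, sub_left_inj]
    rcases h1.lt_or_eq with h0 | h0
    · exact hγne _ (by positivity) y
    · rw [← h0, zero_mul, R.γ_zero 0 le_rfl]
      exact fun he => hy (S.inj 0 he)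
  have hDim : ∀ s, (s, T) ∈ W → 0 < (D (s, T)).im := fun s hs =>
    sigma_im hσ' (R.lam_base y) (hμim s hs)
  have hWT : ∀ s, 0 ≤ s → s < 1 → (s, T) ∈ W := fun s h1 h2 => ⟨⟨h1, h2⟩, hT, le_rfl⟩
  obtain ⟨Λ, hΛc, hΛe, hΛ0⟩ := lift_log W T hWstar D hDc hDne (fun s => Complex.log (D (s, T)))
    (by
      refine ContinuousOn.clog ?_ fun s hs => Or.inr (hDim s hs).ne'
      exact hDc.comp (f := fun s : ℝ => (s, T)) (by fun_prop) fun s hs => hs)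
    (fun s hs => Complex.exp_log (hDne _ hs))
  -- choices
  let d := ‖S.H 0 y - S.H 0 x‖
  have hd : 0 < d := norm_pos_iff.2 (sub_ne_zero.2 fun he => hy (S.inj 0 he))
  have hγ00 : γ 0 = S.H 0 x := R.γ_zero 0 le_rfl
  obtain ⟨η, hη, hη'⟩ := Metric.continuousAt_iff.1 (R.γ_cont.continuousAt (x := 0)) (d / 4) (by positivity)
  let us := min (η / 2) T
  have hus : 0 < us := lt_min (by positivity) hT
  have husT : us ≤ T := min_le_right _ _
  have hγs : ∀ v, 0 ≤ v → v ≤ us → ‖γ v - S.H 0 x‖ < d / 4 := by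
    intro v h1 h2
    rw [← hγ00, ← dist_eq_norm]
    apply hη'
    rw [Real.dist_eq, sub_zero, abs_of_nonneg h1]
    have : us ≤ η / 2 := min_le_left _ _
    linarith
  have hγs' : ∀ v, 0 ≤ v → v ≤ us → 3 * d / 4 < ‖S.H 0 y - γ v‖ := by
    intro v h1 h2
    have h3 := hγs v h1 h2
    have h4 : d ≤ ‖S.H 0 y - γ v‖ + ‖γ v - S.H 0 x‖ := by
      have := norm_add_le (S.H 0 y - γ v) (γ v - S.H 0 x)
      simpa [d] using this
    linarith
  have hev : ∀ᶠ s : ℝ in 𝓝 1, ∀ u ∈ Icc 0 T, ‖γ (s * u) - γ u‖ < ‖S.H 0 y - γ u‖ := by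
    refine isCompact_Icc.eventually_forall_of_forall_eventually fun u hu => ?_
    refine ContinuousAt.eventually_lt (by fun_prop) (by fun_prop) ?_
    simp only [one_mul, sub_self, norm_zero]
    refine norm_pos_iff.2 (sub_ne_zero.2 ?_)
    rcases hu.1.lt_or_eq with h0 | h0
    · exact hγne u h0 y
    · rw [← h0, hγ00]
      exact fun he => hy (S.inj 0 he)
  obtain ⟨ss, hss, hss0, hss1⟩ := ((hev.filter_mono (nhdsWithin_le_nhds (s := Iio 1))).and
    (eventually_iff.2 (Ioo_mem_nhdsLT (zero_lt_one (α := ℝ))) : ∀ᶠ s : ℝ in 𝓝[<] 1, s ∈ Ioo (0:ℝ) 1)).exists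
  have hDre : ∀ p ∈ W, ‖γ (p.1 * p.2) - γ p.2‖ < ‖S.H 0 y - γ p.2‖ → 0 < σ * (D p).re := by
    intro p hp hlt
    exact sigma_re hσ' (hlame p.2 hp.2.1.le) (hμe p hp) hlt
  have st0 : |(Λ (ss, T)).im - θ| < Real.pi / 2 := by
    rw [hΛ0 ss (hWT ss hss0.le hss1), Complex.log_im]
    exact arg_sector hσ (hDim ss (hWT ss hss0.le hss1))
      (hDre _ (hWT ss hss0.le hss1) (hss T ⟨hT.le, le_rfl⟩))
  have st1 : |(Λ (ss, us)).im - θ| < Real.pi / 2 := by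
    have hm : ∀ u ∈ Icc us T, (ss, u) ∈ W := fun u hu =>
      ⟨⟨hss0.le, hss1⟩, hus.trans_le hu.1, hu.2⟩
    refine sector_lemma (S := Icc us T) (G := fun u => Λ (ss, u)) isPreconnected_Icc ?_ θ ?_
      (right_mem_Icc.2 husT) st0 us (left_mem_Icc.2 husT)
    · exact hΛc.comp (f := fun u : ℝ => (ss, u)) (by fun_prop) hm
    · intro u hu
      rw [sigma_exp hσ, hΛe _ (hm u hu)]
      exact hDre _ (hm u hu) (hss u ⟨hus.le.trans hu.1, hu.2⟩)
  have st2 : |(Λ (0, us)).im - θ| < Real.pi / 2 := by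
    have hm : ∀ s ∈ Icc 0 ss, (s, us) ∈ W := fun s hs =>
      ⟨⟨hs.1, hs.2.trans_lt hss1⟩, hus, husT⟩
    refine sector_lemma (S := Icc 0 ss) (G := fun s => Λ (s, us)) isPreconnected_Icc ?_ θ ?_
      (right_mem_Icc.2 hss0.le) st1 0 (left_mem_Icc.2 hss0.le)
    · exact hΛc.comp (f := fun s : ℝ => (s, us)) (by fun_prop) hm
    · intro s hs
      rw [sigma_exp hσ, hΛe _ (hm s hs)]
      refine hDre _ (hm s hs) ?_
      show ‖γ (s * us) - γ us‖ < ‖S.H 0 y - γ us‖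
      have h1 := hγs (s * us) (mul_nonneg hs.1 hus.le) (by nlinarith [hs.2])
      have h2 := hγs us hus.le le_rfl
      have h3 := hγs' us hus.le le_rfl
      have h4 := norm_sub_le (γ (s * us) - S.H 0 x) (γ us - S.H 0 x)
      rw [sub_sub_sub_cancel_right] at h4
      linarith
  -- linking
  have hm0 : ∀ u ∈ Ioc 0 T, ((0:ℝ), u) ∈ W := fun u hu => ⟨⟨le_rfl, one_pos⟩, hu.1, hu.2⟩
  have hlx : ContinuousOn (fun u : ℝ => lam (x, -u)) (Ioc 0 T) :=
    R.lam_cont.comp (f := fun u : ℝ => (x, -u)) (by fun_prop) fun u hu => Or.inr (neg_lt_zero.2 hu.1)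
  have hlxe : ∀ u ∈ Ioc 0 T, Complex.exp (lam (x, -u)) = S.H 0 x - γ u := by
    intro u hu
    rw [R.lam_exp _ (Or.inr (neg_lt_zero.2 hu.1)), S.E_nonpos (neg_nonpos.2 hu.1.le), neg_neg]
  have hTm : T ∈ Ioc 0 T := ⟨hT, le_rfl⟩
  have hpre : IsPreconnected (Ioc 0 T) := isPreconnected_Ioc
  have link1 : ∀ u ∈ Ioc 0 T, μ (0, u) = lam (x, -u) := by
    refine log_unique hpre (hμc.comp (f := fun u : ℝ => ((0:ℝ), u)) (by fun_prop) hm0) hlx ?_ hTm ?_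
    · intro u hu
      rw [hlxe u hu]
      rw [hμe _ (hm0 u hu)]
      simp [hγ00]
    · refine exp_eq_im_lt ?_ ?_
      · rw [hlxe T hTm, hμe _ (hm0 T hTm)]
        simp [hγ00]
      · have h1 := abs_lt.1 (hμim 0 (hm0 T hTm))
        have h2 := abs_lt.1 (R.lam_base x)
        rw [abs_lt]
        constructor <;> linarith [Real.pi_pos]
  have link2 : ∀ u ∈ Ioc 0 T, Λ (0, u) = B (x, -u) := by
    have hex : ∀ u ∈ Ioc 0 T, Complex.exp (Λ (0, u)) = Complex.exp (B (x, -u)) := by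
      intro u hu
      rw [hΛe _ (hm0 u hu), hBe _ (Or.inr (neg_lt_zero.2 hu.1))]
      simp only [D]
      rw [link1 u hu]
    refine log_unique hpre (hΛc.comp (f := fun u : ℝ => ((0:ℝ), u)) (by fun_prop) hm0)
      (hBc.comp (f := fun u : ℝ => (x, -u)) (by fun_prop) fun u hu => Or.inr (neg_lt_zero.2 hu.1))
      hex hTm ?_
    refine exp_eq_im_lt (hex T hTm) ?_
    have h1 := log_im_mem (hDim 0 (hm0 T hTm))
    rw [← hΛ0 0 (hm0 T hTm)] at h1
    have h2 := hB0 x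
    rw [abs_lt]
    constructor <;> linarith [Real.pi_pos, h1.1, h1.2, h2.1, h2.2]
  have st3 : |(B (x, -us)).im - θ| < Real.pi / 2 := by
    rw [← link2 us ⟨hus, husT⟩]
    exact st2
  have hev1 : ∀ᶠ y' in 𝓝 x, |(B (y', -us)).im - θ| < Real.pi / 2 := by
    have hBu : Continuous (fun y' => B (y', -us)) :=
      hBc.comp_continuous (f := fun y' => (y', -us)) (by fun_prop) fun y' => Or.inr (neg_lt_zero.2 hus)
    have : Continuous (fun y' => |(B (y', -us)).im - θ|) :=
      ((Complex.continuous_im.comp hBu).sub continuous_const).abs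
    exact this.continuousAt.eventually (gt_mem_nhds st3)
  have hEc := S.E_cont (x := x) R.γ_cont
  have hev2 : ∀ᶠ y' in 𝓝 x, ∀ τ ∈ Icc (-us) t, ‖S.E x γ (y', τ)‖ < ‖S.E x γ (y, τ)‖ := by
    refine isCompact_Icc.eventually_forall_of_forall_eventually fun τ hτ => ?_
    refine ContinuousAt.eventually_lt (by fun_prop) (by fun_prop) ?_
    show ‖S.E x γ (x, τ)‖ < ‖S.E x γ (y, τ)‖
    rcases le_total 0 τ with h0 | h0
    · rw [S.E_nonneg R.γ_zero h0, S.E_nonneg R.γ_zero h0, sub_self, norm_zero]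
      exact norm_pos_iff.2 (sub_ne_zero.2 fun he => hy (S.inj τ he))
    · rw [S.E_nonpos h0, S.E_nonpos h0]
      have h1 := hγs (-τ) (by linarith) (by linarith [hτ.1])
      have h2 := hγs' (-τ) (by linarith) (by linarith [hτ.1])
      rw [norm_sub_rev]
      linarith
  rw [eventually_nhdsWithin_iff]
  filter_upwards [hev1, hev2] with y' h1 h2 hy'
  have hy' : y' ≠ x := hy'
  have hle : -us ≤ t := by linarith
  refine sector_lemma (S := Icc (-us) t) (G := fun τ => B (y', τ)) isPreconnected_Icc ?_ θ ?_
    (left_mem_Icc.2 hle) h1 t (right_mem_Icc.2 hle)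
  · exact hBc.comp (f := fun τ : ℝ => (y', τ)) (by fun_prop) fun τ _ => Or.inl hy'
  · intro τ hτ
    rw [sigma_exp hσ, hBe _ (Or.inl hy')]
    exact sigma_re hσ' (R.lam_exp (y, τ) (Or.inl hy)) (R.lam_exp (y', τ) (Or.inl hy')) (h2 τ hτ)

/-- the logarithm of differences of logarithms -/
theorem Ray.exists_B {x : Y} {c T : ℝ} {γ : ℝ → ℂ} {lam : Y × ℝ → ℂ} (R : S.Ray x c T γ lam) {t : ℝ}
    (ht : 0 ≤ t) : ∃ B : Y × Y → ℂ, ContinuousOn B {p | p.1 ≠ x ∧ p.2 ≠ x} ∧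
      (∀ p : Y × Y, p.1 ≠ x → p.2 ≠ x →
        Complex.exp (B p) = lam (p.2, t) - lam (p.1, t) + 2 * Real.pi * Complex.I) ∧
      (∀ y1 ≠ x, ∀ᶠ y0 in 𝓝[≠] x, |(B (y0, y1)).im| < Real.pi / 2) ∧
      (∀ y0 ≠ x, ∀ᶠ y1 in 𝓝[≠] x, |(B (y0, y1)).im - Real.pi| < Real.pi / 2) := by
  have hT := R.Tpos
  let W : Set ((Y × Y) × ℝ) := {p | (p.1.1 ≠ x ∧ p.1.2 ≠ x) ∨ p.2 < 0}
  let D : (Y × Y) × ℝ → ℂ := fun p => lam (p.1.2, p.2) - lam (p.1.1, p.2) + 2 * Real.pi * Complex.I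
  have hm1 : ∀ p ∈ W, p.1.1 ≠ x ∨ p.2 < 0 := fun p hp => hp.imp And.left id
  have hm2 : ∀ p ∈ W, p.1.2 ≠ x ∨ p.2 < 0 := fun p hp => hp.imp And.right id
  have hDc : ContinuousOn D W := by
    have h1 := R.lam_cont.comp (f := fun p : (Y × Y) × ℝ => (p.1.1, p.2)) (s := W) (by fun_prop) hm1
    have h2 := R.lam_cont.comp (f := fun p : (Y × Y) × ℝ => (p.1.2, p.2)) (s := W) (by fun_prop) hm2
    exact (h2.sub h1).add continuousOn_const
  have hDne : ∀ p ∈ W, D p ≠ 0 := by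
    rintro ⟨⟨y0, y1⟩, τ⟩ hp h0
    have h1 := R.lam_exp (y0, τ) (hm1 _ hp)
    have h2 := R.lam_exp (y1, τ) (hm2 _ hp)
    have h3 : lam (y1, τ) = lam (y0, τ) - 2 * Real.pi * Complex.I := by
      simp only [D] at h0
      linear_combination h0
    rw [h3, Complex.exp_sub, Complex.exp_two_pi_mul_I, div_one, h1] at h2
    have h4 := S.E_inj h2
    subst h4
    simp [D] at h0
  have hDim : ∀ z : Y × Y, 0 < (D (z, -T)).im := by
    intro z
    have := sigma_im (σ := 1) (Or.inl rfl) (R.lam_base z.2) (R.lam_base z.1)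
    simpa [D] using this
  have hTW : ∀ z : Y × Y, (z, -T) ∈ W := fun z => Or.inr (neg_lt_zero.2 hT)
  obtain ⟨B, hBc, hBe, hB0⟩ := lift_log W (-T) (by
      rintro y τ hp s hs
      rcases hp with hp | hp
      · exact Or.inl hp
      · refine Or.inr ?_
        have hp : τ < 0 := hp
        show -T + s * (τ - -T) < 0
        rcases hs.1.lt_or_eq with h1 | h1
        · nlinarith [hs.2]
        · rw [← h1]
          linarith) D hDc hDne (fun z => Complex.log (D (z, -T)))
      (ContinuousOn.clog (hDc.comp (f := fun z : Y × Y => (z, -T)) (by fun_prop) fun z _ => hTW z)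
        fun z _ => Or.inr (hDim z).ne')
      (fun z _ => Complex.exp_log (hDne _ (hTW z)))
  have hBim : ∀ z : Y × Y, (B (z, -T)).im ∈ Icc 0 Real.pi := by
    intro z
    rw [hB0 z (hTW z)]
    exact log_im_mem (hDim z)
  refine ⟨fun z => B (z, t), ?_, ?_, ?_, ?_⟩
  · exact hBc.comp (f := fun z : Y × Y => (z, t)) (by fun_prop) fun z hz => Or.inl hz
  · intro p h1 h2
    exact hBe (p, t) (Or.inl ⟨h1, h2⟩)
  · intro y1 hy1
    have := R.sigma (σ := 1) (θ := 0) (Or.inl ⟨rfl, rfl⟩) hy1 (B := fun p => B ((p.1, y1), p.2))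
      (hBc.comp (f := fun p : Y × ℝ => ((p.1, y1), p.2)) (by fun_prop)
        fun p hp => hp.imp (fun h => ⟨h, hy1⟩) id)
      (fun p hp => by
        rw [hBe _ (hp.imp (fun h => ⟨h, hy1⟩) id)]
        simp [D]) (fun y' => hBim _) ht
    simpa using this
  · intro y0 hy0
    have := R.sigma (σ := -1) (θ := Real.pi) (Or.inr ⟨rfl, rfl⟩) hy0 (B := fun p => B ((y0, p.1), p.2))
      (hBc.comp (f := fun p : Y × ℝ => ((y0, p.1), p.2)) (by fun_prop)
        fun p hp => hp.imp (fun h => ⟨hy0, h⟩) id)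
      (fun p hp => by
        rw [hBe _ (hp.imp (fun h => ⟨hy0, h⟩) id)]
        simp [D]) (fun y' => hBim _) ht
    exact this

end Sys


theorem clopen_step {Y : Type*} [TopologicalSpace Y] [T1Space Y] [PreconnectedSpace Y] {x : Y} {θ : ℝ}
    {M : Y → ℂ} (hM : ContinuousOn M {x}ᶜ)
    (hpos : ∀ y ≠ x, 0 < (Complex.exp (-(θ * Complex.I)) * Complex.exp (M y)).re)
    (hev : ∀ᶠ y in 𝓝[≠] x, |(M y).im - θ| < Real.pi / 2) :
    ∀ y ≠ x, |(M y).im - θ| < Real.pi / 2 := by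
  have hc : ContinuousOn (fun y => |(M y).im - θ|) {x}ᶜ :=
    ((Complex.continuous_im.comp_continuousOn hM).sub continuousOn_const).abs
  have hop : IsOpen ({x}ᶜ : Set Y) := isOpen_compl_singleton
  have hne : ∀ y ≠ x, |(M y).im - θ| ≠ Real.pi / 2 := by
    intro y hy he
    have h1 := hpos y hy
    rw [← Complex.exp_add, Complex.exp_re] at h1
    have h2 : (-(θ * Complex.I) + M y).im = (M y).im - θ := by simp; ring
    rw [h2, ← Real.cos_abs, he, Real.cos_pi_div_two, mul_zero] at h1
    exact lt_irrefl _ h1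
  let A : Set Y := {y | y = x ∨ |(M y).im - θ| < Real.pi / 2}
  have hA : IsClopen A := by
    constructor
    · rw [← isOpen_compl_iff]
      have : Aᶜ = {x}ᶜ ∩ (fun y => |(M y).im - θ|) ⁻¹' Ioi (Real.pi / 2) := by
        ext y
        simp only [A, mem_compl_iff, Set.mem_ofPred_eq, not_or, mem_inter_iff, mem_singleton_iff,
          mem_preimage, mem_Ioi, not_lt]
        refine and_congr_right fun hy => ⟨fun h => lt_of_le_of_ne h (hne y hy).symm, le_of_lt⟩
      rw [this]
      exact hc.isOpen_inter_preimage hop isOpen_Ioi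
    · rw [isOpen_iff_mem_nhds]
      rintro y hy
      by_cases hyx : y = x
      · subst hyx
        rw [eventually_nhdsWithin_iff] at hev
        filter_upwards [hev] with z hz
        by_cases h : z = y
        · exact Or.inl h
        · exact Or.inr (hz h)
      · have h1 := (hc.continuousAt (hop.mem_nhds hyx)).eventually (gt_mem_nhds (hy.resolve_left hyx))
        filter_upwards [h1] with z hz
        exact Or.inr hz
  rcases isClopen_iff.1 hA with h | h
  · exact absurd (h ▸ (Or.inl rfl : x ∈ A)) (notMem_empty x)
  · intro y hy
    have : y ∈ A := h ▸ mem_univ y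
    exact this.resolve_left hy

theorem clopen_gen {Y : Type*} [TopologicalSpace Y] [T1Space Y] [PreconnectedSpace Y] {x : Y} {σ θ : ℝ}
    (hσ : σ = 1 ∧ θ = 0 ∨ σ = -1 ∧ θ = Real.pi) {Γ : ℝ → ℂ} (hΓ : ContinuousOn Γ (Ici 0))
    {l : Y → ℂ} (hl : Tendsto (fun y => (l y).re) (𝓝[≠] x) atBot) {R : ℝ} (hR0 : 0 ≤ R)
    (hR : ∀ y ≠ x, (l y).re < (Γ R).re)
    {M : Y × ℝ → ℂ} (hM : ContinuousOn M {p | p.1 ≠ x ∧ 0 ≤ p.2})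
    (hMe : ∀ y ≠ x, ∀ u ≥ 0, Complex.exp (M (y, u)) = σ * (Γ u - l y))
    (hev : ∀ᶠ y in 𝓝[≠] x, |(M (y, 0)).im - θ| < Real.pi / 2) :
    ∀ y ≠ x, |(M (y, R)).im - θ| < Real.pi / 2 := by
  have key : ∀ y ≠ x, ∀ u ≥ 0, (l y).re < (Γ u).re →
      0 < (Complex.exp (-(θ * Complex.I)) * Complex.exp (M (y, u))).re := by
    intro y hy u hu hlt
    rw [sigma_exp hσ, hMe y hy u hu]
    rcases hσ with ⟨rfl, -⟩ | ⟨rfl, -⟩ <;> simp <;> linarith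
  refine clopen_step (M := fun y => M (y, R)) ?_ (fun y hy => key y hy R hR0 (hR y hy)) ?_
  · exact hM.comp (f := fun y => (y, R)) (by fun_prop) fun y hy => ⟨hy, hR0⟩
  · obtain ⟨m, hm⟩ : ∃ m, ∀ u ∈ Icc 0 R, m < (Γ u).re := by
      obtain ⟨u0, -, h0⟩ := isCompact_Icc.exists_isMinOn (nonempty_Icc.2 hR0)
        (Complex.continuous_re.comp_continuousOn (hΓ.mono Icc_subset_Ici_self))
      refine ⟨(Γ u0).re - 1, fun u hu => ?_⟩
      have : (Γ u0).re ≤ (Γ u).re := h0 hu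
      linarith
    filter_upwards [hev, hl.eventually (eventually_lt_atBot m), self_mem_nhdsWithin] with y h1 h2 hy
    have hy : y ≠ x := hy
    refine sector_lemma (S := Icc 0 R) (G := fun u => M (y, u)) isPreconnected_Icc ?_ θ ?_
      (left_mem_Icc.2 hR0) h1 R (right_mem_Icc.2 hR0)
    · exact hM.comp (f := fun u : ℝ => (y, u)) (by fun_prop) fun u hu => ⟨hy, hu.1⟩
    · intro u hu
      exact key y hy u hu.1 (h2.trans (hm u hu))

namespace Sys
variable {Y : Type*} [TopologicalSpace Y] [CompactSpace Y] [Nontrivial Y] {S : Sys Y}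

omit [CompactSpace Y] [Nontrivial Y] in
theorem t2 (S : Sys Y) : T2Space Y :=
  T2Space.of_injective_continuous (S.inj 0) (S.cont.comp (by fun_prop : Continuous fun y : Y => ((0:ℝ), y)))

/-- the lifted ray at height `c` ends at sheet `N` over `y` -/
def Ends (x : Y) (Φ : ℝ → ℂ → ℂ) (lam : Y × ℝ → ℂ) (t c : ℝ) (N : ℤ) (y : Y) : Prop :=
  y ≠ x ∧ Tendsto (fun u : ℝ => Φ t ⟨u, c⟩) (𝓝[>] 0) (𝓝 (lam (y, t) + N * (2 * Real.pi * Complex.I)))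

variable {x : Y} {c T : ℝ} {γ : ℝ → ℂ} {lam : Y × ℝ → ℂ} {Φ : ℝ → ℂ → ℂ}

omit [CompactSpace Y] [Nontrivial Y] in
theorem IsCore.per_int (C : S.IsCore x Φ) (t : ℝ) {w : ℂ} (hw : w ∈ HP) (n : ℤ) :
    Φ t (w + n * (2 * Real.pi * Complex.I)) = Φ t w + n * (2 * Real.pi * Complex.I) := by
  induction n with
  | zero => simp
  | succ n ih =>
    have := C.per t (w + n * (2 * Real.pi * Complex.I)) (by simpa [HP] using hw)
    push_cast at ih ⊢
    rw [show w + (n + 1) * (2 * Real.pi * Complex.I) = w + n * (2 * Real.pi * Complex.I) + 2 * Real.pi * Complex.I by ring,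
      this, ih]
    ring
  | pred n ih =>
    have := C.per t (w + (-n - 1 : ℂ) * (2 * Real.pi * Complex.I)) (by
      have : (-n - 1 : ℂ) = ((-n - 1 : ℝ) : ℂ) := by push_cast; ring
      rw [this]
      simpa [HP] using hw)
    push_cast at ih ⊢
    rw [show w + (-n - 1 : ℂ) * (2 * Real.pi * Complex.I) + 2 * Real.pi * Complex.I =
      w + -n * (2 * Real.pi * Complex.I) by ring, ih] at this
    linear_combination -this

omit [CompactSpace Y] [Nontrivial Y] in
theorem IsCore.cont1 (C : S.IsCore x Φ) (t : ℝ) : ContinuousOn (Φ t) HP :=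
  C.cont.comp (f := fun w : ℂ => (t, w)) (by fun_prop) fun w hw => ⟨mem_univ _, hw⟩

omit [CompactSpace Y] [Nontrivial Y] in
theorem IsCore.cont_hor (C : S.IsCore x Φ) (t c : ℝ) :
    ContinuousOn (fun u : ℝ => Φ t ⟨u, c⟩) (Ioi 0) :=
  (C.cont1 t).comp (continuous_hor c).continuousOn fun u hu => hu

omit [CompactSpace Y] [Nontrivial Y] in
theorem IsCore.ends_shift (C : S.IsCore x Φ) {t c : ℝ} {N : ℤ} {y : Y} (h : Ends x Φ lam t c N y) (n : ℤ) :
    Ends x Φ lam t (c + n * (2 * Real.pi)) (N + n) y := by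
  refine ⟨h.1, ?_⟩
  have h1 := h.2.add_const ((n : ℂ) * (2 * Real.pi * Complex.I))
  have h2 : lam (y, t) + ((N + n : ℤ) : ℂ) * (2 * Real.pi * Complex.I) =
    lam (y, t) + N * (2 * Real.pi * Complex.I) + n * (2 * Real.pi * Complex.I) := by push_cast; ring
  rw [h2]
  refine h1.congr' ?_
  filter_upwards [self_mem_nhdsWithin] with u hu
  have hu : 0 < u := hu
  rw [← C.per_int t (w := ⟨u, c⟩) hu n]
  congr 1
  apply Complex.ext <;> simp

theorem IsCore.inj_ht (C : S.IsCore x Φ) {t : ℝ} {w w' : ℂ} (hw : w ∈ HP) (hw' : w' ∈ HP)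
    (he : Φ t w = Φ t w') : w = w' := by
  have h1 := C.exp t w hw
  rw [he, C.exp t w' hw'] at h1
  obtain ⟨n, hn⟩ := (S.rm t).psi_inj hw hw' (sub_left_injective h1.symm)
  rw [hn, C.per_int t hw' n] at he
  have h2 : (n : ℂ) * (2 * Real.pi * Complex.I) = 0 := by linear_combination he
  rw [hn, h2, add_zero]

theorem Ray.lam_exp' (R : S.Ray x c T γ lam) {t : ℝ} (ht : 0 ≤ t) {y : Y} (hy : y ≠ x) :
    Complex.exp (lam (y, t)) = S.H t y - S.H t x := by
  rw [R.lam_exp _ (Or.inl hy), S.E_nonneg R.γ_zero ht]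

theorem ne_lam (C : S.IsCore x Φ) (R : S.Ray x c T γ lam) {t : ℝ} (ht : 0 ≤ t) {y : Y} (hy : y ≠ x)
    {w : ℂ} (hw : w ∈ HP) (n : ℤ) : Φ t w ≠ lam (y, t) + n * (2 * Real.pi * Complex.I) := by
  intro he
  have h1 := C.exp t w hw
  rw [he, Complex.exp_add, Complex.exp_int_mul_two_pi_mul_I, mul_one, R.lam_exp' ht hy] at h1
  exact (S.rm t).psi_ne hw (mem_range_self y) (sub_left_injective h1.symm)

theorem exists_ends (C : S.IsCore x Φ) (R : S.Ray x c T γ lam) {t : ℝ} (ht : 0 ≤ t) {y : Y} (hy : y ≠ x)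
    {c' : ℝ} (hl : Lands (S.φ t) c' (S.H t y)) : ∃ N, Ends x Φ lam t c' N y := by
  let G : ℝ → ℂ := fun u => Φ t ⟨u, c'⟩ - lam (y, t)
  have hGc : ContinuousOn G (Ioi 0) := (C.cont_hor t c').sub continuousOn_const
  have he : Tendsto (fun u => Complex.exp (G u)) (𝓝[>] 0) (𝓝 1) := by
    have h1 : Tendsto (fun u : ℝ => (psi (S.φ t) ⟨u, c'⟩ - S.H t x) / Complex.exp (lam (y, t))) (𝓝[>] 0)
        (𝓝 ((S.H t y - S.H t x) / Complex.exp (lam (y, t)))) := (hl.sub_const _).div_const _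
    rw [← R.lam_exp' ht hy, div_self (Complex.exp_ne_zero _)] at h1
    refine h1.congr' ?_
    filter_upwards [self_mem_nhdsWithin] with u hu
    rw [Complex.exp_sub, C.exp t _ hu]
  have hev : ∀ᶠ u in 𝓝[>] (0:ℝ), 0 < (Complex.exp (G u)).re := by
    have := (Complex.continuous_re.tendsto 1).comp he
    exact this.eventually (lt_mem_nhds (by simp))
  obtain ⟨δ, hδ, hδ'⟩ := mem_nhdsGT_iff_exists_Ioo_subset.1 hev
  have hδ : 0 < δ := hδ
  have hm : δ / 2 ∈ Ioo 0 δ := ⟨by positivity, by linarith⟩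
  obtain ⟨n, hn⟩ := Complex.exp_eq_exp_iff_exists_int.1
    (Complex.exp_log (Complex.exp_ne_zero (G (δ / 2)))).symm
  have heq := log_unique (S := Ioo 0 δ) (G₁ := G)
    (G₂ := fun u => Complex.log (Complex.exp (G u)) + n * (2 * Real.pi * Complex.I)) isPreconnected_Ioo
    (hGc.mono Ioo_subset_Ioi_self)
    (((Complex.continuous_exp.comp_continuousOn (hGc.mono Ioo_subset_Ioi_self)).clog
      fun u hu => Or.inl (hδ' hu)).add continuousOn_const)
    (by
      intro u hu
      rw [Complex.exp_add, Complex.exp_int_mul_two_pi_mul_I, mul_one, Complex.exp_log (Complex.exp_ne_zero _)])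
    hm hn
  refine ⟨n, hy, ?_⟩
  have h1 : Tendsto (fun u => Complex.log (Complex.exp (G u)) + n * (2 * Real.pi * Complex.I) + lam (y, t)) (𝓝[>] 0)
      (𝓝 (0 + n * (2 * Real.pi * Complex.I) + lam (y, t))) := by
    refine Tendsto.add_const _ (Tendsto.add_const _ ?_)
    have := (continuousAt_clog (x := 1) (by simp)).tendsto.comp he
    simpa [Function.comp_def] using this
  rw [zero_add, add_comm] at h1
  refine h1.congr' ?_
  filter_upwards [Ioo_mem_nhdsGT hδ] with u hu
  rw [← heq u hu]
  simp [G]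

end Sys


namespace Sys
variable {Y : Type*} [TopologicalSpace Y] [CompactSpace Y] [Nontrivial Y] {S : Sys Y}
variable {x : Y} {c T : ℝ} {γ : ℝ → ℂ} {lam : Y × ℝ → ℂ} {Φ : ℝ → ℂ → ℂ}

/-- extension of a curve by its end point -/
noncomputable def extend (g : ℝ → ℂ) (p : ℂ) (u : ℝ) : ℂ := if 0 < u then g u else p

theorem extend_pos {g : ℝ → ℂ} {p : ℂ} {u : ℝ} (hu : 0 < u) : extend g p u = g u := if_pos hu
theorem extend_zero {g : ℝ → ℂ} {p : ℂ} : extend g p 0 = p := if_neg (lt_irrefl _)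

theorem extend_cont {g : ℝ → ℂ} {p : ℂ} (hg : ContinuousOn g (Ioi 0)) (hp : Tendsto g (𝓝[>] 0) (𝓝 p)) :
    ContinuousOn (extend g p) (Ici 0) := by
  intro u hu
  have hu : 0 ≤ u := hu
  rcases hu.lt_or_eq with h0 | h0
  · have h1 := hg.continuousAt (Ioi_mem_nhds h0)
    refine (h1.congr ?_).continuousWithinAt
    filter_upwards [Ioi_mem_nhds h0] with v hv
    exact (extend_pos hv).symm
  · subst h0
    rw [← continuousWithinAt_Ioi_iff_Ici]
    unfold ContinuousWithinAt
    rw [extend_zero]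
    refine hp.congr' ?_
    filter_upwards [self_mem_nhdsWithin] with v hv
    exact (extend_pos hv).symm

theorem Ray.lam_re (R : S.Ray x c T γ lam) {t : ℝ} (ht : 0 ≤ t) {y : Y} (hy : y ≠ x) :
    (lam (y, t)).re = Real.log ‖S.H t y - S.H t x‖ := by
  rw [← R.lam_exp' ht hy, Complex.norm_exp, Real.log_exp]

theorem Ray.lam_atBot (R : S.Ray x c T γ lam) {t : ℝ} (ht : 0 ≤ t) :
    Tendsto (fun y => (lam (y, t)).re) (𝓝[≠] x) atBot := by
  have h1 : Tendsto (fun y => ‖S.H t y - S.H t x‖) (𝓝[≠] x) (𝓝[>] 0) := by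
    refine tendsto_nhdsWithin_iff.2 ⟨?_, ?_⟩
    · have : Continuous (fun y => ‖S.H t y - S.H t x‖) := ((S.contY t).sub continuous_const).norm
      have h2 := (this.tendsto x).mono_left (nhdsWithin_le_nhds (s := {x}ᶜ))
      simpa using h2
    · filter_upwards [self_mem_nhdsWithin] with y hy
      exact norm_pos_iff.2 (sub_ne_zero.2 fun he => hy (S.inj t he))
  refine (Real.tendsto_log_nhdsGT_zero.comp h1).congr' ?_
  filter_upwards [self_mem_nhdsWithin] with y hy
  exact (R.lam_re ht hy).symm

theorem Ray.lam_bdd (R : S.Ray x c T γ lam) {t : ℝ} (ht : 0 ≤ t) :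
    ∃ L, ∀ y ≠ x, (lam (y, t)).re < L := by
  refine ⟨Real.log (2 * S.M) + 1, fun y hy => ?_⟩
  rw [R.lam_re ht hy]
  have h1 : 0 < ‖S.H t y - S.H t x‖ := norm_pos_iff.2 (sub_ne_zero.2 fun he => hy (S.inj t he))
  have h2 : ‖S.H t y - S.H t x‖ ≤ 2 * S.M := by
    have := norm_sub_le (S.H t y) (S.H t x)
    have h3 := S.bdd t y
    have h4 := S.bdd t x
    linarith
  have := Real.log_le_log h1 h2
  linarith

theorem lam_contY (R : S.Ray x c T γ lam) (t : ℝ) : ContinuousOn (fun y => lam (y, t)) {x}ᶜ :=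
  R.lam_cont.comp (f := fun y => (y, t)) (by fun_prop) fun y hy => Or.inl hy

theorem order_aux [PreconnectedSpace Y] (C : S.IsCore x Φ) (R : S.Ray x c T γ lam) {t : ℝ} (ht : 0 ≤ t)
    {c0 c1 : ℝ} {y0 y1 : Y} (h0 : Ends x Φ lam t c0 0 y0) (h1 : Ends x Φ lam t c1 1 y1)
    (hc : c1 < c0) : False := by
  haveI := S.t2
  obtain ⟨B, hBc, hBe, hB1, hB2⟩ := R.exists_B ht
  obtain ⟨hy0, h0⟩ := h0
  obtain ⟨hy1, h1⟩ := h1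
  rw [Int.cast_zero, zero_mul, add_zero] at h0
  rw [Int.cast_one, one_mul] at h1
  set Γ0 := extend (fun u : ℝ => Φ t ⟨u, c0⟩) (lam (y0, t)) with hΓ0
  set Γ1 := extend (fun u : ℝ => Φ t ⟨u, c1⟩) (lam (y1, t) + 2 * Real.pi * Complex.I) with hΓ1
  have hc0 : ContinuousOn Γ0 (Ici 0) := extend_cont (C.cont_hor t c0) h0
  have hc1 : ContinuousOn Γ1 (Ici 0) := extend_cont (C.cont_hor t c1) h1
  have hp0 : ∀ u > 0, Γ0 u = Φ t ⟨u, c0⟩ := fun u hu => extend_pos hu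
  have hp1 : ∀ u > 0, Γ1 u = Φ t ⟨u, c1⟩ := fun u hu => extend_pos hu
  have hz0 : Γ0 0 = lam (y0, t) := extend_zero
  have hz1 : Γ1 0 = lam (y1, t) + 2 * Real.pi * Complex.I := extend_zero
  -- star-shaped domains
  have hstar : ∀ τ s : ℝ, 0 ≤ τ → s ∈ Icc (0:ℝ) 1 → 0 ≤ 0 + s * (τ - 0) := by
    intro τ s h1 h2
    have := mul_nonneg h2.1 h1
    simpa using this
  have hlc := lam_contY R t
  have hW : ∀ z τ, (z, τ) ∈ {p : Y × ℝ | p.1 ≠ x ∧ 0 ≤ p.2} → ∀ s ∈ Icc (0:ℝ) 1,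
      (z, (0:ℝ) + s * (τ - 0)) ∈ {p : Y × ℝ | p.1 ≠ x ∧ 0 ≤ p.2} :=
    fun z τ hz s hs => ⟨hz.1, hstar τ s hz.2 hs⟩
  have hBne : ∀ y y', y ≠ x → y' ≠ x → lam (y', t) - lam (y, t) + 2 * Real.pi * Complex.I ≠ 0 := by
    intro y y' h1 h2
    rw [← hBe (y, y') h1 h2]
    exact Complex.exp_ne_zero _
  have hl1 : ContinuousOn (fun p : Y × ℝ => lam (p.1, t)) {p | p.1 ≠ x ∧ 0 ≤ p.2} :=
    hlc.comp continuousOn_fst fun p hp => hp.1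
  have hg0 : ContinuousOn (fun p : Y × ℝ => Γ0 p.2) {p | p.1 ≠ x ∧ 0 ≤ p.2} :=
    hc0.comp continuousOn_snd fun p hp => hp.2
  have hg1 : ContinuousOn (fun p : Y × ℝ => Γ1 p.2) {p | p.1 ≠ x ∧ 0 ≤ p.2} :=
    hc1.comp continuousOn_snd fun p hp => hp.2
  have hne1 : ∀ y ≠ x, ∀ u ≥ 0, Γ1 u ≠ lam (y, t) := by
    intro y hy u hu
    rcases hu.lt_or_eq with h | h
    · rw [hp1 u h]
      have := ne_lam C R ht hy (w := ⟨u, c1⟩) h 0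
      simpa using this
    · rw [← h, hz1]
      intro he
      exact hBne y y1 hy hy1 (by linear_combination he)
  have hne0 : ∀ y ≠ x, ∀ u ≥ 0, Γ0 u ≠ lam (y, t) + 2 * Real.pi * Complex.I := by
    intro y hy u hu
    rcases hu.lt_or_eq with h | h
    · rw [hp0 u h]
      have := ne_lam C R ht hy (w := ⟨u, c0⟩) h 1
      simpa using this
    · rw [← h, hz0]
      intro he
      exact hBne y0 y hy0 hy (by linear_combination -he)
  obtain ⟨M1, hM1c, hM1e, hM10⟩ := lift_log {p : Y × ℝ | p.1 ≠ x ∧ 0 ≤ p.2} 0 hW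
    (fun p => Γ1 p.2 - lam (p.1, t)) (hg1.sub hl1)
    (fun p hp => sub_ne_zero.2 (hne1 p.1 hp.1 p.2 hp.2)) (fun y => B (y, y1))
    (hBc.comp (f := fun y => (y, y1)) (by fun_prop) fun y hy => ⟨hy.1, hy1⟩)
    (fun y hy => by rw [hBe _ hy.1 hy1, hz1]; ring)
  obtain ⟨M2, hM2c, hM2e, hM20⟩ := lift_log {p : Y × ℝ | p.1 ≠ x ∧ 0 ≤ p.2} 0 hW
    (fun p => lam (p.1, t) + 2 * Real.pi * Complex.I - Γ0 p.2) ((hl1.add continuousOn_const).sub hg0)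
    (fun p hp => sub_ne_zero.2 (hne0 p.1 hp.1 p.2 hp.2).symm) (fun y => B (y0, y))
    (hBc.comp (f := fun y => (y0, y)) (by fun_prop) fun y hy => ⟨hy0, hy.1⟩)
    (fun y hy => by rw [hBe _ hy0 hy.1, hz0]; ring)
  -- the quadrant: (u1, u0)
  have hne : ∀ p : ℝ × ℝ, 0 ≤ p.1 → 0 ≤ p.2 → Γ1 p.1 - Γ0 p.2 ≠ 0 := by
    rintro ⟨u1, u0⟩ hu1 hu0
    rw [sub_ne_zero]
    have hu1 : 0 ≤ u1 := hu1
    have hu0 : 0 ≤ u0 := hu0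
    show Γ1 u1 ≠ Γ0 u0
    rcases hu0.lt_or_eq with h | h
    · rcases hu1.lt_or_eq with h' | h'
      · rw [hp0 u0 h, hp1 u1 h']
        intro he
        have := congrArg Complex.im (C.inj_ht (w := ⟨u1, c1⟩) (w' := ⟨u0, c0⟩) h' h he)
        exact hc.ne this
      · rw [← h', hz1]
        exact (hne0 y1 hy1 u0 hu0).symm
    · rw [← h, hz0]
      exact hne1 y0 hy0 u1 hu1
  obtain ⟨M, hMc, hMe, hM0⟩ := lift_log {p : ℝ × ℝ | 0 ≤ p.1 ∧ 0 ≤ p.2} 0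
    (fun z τ hz s hs => ⟨hz.1, hstar τ s hz.2 hs⟩)
    (fun p => Γ1 p.1 - Γ0 p.2) ((hc1.comp continuousOn_fst fun p hp => hp.1).sub
      (hc0.comp continuousOn_snd fun p hp => hp.2))
    (fun p hp => hne p hp.1 hp.2) (fun u1 => M1 (y0, u1))
    (hM1c.comp (f := fun u : ℝ => (y0, u)) (by fun_prop) fun u hu => ⟨hy0, hu.1⟩)
    (fun u hu => by rw [hM1e (y0, u) ⟨hy0, hu.1⟩, hz0])
  have hMc' : ∀ u ≥ 0, ContinuousOn (fun v : ℝ => M (u, v)) (Ici 0) := fun u hu =>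
    hMc.comp (f := fun v : ℝ => (u, v)) (by fun_prop) fun v hv => ⟨hu, hv⟩
  have hMc'' : ∀ v ≥ 0, ContinuousOn (fun u : ℝ => M (u, v)) (Ici 0) := fun v hv =>
    hMc.comp (f := fun u : ℝ => (u, v)) (by fun_prop) fun u hu => ⟨hu, hv⟩
  have hMM2 : ∀ v ∈ Ici (0:ℝ), M (0, v) = M2 (y1, v) := by
    refine log_unique isPreconnected_Ici (hMc' 0 le_rfl)
      (hM2c.comp (f := fun u : ℝ => (y1, u)) (by fun_prop) fun u hu => ⟨hy1, hu⟩) ?_ self_mem_Ici ?_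
    · intro v hv
      rw [hMe (0, v) ⟨le_rfl, hv⟩, hM2e (y1, v) ⟨hy1, hv⟩, hz1]
    · rw [hM0 0 ⟨le_rfl, le_rfl⟩, hM10 y0 ⟨hy0, le_rfl⟩, hM20 y1 ⟨hy1, le_rfl⟩]
  -- asymptotics
  obtain ⟨L, hL⟩ := C.asym t
  obtain ⟨R1, hR1, hL1⟩ := hL (min 1 ((c0 - c1) / 4)) (lt_min one_pos (by linarith))
  obtain ⟨L2, hL2⟩ := R.lam_bdd ht
  set P := R1 + 1 with hP
  have hPp : 0 < P := by linarith
  have as0 : ∀ u ≥ P, |(Γ0 u).re - u - L| < 1 ∧ |(Γ0 u).im - c0| < (c0 - c1) / 4 := by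
    intro u hu
    rw [hp0 u (by linarith)]
    have h := hL1 ⟨u, c0⟩ (by show R1 < u; linarith)
    have h1 := (Complex.abs_re_le_norm _).trans_lt h
    have h2 := (Complex.abs_im_le_norm _).trans_lt h
    simp at h1 h2
    exact ⟨h1.1, h2.2⟩
  have as1 : ∀ u ≥ P, |(Γ1 u).re - u - L| < 1 ∧ |(Γ1 u).im - c1| < (c0 - c1) / 4 := by
    intro u hu
    rw [hp1 u (by linarith)]
    have h := hL1 ⟨u, c1⟩ (by show R1 < u; linarith)
    have h1 := (Complex.abs_re_le_norm _).trans_lt h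
    have h2 := (Complex.abs_im_le_norm _).trans_lt h
    simp at h1 h2
    exact ⟨h1.1, h2.2⟩
  have bdd : ∀ Γ : ℝ → ℂ, ContinuousOn Γ (Ici 0) → ∃ b, ∀ u ∈ Icc 0 P, (Γ u).re < b := by
    intro Γ hΓ
    obtain ⟨u0, -, h0⟩ := isCompact_Icc.exists_isMaxOn (nonempty_Icc.2 hPp.le)
      (Complex.continuous_re.comp_continuousOn (hΓ.mono Icc_subset_Ici_self))
    refine ⟨(Γ u0).re + 1, fun u hu => ?_⟩
    have : (Γ u).re ≤ (Γ u0).re := h0 hu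
    linarith
  obtain ⟨b0, hb0⟩ := bdd Γ0 hc0
  obtain ⟨b1, hb1⟩ := bdd Γ1 hc1
  set Q := P + |L| + |L2| + |b0| + |b1| + 2 with hQ
  have hQP : P ≤ Q := by
    have := abs_nonneg L; have := abs_nonneg L2; have := abs_nonneg b0; have := abs_nonneg b1
    linarith
  have hQ0 : 0 ≤ Q := hPp.le.trans hQP
  have big : ∀ m, m ≤ |L2| ∨ m ≤ |b0| ∨ m ≤ |b1| → m < Q + L - 1 := by
    intro m hm
    have := abs_nonneg L2; have := abs_nonneg b0; have := abs_nonneg b1; have := neg_abs_le L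
    rcases hm with h | h | h <;> linarith
  have hre0 : ∀ m, m ≤ |L2| ∨ m ≤ |b0| ∨ m ≤ |b1| → m < (Γ0 Q).re := fun m hm => by
    have := (abs_lt.1 (as0 Q hQP).1).1
    linarith [big m hm]
  have hre1 : ∀ m, m ≤ |L2| ∨ m ≤ |b0| ∨ m ≤ |b1| → m < (Γ1 Q).re := fun m hm => by
    have := (abs_lt.1 (as1 Q hQP).1).1
    linarith [big m hm]
  have hpi := Real.pi_pos
  have himneg : ∀ u ≥ P, ∀ v ≥ P, (Γ1 u - Γ0 v).im < 0 := by
    intro u hu v hv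
    have h1 := abs_lt.1 (as1 u hu).2
    have h2 := abs_lt.1 (as0 v hv).2
    rw [Complex.sub_im]
    linarith [h1.2, h2.1]
  -- first route
  have A1 : |(M (Q, 0)).im| < Real.pi / 2 := by
    rw [hM0 Q ⟨hQ0, le_rfl⟩]
    have := clopen_gen (σ := 1) (θ := 0) (Or.inl ⟨rfl, rfl⟩) hc1 (l := fun y => lam (y, t)) (R.lam_atBot ht)
      (R := Q) hQ0 (fun y hy => (hL2 y hy).trans_le (hre1 _ (Or.inl (le_abs_self _))).le) hM1c
      (fun y hy u hu => by rw [hM1e (y, u) ⟨hy, hu⟩]; simp) (by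
        filter_upwards [hB1 y1 hy1, self_mem_nhdsWithin] with y h1 h2
        rw [hM10 y ⟨h2, le_rfl⟩, sub_zero]
        exact h1) y0 hy0
    simpa using this
  have A2 : |(M (Q, P)).im - 0| < Real.pi / 2 := by
    refine sector_lemma (S := Icc 0 P) (G := fun v => M (Q, v)) isPreconnected_Icc
      ((hMc' Q hQ0).mono Icc_subset_Ici_self) 0 ?_ (left_mem_Icc.2 hPp.le) (by simpa using A1) P
      (right_mem_Icc.2 hPp.le)
    intro v hv
    rw [hMe _ ⟨hQ0, hv.1⟩]
    have := hre1 _ (Or.inr (Or.inl (le_abs_self b0)))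
    have := hb0 v hv
    simp
    linarith
  have him : ∀ p : ℝ × ℝ, P ≤ p.1 → P ≤ p.2 → Real.sin (M p).im < 0 := by
    intro p h1 h2
    have h3 := himneg p.1 h1 p.2 h2
    rw [← hMe p ⟨hPp.le.trans h1, hPp.le.trans h2⟩, Complex.exp_im] at h3
    by_contra h4
    have := mul_nonneg (Real.exp_pos (M p).re).le (not_lt.1 h4)
    linarith
  have A3 : |(M (P, P)).im - (-(Real.pi / 2) : ℝ)| < Real.pi / 2 := by
    refine sector_lemma (S := Icc P Q) (G := fun u => M (u, P)) isPreconnected_Icc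
      ((hMc'' P hPp.le).mono fun u hu => hPp.le.trans hu.1) _ ?_ (right_mem_Icc.2 hQP) ?_ P
      (left_mem_Icc.2 hQP)
    · intro u hu
      rw [hMe _ ⟨hPp.le.trans hu.1, hPp.le⟩]
      have h1 := himneg u hu.1 P le_rfl
      have h2 : Complex.exp (-((-(Real.pi / 2) : ℝ) * Complex.I)) = Complex.I := by
        push_cast
        rw [neg_mul, neg_neg, Complex.exp_pi_div_two_mul_I]
      rw [h2]
      simp only [Complex.mul_re, Complex.I_re, Complex.I_im]
      linarith
    · have h1 := him (Q, P) hQP le_rfl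
      have h2 : (M (Q, P)).im < 0 := by
        by_contra h3
        rw [sub_zero] at A2
        have := Real.sin_nonneg_of_nonneg_of_le_pi (not_lt.1 h3) (by linarith [(abs_lt.1 A2).2])
        linarith
      rw [sub_zero] at A2
      rw [abs_lt] at A2 ⊢
      constructor <;> linarith
  -- second route
  have B1 : |(M (0, Q)).im - Real.pi| < Real.pi / 2 := by
    rw [hMM2 Q hQ0]
    refine clopen_gen (σ := -1) (θ := Real.pi) (Or.inr ⟨rfl, rfl⟩) hc0
      (l := fun y => lam (y, t) + 2 * Real.pi * Complex.I) (by simpa using R.lam_atBot ht)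
      (R := Q) hQ0 (fun y hy => ?_) hM2c
      (fun y hy u hu => by rw [hM2e (y, u) ⟨hy, hu⟩]; push_cast; ring) (by
        filter_upwards [hB2 y0 hy0, self_mem_nhdsWithin] with y h1 h2
        rw [hM20 y ⟨h2, le_rfl⟩]
        exact h1) y1 hy1
    have := (hL2 y hy).trans_le (hre0 _ (Or.inl (le_abs_self _))).le
    simpa using this
  have B2 : |(M (P, Q)).im - Real.pi| < Real.pi / 2 := by
    refine sector_lemma (S := Icc 0 P) (G := fun u => M (u, Q)) isPreconnected_Icc
      ((hMc'' Q hQ0).mono Icc_subset_Ici_self) Real.pi ?_ (left_mem_Icc.2 hPp.le) B1 P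
      (right_mem_Icc.2 hPp.le)
    intro u hu
    rw [hMe _ ⟨hu.1, hQ0⟩, sigma_exp (σ := -1) (θ := Real.pi) (Or.inr ⟨rfl, rfl⟩)]
    have := hre0 _ (Or.inr (Or.inr (le_abs_self b1)))
    have := hb1 u hu
    simp
    linarith
  have B3 : |(M (P, P)).im - (Real.pi + Real.pi / 2 : ℝ)| < Real.pi / 2 := by
    refine sector_lemma (S := Icc P Q) (G := fun v => M (P, v)) isPreconnected_Icc
      ((hMc' P hPp.le).mono fun u hu => hPp.le.trans hu.1) _ ?_ (right_mem_Icc.2 hQP) ?_ P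
      (left_mem_Icc.2 hQP)
    · intro u hu
      rw [hMe _ ⟨hPp.le, hPp.le.trans hu.1⟩]
      have h1 := himneg P le_rfl u hu.1
      have h2 : Complex.exp (-((Real.pi + Real.pi / 2 : ℝ) * Complex.I)) = Complex.I := by
        push_cast
        rw [add_mul, Complex.exp_neg, Complex.exp_add, Complex.exp_pi_mul_I, Complex.exp_pi_div_two_mul_I]
        simp
      rw [h2]
      simp only [Complex.mul_re, Complex.I_re, Complex.I_im]
      linarith
    · have h1 := him (P, Q) le_rfl hQP
      have h2 : Real.pi < (M (P, Q)).im := by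
        by_contra h3
        have := Real.sin_nonneg_of_nonneg_of_le_pi (x := (M (P, Q)).im)
          (by linarith [(abs_lt.1 B2).1]) (not_lt.1 h3)
        linarith
      rw [abs_lt] at B2 ⊢
      constructor <;> linarith
  rw [abs_lt] at A3 B3
  linarith [A3.2, B3.1]

theorem order [PreconnectedSpace Y] (C : S.IsCore x Φ) (R : S.Ray x c T γ lam) {t : ℝ} (ht : 0 ≤ t)
    {c1 c2 : ℝ} {N1 N2 : ℤ} {y1 y2 : Y} (h1 : Ends x Φ lam t c1 N1 y1) (h2 : Ends x Φ lam t c2 N2 y2)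
    (hc : c1 < c2) : N1 ≤ N2 := by
  by_contra hN
  have hN : N2 + 1 ≤ N1 := not_le.1 hN
  have h3 := C.ends_shift h2 (-N2)
  have h4 := C.ends_shift h1 (1 - N1)
  rw [add_neg_cancel] at h3
  rw [add_sub_cancel] at h4
  refine order_aux C R ht h3 h4 ?_
  have h5 : ((N2 : ℝ) + 1) ≤ N1 := by exact_mod_cast hN
  push_cast
  nlinarith [Real.pi_pos]

end Sys


theorem dir_pi (θ : ℝ) (z : ℂ) : (Complex.exp (-((θ + Real.pi : ℝ) * Complex.I)) * z).re =
    -(Complex.exp (-(θ * Complex.I)) * z).re := by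
  push_cast
  rw [add_mul, neg_add, Complex.exp_add, Complex.exp_neg (Real.pi * Complex.I), Complex.exp_pi_mul_I]
  simp

theorem RM.psi_dir {K : Set ℂ} {f : ℂ → ℂ} {M : ℝ} (h : RM K f M) {θ c : ℝ} (hcos : 0 < Real.cos (c - θ)) :
    Tendsto (fun u : ℝ => (Complex.exp (-(θ * Complex.I)) * psi f ⟨u, c⟩).re) atTop atTop := by
  obtain ⟨C, hC, hC'⟩ := h.Q_zero
  have h1 : Tendsto (fun u : ℝ => Complex.exp (-(⟨u, c⟩ : ℂ)) * psi f ⟨u, c⟩) atTop (𝓝 C) := by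
    rw [Metric.tendsto_atTop]
    intro ε hε
    obtain ⟨R, hR, hR'⟩ := h.psi_asym hε
    refine ⟨R + 1, fun u hu => ?_⟩
    rw [dist_eq_norm, ← hC']
    exact hR' ⟨u, c⟩ (by show R < u; linarith)
  have h2 : Tendsto (fun u : ℝ => (Complex.exp ((c - θ : ℝ) * Complex.I) *
      (Complex.exp (-(⟨u, c⟩ : ℂ)) * psi f ⟨u, c⟩)).re) atTop (𝓝 (C * Real.cos (c - θ))) := by
    have := (Complex.continuous_re.tendsto _).comp (h1.const_mul (Complex.exp ((c - θ : ℝ) * Complex.I)))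
    have h3 : (Complex.exp ((c - θ : ℝ) * Complex.I) * (C : ℂ)).re = C * Real.cos (c - θ) := by
      rw [Complex.mul_re, Complex.exp_ofReal_mul_I_re]
      simp [mul_comm]
    rw [h3] at this
    exact this
  have h3 := Real.tendsto_exp_atTop.atTop_mul_pos (mul_pos hC hcos) h2
  refine h3.congr fun u => ?_
  rw [← Complex.re_ofReal_mul, Complex.ofReal_exp, ← mul_assoc, ← mul_assoc, ← Complex.exp_add, ← Complex.exp_add]
  have h4 : ((u : ℂ) + (c - θ : ℝ) * Complex.I + -(⟨u, c⟩ : ℂ)) = -(θ * Complex.I) := by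
    apply Complex.ext <;> simp
    ring
  rw [h4]

theorem sector_transfer {θ θ' : ℝ} {G : ℂ} (h1 : |G.im - θ| < Real.pi / 2) (h2 : |θ - θ'| < Real.pi / 2)
    (hpos : 0 < (Complex.exp (-(θ' * Complex.I)) * Complex.exp G).re) : |G.im - θ'| < Real.pi / 2 := by
  rw [← Complex.exp_add, Complex.exp_re] at hpos
  have h3 : (-(θ' * Complex.I) + G).im = G.im - θ' := by simp; ring
  rw [h3, ← Real.cos_abs] at hpos
  by_contra h4
  have h5 : |G.im - θ'| ≤ Real.pi := by
    have := abs_sub_le G.im θ θ'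
    linarith
  have := Real.cos_nonpos_of_pi_div_two_le_of_le (not_lt.1 h4) (by linarith [Real.pi_pos])
  have := mul_nonpos_of_nonneg_of_nonpos (Real.exp_pos (-(θ' * Complex.I) + G).re).le this
  linarith

namespace Sys
variable {Y : Type*} [TopologicalSpace Y] [CompactSpace Y] [Nontrivial Y] {S : Sys Y}
variable {x : Y} {c T : ℝ} {γ : ℝ → ℂ} {lam : Y × ℝ → ℂ} {Φ : ℝ → ℂ → ℂ}

theorem zero_sheet (C : S.IsCore x Φ) (R : S.Ray x c T γ lam) {c1 : ℝ} {N : ℤ} {y : Y}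
    (hc : c < c1) (hc' : c1 < c + 2 * Real.pi) (hl : Lands (S.φ 0) c1 (S.H 0 y))
    (h : Ends x Φ lam 0 c1 N y) : N = 0 := by
  have hpi := Real.pi_pos
  have h0 := S.rm 0
  obtain ⟨hy, hN⟩ := h
  set P := extend (fun u : ℝ => psi (S.φ 0) ⟨u, c1⟩) (S.H 0 y) with hP
  set G := extend (fun u : ℝ => Φ 0 ⟨u, c1⟩) (lam (y, 0) + N * (2 * Real.pi * Complex.I)) with hG
  have hPc : ContinuousOn P (Ici 0) := by
    refine extend_cont ?_ hl
    exact h0.psi_diff.continuousOn.comp (continuous_hor c1).continuousOn fun u hu => hu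
  have hGc : ContinuousOn G (Ici 0) := extend_cont (C.cont_hor 0 c1) hN
  have hPp : ∀ u > 0, P u = psi (S.φ 0) ⟨u, c1⟩ := fun u hu => extend_pos hu
  have hGp : ∀ u > 0, G u = Φ 0 ⟨u, c1⟩ := fun u hu => extend_pos hu
  have hP0 : P 0 = S.H 0 y := extend_zero
  have hG0 : G 0 = lam (y, 0) + N * (2 * Real.pi * Complex.I) := extend_zero
  have hγ0 : γ 0 = S.H 0 x := R.γ_zero 0 le_rfl
  have hγc := R.γ_cont
  have hne : ∀ p : ℝ × ℝ, 0 ≤ p.1 → 0 ≤ p.2 → P p.1 - γ p.2 ≠ 0 := by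
    rintro ⟨v, u⟩ hv hu
    rw [sub_ne_zero]
    have hv : 0 ≤ v := hv
    have hu : 0 ≤ u := hu
    show P v ≠ γ u
    rcases hv.lt_or_eq with h1 | h1
    · rw [hPp v h1]
      rcases hu.lt_or_eq with h2 | h2
      · rw [R.γ_pos u h2]
        intro he
        obtain ⟨n, hn⟩ := h0.psi_inj (w := ⟨v, c1⟩) (w' := ⟨u, c⟩) h1 h2 he
        have := congrArg Complex.im hn
        simp at this
        have h3 : (0:ℝ) < n := by
          by_contra h4
          nlinarith [mul_nonneg (neg_nonneg.2 (not_lt.1 h4)) hpi.le]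
        have h5 : (n:ℝ) < 1 := by
          by_contra h4
          nlinarith [mul_nonneg (sub_nonneg.2 (not_lt.1 h4)) hpi.le]
        have h6 : 0 < n := by exact_mod_cast h3
        have h7 : n < 1 := by exact_mod_cast h5
        omega
      · rw [← h2, hγ0]
        exact h0.psi_ne (w := ⟨v, c1⟩) h1 (mem_range_self x)
    · rw [← h1, hP0]
      rcases hu.lt_or_eq with h2 | h2
      · rw [R.γ_pos u h2]
        exact (h0.psi_ne (w := ⟨u, c⟩) h2 (mem_range_self y)).symm
      · rw [← h2, hγ0]
        exact fun he => hy (S.inj 0 he)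
  obtain ⟨M, hMc, hMe, hM0⟩ := lift_log {p : ℝ × ℝ | 0 ≤ p.1 ∧ 0 ≤ p.2} 0
    (fun z τ hz s hs => ⟨hz.1, by
      have := mul_nonneg hs.1 hz.2
      show 0 ≤ 0 + s * (τ - 0)
      simpa using this⟩)
    (fun p => P p.1 - γ p.2) ((hPc.comp continuousOn_fst fun p hp => hp.1).sub (by fun_prop))
    (fun p hp => hne p hp.1 hp.2) G (hGc.mono fun v hv => hv.1) (fun v hv => by
      have hv : 0 ≤ v := hv.1
      show _ = P v - γ 0
      rcases hv.lt_or_eq with h1 | h1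
      · rw [hGp v h1, hPp v h1, hγ0, C.exp 0 _ h1]
      · rw [← h1, hG0, hP0, hγ0, Complex.exp_add, Complex.exp_int_mul_two_pi_mul_I, mul_one,
          R.lam_exp' le_rfl hy])
  have hMc' : ∀ u ≥ 0, ContinuousOn (fun v : ℝ => M (u, v)) (Ici 0) := fun u hu =>
    hMc.comp (f := fun v : ℝ => (u, v)) (by fun_prop) fun v hv => ⟨hu, hv⟩
  have hMc'' : ∀ v ≥ 0, ContinuousOn (fun u : ℝ => M (u, v)) (Ici 0) := fun v hv =>
    hMc.comp (f := fun u : ℝ => (u, v)) (by fun_prop) fun u hu => ⟨hu, hv⟩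
  let m : ℝ := (c1 + c + Real.pi) / 2
  have hm1 : |c1 - m| < Real.pi / 2 := by
    rw [abs_lt]; constructor <;> simp only [m] <;> linarith
  have hm2 : |m - (c + Real.pi)| < Real.pi / 2 := by
    rw [abs_lt]; constructor <;> simp only [m] <;> linarith
  have dP : ∀ θ : ℝ, 0 < Real.cos (c1 - θ) →
      Tendsto (fun u => (Complex.exp (-(θ * Complex.I)) * P u).re) atTop atTop := by
    intro θ hθ
    refine (h0.psi_dir hθ).congr' ?_
    filter_upwards [eventually_gt_atTop 0] with u hu
    rw [hPp u hu]
  have dγ : ∀ θ : ℝ, 0 < Real.cos (c - θ) →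
      Tendsto (fun u => (Complex.exp (-(θ * Complex.I)) * γ u).re) atTop atTop := by
    intro θ hθ
    refine (h0.psi_dir hθ).congr' ?_
    filter_upwards [eventually_gt_atTop 0] with u hu
    rw [R.γ_pos u hu]
  have e1 := (dP m (Real.cos_pos_of_mem_Ioo (abs_lt.1 hm1 |> fun h => ⟨by linarith [h.1], h.2⟩))).eventually
    (eventually_gt_atTop 0)
  have e2 : ∀ᶠ u in atTop, (Complex.exp (-(m * Complex.I)) * γ u).re < 0 := by
    have h3 := dγ (m - Real.pi) (Real.cos_pos_of_mem_Ioo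
      ⟨by linarith [(abs_lt.1 hm2).2], by linarith [(abs_lt.1 hm2).1]⟩)
    filter_upwards [h3.eventually (eventually_gt_atTop 0)] with u hu
    have := dir_pi (m - Real.pi) (γ u)
    rw [sub_add_cancel] at this
    linarith
  obtain ⟨U0, hU0⟩ := eventually_atTop.1 ((e1.and e2).and (eventually_ge_atTop 0))
  have hU00 : 0 ≤ U0 := (hU0 U0 le_rfl).2
  have quad : ∀ v ≥ U0, ∀ u ≥ U0, 0 < (Complex.exp (-(m * Complex.I)) * Complex.exp (M (v, u))).re := by
    intro v hv u hu
    rw [hMe (v, u) ⟨hU00.trans hv, hU00.trans hu⟩, mul_sub, Complex.sub_re]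
    linarith [(hU0 v hv).1.1, (hU0 u hu).1.2]
  -- choose V
  have bdd : ∀ Γ : ℝ → ℝ, ContinuousOn Γ (Ici 0) → ∃ b, ∀ u ∈ Icc 0 U0, Γ u < b := by
    intro Γ hΓ
    obtain ⟨u0, -, h0⟩ := isCompact_Icc.exists_isMaxOn (nonempty_Icc.2 hU00) (hΓ.mono Icc_subset_Ici_self)
    refine ⟨Γ u0 + 1, fun u hu => ?_⟩
    have : Γ u ≤ Γ u0 := h0 hu
    linarith
  obtain ⟨b1, hb1⟩ := bdd (fun u => (Complex.exp (-(c1 * Complex.I)) * γ u).re) (by fun_prop)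
  obtain ⟨b2, hb2⟩ := bdd (fun u => (Complex.exp (-(c * Complex.I)) * P u).re)
    (Complex.continuous_re.comp_continuousOn (continuousOn_const.mul hPc))
  obtain ⟨L, hL⟩ := C.asym 0
  obtain ⟨R1, hR1, hL1⟩ := hL (Real.pi / 2) (by positivity)
  obtain ⟨V, ⟨hV1, hV2⟩, hV3⟩ := (((dP c1 (by simp)).eventually (eventually_gt_atTop b1)).and
    (eventually_gt_atTop (max R1 0))).and (eventually_ge_atTop U0) |>.exists
  have hVR := (max_lt_iff.1 hV2).1
  have hV0 := (max_lt_iff.1 hV2).2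
  obtain ⟨U, ⟨hU1, hU2⟩, hU3⟩ := (((dγ c (by simp)).eventually (eventually_gt_atTop b2)).and
    (eventually_ge_atTop T)).and (eventually_ge_atTop U0) |>.exists
  have hUpos : 0 < U := R.Tpos.trans_le hU2
  have s1 : |(M (V, 0)).im - c1| < Real.pi / 2 := by
    rw [hM0 V ⟨hV0.le, le_rfl⟩, hGp V hV0]
    have h1 := (Complex.abs_im_le_norm _).trans_lt (hL1 ⟨V, c1⟩ hVR)
    simpa using h1
  have pos1 : ∀ u ∈ Icc 0 U0, 0 < (Complex.exp (-(c1 * Complex.I)) * Complex.exp (M (V, u))).re := by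
    intro u hu
    rw [hMe (V, u) ⟨hV0.le, hu.1⟩, mul_sub, Complex.sub_re]
    linarith [hb1 u hu]
  have s2 : |(M (V, U0)).im - c1| < Real.pi / 2 :=
    sector_lemma (S := Icc 0 U0) (G := fun u => M (V, u)) isPreconnected_Icc
      ((hMc' V hV0.le).mono Icc_subset_Ici_self) c1 pos1 (left_mem_Icc.2 hU00) s1 U0 (right_mem_Icc.2 hU00)
  have s3 := sector_transfer s2 hm1 (quad V hV3 U0 le_rfl)
  have s4 : |(M (U0, U0)).im - m| < Real.pi / 2 :=
    sector_lemma (S := Icc U0 V) (G := fun v => M (v, U0)) isPreconnected_Icc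
      ((hMc'' U0 hU00).mono fun v hv => hU00.trans hv.1) m (fun v hv => quad v hv.1 U0 le_rfl)
      (right_mem_Icc.2 hV3) s3 U0 (left_mem_Icc.2 hV3)
  have s5 : |(M (U0, U)).im - m| < Real.pi / 2 :=
    sector_lemma (S := Icc U0 U) (G := fun u => M (U0, u)) isPreconnected_Icc
      ((hMc' U0 hU00).mono fun v hv => hU00.trans hv.1) m (fun u hu => quad U0 le_rfl u hu.1)
      (left_mem_Icc.2 hU3) s4 U (right_mem_Icc.2 hU3)
  have pos2 : ∀ v ∈ Icc 0 U0, 0 < (Complex.exp (-((c + Real.pi : ℝ) * Complex.I)) * Complex.exp (M (v, U))).re := by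
    intro v hv
    rw [dir_pi, hMe (v, U) ⟨hv.1, hUpos.le⟩, mul_sub, Complex.sub_re]
    linarith [hb2 v hv]
  have s6 := sector_transfer s5 hm2 (pos2 U0 (right_mem_Icc.2 hU00))
  have s7 : |(M (0, U)).im - (c + Real.pi)| < Real.pi / 2 :=
    sector_lemma (S := Icc 0 U0) (G := fun v => M (v, U)) isPreconnected_Icc
      ((hMc'' U hUpos.le).mono Icc_subset_Ici_self) (c + Real.pi) pos2
      (right_mem_Icc.2 hU00) s6 0 (left_mem_Icc.2 hU00)
  have hle : ∀ u ≥ 0, Complex.exp (lam (y, -u)) = S.H 0 y - γ u := by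
    intro u hu
    rw [R.lam_exp _ (Or.inl hy), S.E_nonpos (neg_nonpos.2 hu), neg_neg]
  have hlc : Continuous (fun u : ℝ => lam (y, -u)) :=
    R.lam_cont.comp_continuous (f := fun u : ℝ => (y, -u)) (by fun_prop) fun u => Or.inl hy
  have s8 : |(lam (y, -U)).im - (c + Real.pi : ℝ)| < Real.pi / 2 := by
    refine sector_lemma (S := Icc T U) (G := fun u => lam (y, -u)) isPreconnected_Icc
      hlc.continuousOn (c + Real.pi) (fun u hu => ?_)
      (left_mem_Icc.2 hU2) (R.lam_base y) U (right_mem_Icc.2 hU2)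
    rw [hle u (R.Tpos.le.trans hu.1), mul_sub, Complex.sub_re]
    have h1 := R.kM u hu.1
    have h2 : |(Complex.exp (-((c + Real.pi : ℝ) * Complex.I)) * S.H 0 y).re| ≤ S.M := by
      refine (Complex.abs_re_le_norm _).trans ?_
      rw [norm_mul, Complex.norm_exp]
      simpa using S.bdd 0 y
    linarith [(abs_le.1 h2).1]
  have hexp : ∀ u ∈ Icc 0 U, Complex.exp (M (0, u)) = Complex.exp (lam (y, -u)) := by
    intro u hu
    rw [hMe (0, u) ⟨le_rfl, hu.1⟩, hle u hu.1, hP0]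
  have fin := log_unique (S := Icc 0 U) (G₁ := fun u => M (0, u)) isPreconnected_Icc
    ((hMc' 0 le_rfl).mono Icc_subset_Ici_self) hlc.continuousOn hexp (right_mem_Icc.2 hUpos.le)
    (exp_eq_im_lt (hexp U (right_mem_Icc.2 hUpos.le)) (by
      rw [abs_lt] at s7 s8 ⊢
      constructor <;> linarith)) 0 (left_mem_Icc.2 hUpos.le)
  rw [hM0 0 ⟨le_rfl, le_rfl⟩, hG0, neg_zero] at fin
  have h9 : (N : ℂ) * (2 * Real.pi * Complex.I) = 0 := by linear_combination fin
  have h10 : (2 * Real.pi * Complex.I : ℂ) ≠ 0 := Complex.two_pi_I_ne_zero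
  simpa [h10] using h9

end Sys


theorem ae_dense {P : ℝ → Prop} (hP : ∀ᵐ c : ℝ, P c) {a b : ℝ} (hab : a < b) : ∃ c ∈ Ioo a b, P c := by
  by_contra hcon
  push Not at hcon
  have h1 : Ioo a b ⊆ {c | ¬ P c} := fun c hc => hcon c hc
  have h2 := MeasureTheory.measure_mono_null h1 (MeasureTheory.ae_iff.1 hP)
  rw [Real.volume_Ioo, ENNReal.ofReal_eq_zero] at h2
  linarith

theorem sel {g : ℝ → ENNReal} {P : ℝ → Prop} (hP : ∀ᵐ c : ℝ, P c) {α β η : ℝ} (hη : 0 ≤ η)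
    (h : ∫⁻ c in Ioo α β, g c < ENNReal.ofReal (η * (β - α))) : ∃ c ∈ Ioo α β, P c ∧ g c < ENNReal.ofReal η := by
  by_contra hcon
  push Not at hcon
  have h1 : ∫⁻ c in Ioo α β, ENNReal.ofReal η ≤ ∫⁻ c in Ioo α β, g c := by
    refine MeasureTheory.lintegral_mono_ae ?_
    refine (MeasureTheory.ae_restrict_iff' measurableSet_Ioo).2 ?_
    filter_upwards [hP] with c hc hcm
    exact hcon c hcm hc
  rw [MeasureTheory.setLIntegral_const, Real.volume_Ioo, ← ENNReal.ofReal_mul hη] at h1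
  exact absurd h (not_lt.2 h1)

namespace RM
variable {K : Set ℂ} {f : ℂ → ℂ} {M : ℝ} (h : RM K f M)
include h

theorem box_small (a : ℝ) {η : ℝ} (hη : 0 < η) : ∀ᶠ δ in 𝓝[>] (0:ℝ),
    ∫⁻ p in Ioo 0 (2 * δ) ×ˢ Ioo (a - 2 * δ) (a + 2 * δ), spd f p < ENNReal.ofReal (η * δ) := by
  have hpi := Real.pi_gt_three
  let D : Set (ℝ × ℝ) := Ioo (0:ℝ) 1 ×ˢ Ioo (a - Real.pi) (a - Real.pi + 2 * Real.pi)
  let Bx : ℝ → Set (ℝ × ℝ) := fun δ => Ioo 0 (2 * δ) ×ˢ Ioo (a - 2 * δ) (a + 2 * δ)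
  have hvol : ∀ δ > 0, MeasureTheory.volume (Bx δ) = ENNReal.ofReal (8 * δ ^ 2) := by
    intro δ hδ
    simp only [Bx]
    rw [MeasureTheory.Measure.volume_eq_prod, MeasureTheory.Measure.prod_prod, Real.volume_Ioo,
      Real.volume_Ioo, ← ENNReal.ofReal_mul (by linarith)]
    congr 1
    ring
  have h1 := MeasureTheory.tendsto_setLIntegral_zero (μ := MeasureTheory.volume.restrict D)
    (f := fun p => spd f p ^ 2) (l := 𝓝[>] (0:ℝ)) (s := Bx)
    ((h.area (a - Real.pi)).trans_lt (areaBd_lt M)).ne (by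
      have h2 : Tendsto (fun δ : ℝ => ENNReal.ofReal (8 * δ ^ 2)) (𝓝[>] 0) (𝓝 0) := by
        have : Continuous fun δ : ℝ => ENNReal.ofReal (8 * δ ^ 2) :=
          ENNReal.continuous_ofReal.comp (by fun_prop)
        have h3 := (this.tendsto 0).mono_left (nhdsWithin_le_nhds (s := Ioi 0))
        simpa using h3
      refine tendsto_of_tendsto_of_tendsto_of_le_of_le' tendsto_const_nhds h2 (by simp) ?_
      filter_upwards [self_mem_nhdsWithin] with δ hδ
      rw [← hvol δ hδ]
      exact MeasureTheory.Measure.restrict_apply_le _ _)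
  have hη2 : 0 < ENNReal.ofReal ((η / 3) ^ 2) := by positivity
  filter_upwards [h1.eventually (gt_mem_nhds hη2), Ioo_mem_nhdsGT (show (0:ℝ) < 1 / 2 by norm_num)] with δ h2 h3
  have hsub : Bx δ ⊆ D := by
    refine prod_mono (Ioo_subset_Ioo_right (by linarith [h3.2])) (Ioo_subset_Ioo (by linarith [h3.2]) (by linarith [h3.2]))
  rw [MeasureTheory.Measure.restrict_restrict_of_subset hsub] at h2
  refine (cs_lintegral f _).trans_lt ?_
  have h4 : (∫⁻ p in Bx δ, spd f p ^ 2) ^ (1/2 : ℝ) ≤ ENNReal.ofReal (η / 3) := by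
    refine (ENNReal.rpow_le_rpow h2.le (by norm_num)).trans ?_
    rw [ENNReal.ofReal_rpow_of_nonneg (by positivity) (by norm_num), ← Real.sqrt_eq_rpow,
      Real.sqrt_sq (by positivity)]
  have h5 : (MeasureTheory.volume (Bx δ)) ^ (1/2 : ℝ) ≤ ENNReal.ofReal (2.9 * δ) := by
    rw [hvol δ h3.1, ENNReal.ofReal_rpow_of_nonneg (by positivity) (by norm_num), ← Real.sqrt_eq_rpow]
    apply ENNReal.ofReal_le_ofReal
    rw [Real.sqrt_le_left (by linarith [h3.1])]
    nlinarith [sq_nonneg δ]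
  refine (mul_le_mul' h4 h5).trans_lt ?_
  rw [← ENNReal.ofReal_mul (by positivity)]
  refine (ENNReal.ofReal_lt_ofReal_iff (mul_pos hη h3.1)).2 ?_
  nlinarith [mul_pos hη h3.1]

theorem box_select {P : ℝ → Prop} (hP : ∀ᵐ c : ℝ, P c) (a : ℝ) {η : ℝ} (hη : 0 < η) : ∀ᶠ δ in 𝓝[>] (0:ℝ),
    ∃ c₁ ∈ Ioo (a - 2 * δ) (a - δ), ∃ c₂ ∈ Ioo (a + δ) (a + 2 * δ), ∃ u₁ ∈ Ioo (δ / 4) (δ / 2),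
    ∃ u₂ ∈ Ioo δ (2 * δ), P c₁ ∧ P c₂ ∧ len f c₁ (2 * δ) < ENNReal.ofReal η ∧
      len f c₂ (2 * δ) < ENNReal.ofReal η ∧
      (∀ c ∈ Icc c₁ c₂, ∀ c' ∈ Icc c₁ c₂, dist (psi f ⟨u₁, c⟩) (psi f ⟨u₁, c'⟩) < η) ∧
      (∀ c ∈ Icc c₁ c₂, ∀ c' ∈ Icc c₁ c₂, dist (psi f ⟨u₂, c⟩) (psi f ⟨u₂, c'⟩) < η) := by
  filter_upwards [h.box_small a (η := η / 4) (by positivity), self_mem_nhdsWithin] with δ h1 hδ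
  have hδ : 0 < δ := hδ
  have selc : ∀ α β, β - α = δ → a - 2 * δ ≤ α → β ≤ a + 2 * δ →
      ∃ c ∈ Ioo α β, P c ∧ len f c (2 * δ) < ENNReal.ofReal η := by
    intro α β h2 h3 h4
    refine sel hP hη.le ?_
    rw [fubini_len, h2]
    refine (MeasureTheory.lintegral_mono_set (prod_mono_right (Ioo_subset_Ioo h3 h4))).trans_lt (h1.trans_le ?_)
    apply ENNReal.ofReal_le_ofReal
    nlinarith
  have selu : ∀ α β, δ / 4 ≤ β - α → 0 ≤ α → β ≤ 2 * δ →
      ∃ u ∈ Ioo α β, ∀ c₁ c₂, a - 2 * δ < c₁ → c₂ < a + 2 * δ →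
        ∀ c ∈ Icc c₁ c₂, ∀ c' ∈ Icc c₁ c₂, dist (psi f ⟨u, c⟩) (psi f ⟨u, c'⟩) < η := by
    intro α β h2 h3 h4
    obtain ⟨u, hu, -, hu2⟩ := sel (g := fun u => ∫⁻ c in Ioo (a - 2 * δ) (a + 2 * δ), spd f (u, c))
      (P := fun _ => True) (MeasureTheory.ae_of_all _ fun _ => trivial) (α := α) (β := β) hη.le (by
        have h5 : ∫⁻ u in Ioo α β, ∫⁻ c in Ioo (a - 2 * δ) (a + 2 * δ), spd f (u, c) =
            ∫⁻ p in Ioo α β ×ˢ Ioo (a - 2 * δ) (a + 2 * δ), spd f p := by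
          rw [MeasureTheory.Measure.volume_eq_prod, ← MeasureTheory.Measure.prod_restrict,
            MeasureTheory.lintegral_prod _ (spd_meas f).aemeasurable]
        rw [h5]
        refine (MeasureTheory.lintegral_mono_set (prod_mono_left (Ioo_subset_Ioo h3 h4))).trans_lt (h1.trans_le ?_)
        apply ENNReal.ofReal_le_ofReal
        nlinarith)
    refine ⟨u, hu, fun c₁ c₂ h6 h7 => ?_⟩
    have key : ∀ c ∈ Icc c₁ c₂, ∀ c' ∈ Icc c₁ c₂, c ≤ c' → dist (psi f ⟨u, c⟩) (psi f ⟨u, c'⟩) < η := by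
      intro c hc c' hc' hle
      rw [dist_comm, ← edist_lt_ofReal, edist_eq_enorm_sub]
      refine (h.var_ver (h3.trans_lt hu.1) hle).trans_lt (lt_of_le_of_lt ?_ hu2)
      exact MeasureTheory.lintegral_mono_set (Icc_subset_Ioo (h6.trans_le hc.1) (hc'.2.trans_lt h7))
    intro c hc c' hc'
    rcases le_total c c' with hle | hle
    · exact key c hc c' hc' hle
    · rw [dist_comm]
      exact key c' hc' c hc hle
  obtain ⟨c₁, hc₁, hP1, hl1⟩ := selc (a - 2 * δ) (a - δ) (by ring) le_rfl (by linarith)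
  obtain ⟨c₂, hc₂, hP2, hl2⟩ := selc (a + δ) (a + 2 * δ) (by ring) (by linarith) le_rfl
  obtain ⟨u₁, hu₁, hd1⟩ := selu (δ / 4) (δ / 2) (by linarith) (by linarith) (by linarith)
  obtain ⟨u₂, hu₂, hd2⟩ := selu δ (2 * δ) (by linarith) (by linarith) (by linarith)
  exact ⟨c₁, hc₁, c₂, hc₂, u₁, hu₁, u₂, hu₂, hP1, hP2, hl1, hl2, hd1 c₁ c₂ hc₁.1 hc₂.2, hd2 c₁ c₂ hc₁.1 hc₂.2⟩

/-- maximum principle on a box -/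
theorem box_max {u₁ u₂ c₁ c₂ : ℝ} (h0 : 0 < u₁) {q : ℂ} {ρ : ℝ}
    (hv : ∀ c ∈ Icc c₁ c₂, ‖psi f ⟨u₁, c⟩ - q‖ ≤ ρ ∧ ‖psi f ⟨u₂, c⟩ - q‖ ≤ ρ)
    (hh : ∀ u ∈ Icc u₁ u₂, ‖psi f ⟨u, c₁⟩ - q‖ ≤ ρ ∧ ‖psi f ⟨u, c₂⟩ - q‖ ≤ ρ) {u c : ℝ}
    (hu : u ∈ Ioo u₁ u₂) (hc : c ∈ Ioo c₁ c₂) : ‖psi f ⟨u, c⟩ - q‖ ≤ ρ := by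
  have hu12 : u₁ < u₂ := hu.1.trans hu.2
  have hc12 : c₁ < c₂ := hc.1.trans hc.2
  have hcl : closure (Ioo u₁ u₂ ×ℂ Ioo c₁ c₂) = Icc u₁ u₂ ×ℂ Icc c₁ c₂ := by
    rw [Complex.closure_reProdIm, closure_Ioo hu12.ne, closure_Ioo hc12.ne]
  refine Complex.norm_le_of_forall_mem_frontier_norm_le (U := Ioo u₁ u₂ ×ℂ Ioo c₁ c₂)
    (f := fun w => psi f w - q) ((Metric.isBounded_Ioo _ _).reProdIm (Metric.isBounded_Ioo _ _)) ?_ ?_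
    (subset_closure (show (⟨u, c⟩ : ℂ) ∈ Ioo u₁ u₂ ×ℂ Ioo c₁ c₂ from ⟨hu, hc⟩))
  · refine DifferentiableOn.diffContOnCl ?_
    rw [hcl]
    exact (h.psi_diff.mono fun w hw => h0.trans_le hw.1.1).sub_const _
  · rintro ⟨u, c⟩ hz
    rw [Complex.frontier_reProdIm, closure_Ioo hu12.ne, closure_Ioo hc12.ne, frontier_Ioo hu12,
      frontier_Ioo hc12] at hz
    rcases hz with ⟨h1, h2⟩ | ⟨h1, h2⟩
    · rcases h2 with h2 | h2
      · have h2 : c = c₁ := h2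
        subst h2; exact (hh u h1).1
      · have h2 : c = c₂ := h2
        subst h2; exact (hh u h1).2
    · rcases h1 with h1 | h1
      · have h1 : u = u₁ := h1
        subst h1; exact (hv c h2).1
      · have h1 : u = u₂ := h1
        subst h1; exact (hv c h2).2

end RM


theorem close_im {Z : Type*} [TopologicalSpace Z] {S : Set Z} (hS : IsPreconnected S) {G : Z → ℂ}
    (hG : ContinuousOn G S) {g : ℂ} (hcl : ∀ z ∈ S, ‖Complex.exp (G z) - Complex.exp g‖ < ‖Complex.exp g‖)
    {z0 : Z} (hz0 : z0 ∈ S) (h0 : |(G z0).im - g.im| < Real.pi / 2) :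
    ∀ z ∈ S, |(G z).im - g.im| < Real.pi / 2 := by
  refine sector_lemma hS hG g.im (fun z hz => ?_) hz0 h0
  have h1 : Complex.exp (-(g.im * Complex.I)) * Complex.exp g = (‖Complex.exp g‖ : ℂ) := by
    rw [← Complex.exp_add, Complex.norm_exp, Complex.ofReal_exp]
    congr 1
    apply Complex.ext <;> simp
  have h2 : Complex.exp (-(g.im * Complex.I)) * Complex.exp (G z) = (‖Complex.exp g‖ : ℂ) +
      Complex.exp (-(g.im * Complex.I)) * (Complex.exp (G z) - Complex.exp g) := by
    rw [mul_sub, h1]; ring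
  have h3 : ‖Complex.exp (-(g.im * Complex.I)) * (Complex.exp (G z) - Complex.exp g)‖ < ‖Complex.exp g‖ := by
    rw [norm_mul, Complex.norm_exp]
    simpa using hcl z hz
  have h4 := (abs_lt.1 ((Complex.abs_re_le_norm _).trans_lt h3)).1
  rw [h2, Complex.add_re, Complex.ofReal_re]
  linarith

namespace Sys
variable {Y : Type*} [TopologicalSpace Y] [CompactSpace Y] [Nontrivial Y] {S : Sys Y}
variable {x : Y} {c T : ℝ} {γ : ℝ → ℂ} {lam : Y × ℝ → ℂ} {Φ : ℝ → ℂ → ℂ}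

theorem ae_ends (C : S.IsCore x Φ) (R : S.Ray x c T γ lam) {t : ℝ} (ht : 0 ≤ t) :
    ∀ᵐ c' : ℝ, len (S.φ t) c' 1 < ⊤ ∧ ∃ N y, Lands (S.φ t) c' (S.H t y) ∧ Ends x Φ lam t c' N y := by
  filter_upwards [(S.rm t).ae_len, (S.rm t).ae_not_lands (mem_range_self x)] with c' h1 h2
  obtain ⟨p, hp⟩ := (S.rm t).lands_of_len one_pos h1
  obtain ⟨y, rfl⟩ := (S.rm t).lands_mem hp
  have hy : y ≠ x := by rintro rfl; exact h2 hp
  obtain ⟨N, hN⟩ := exists_ends C R ht hy hp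
  exact ⟨h1, N, y, hp, hN⟩

/-- the angle of the moving ray -/
noncomputable def ang (x : Y) (Φ : ℝ → ℂ → ℂ) (lam : Y × ℝ → ℂ) (t : ℝ) : ℝ :=
  sSup {c' | ∃ N ≤ (-1 : ℤ), ∃ y, Ends x Φ lam t c' N y}

section
variable [PreconnectedSpace Y] (C : S.IsCore x Φ) (R : S.Ray x c T γ lam) {t : ℝ} (ht : 0 ≤ t)
include C R ht

theorem exists_sheet (n : ℤ) : ∃ c' y, Ends x Φ lam t c' n y := by
  obtain ⟨c', -, -, N, y, -, h⟩ := ae_dense (ae_ends C R ht) (zero_lt_one (α := ℝ))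
  have := C.ends_shift h (n - N)
  rw [add_sub_cancel] at this
  exact ⟨_, y, this⟩

theorem ang_bdd : BddAbove {c' | ∃ N ≤ (-1 : ℤ), ∃ y, Ends x Φ lam t c' N y} := by
  obtain ⟨c', y, h⟩ := exists_sheet C R ht 0
  refine ⟨c', ?_⟩
  rintro c2 ⟨N, hN, y2, h2⟩
  by_contra hlt
  have := order C R ht h h2 (not_le.1 hlt)
  omega

theorem lt_ang {c' : ℝ} {N : ℤ} {y : Y} (h : Ends x Φ lam t c' N y) (hc : c' < ang x Φ lam t) : N ≤ -1 := by
  obtain ⟨c0, y0, h0⟩ := exists_sheet C R ht (-1)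
  have hne : {c' | ∃ N ≤ (-1 : ℤ), ∃ y, Ends x Φ lam t c' N y}.Nonempty := ⟨c0, -1, le_rfl, y0, h0⟩
  obtain ⟨c2, ⟨N2, hN2, y2, h2⟩, hlt⟩ := exists_lt_of_lt_csSup hne hc
  exact (order C R ht h h2 hlt).trans hN2

theorem ang_lt {c' : ℝ} {N : ℤ} {y : Y} (h : Ends x Φ lam t c' N y) (hc : ang x Φ lam t < c') : 0 ≤ N := by
  by_contra hN
  have := le_csSup (ang_bdd C R ht) ⟨N, by omega, y, h⟩
  exact absurd hc (not_lt.2 this)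

theorem le_ang {c' : ℝ} {N : ℤ} {y : Y} (h : Ends x Φ lam t c' N y) (hN : N ≤ -1) : c' ≤ ang x Φ lam t :=
  le_csSup (ang_bdd C R ht) ⟨N, hN, y, h⟩

theorem ang_le {c' : ℝ} {N : ℤ} {y : Y} (h : Ends x Φ lam t c' N y) (hN : 0 ≤ N) : ang x Φ lam t ≤ c' := by
  by_contra hc
  have := lt_ang C R ht h (not_le.1 hc)
  omega
end

theorem ang_zero [PreconnectedSpace Y] (C : S.IsCore x Φ) (R : S.Ray x c T γ lam) : ang x Φ lam 0 = c := by
  have hpi := Real.pi_pos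
  apply le_antisymm
  · refine le_of_forall_gt_imp_ge_of_dense fun b hb => ?_
    obtain ⟨c1, h1, -, N, y, hl, h⟩ := ae_dense (ae_ends C R (le_refl (0:ℝ)))
      (a := c) (b := min b (c + 2 * Real.pi)) (lt_min hb (by linarith))
    have hN := zero_sheet C R h1.1 (h1.2.trans_le (min_le_right _ _)) hl h
    exact (ang_le C R le_rfl h hN.ge).trans (h1.2.le.trans (min_le_left _ _))
  · refine le_of_forall_lt_imp_le_of_dense fun b hb => ?_
    obtain ⟨c1, h1, -, N, y, hl, h⟩ := ae_dense (ae_ends C R (le_refl (0:ℝ)))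
      (a := max (b + 2 * Real.pi) c) (b := c + 2 * Real.pi) (max_lt (by linarith) (by linarith))
    have hN := zero_sheet C R ((le_max_right _ _).trans_lt h1.1) h1.2 hl h
    have h2 := C.ends_shift h (-1)
    have h3 := le_ang C R le_rfl h2 (by omega)
    have h4 := (le_max_left _ _).trans_lt h1.1
    push_cast at h3
    linarith

theorem Ray.unif (R : S.Ray x c T γ lam) (t : ℝ) {ρ : ℝ} (hρ : 0 < ρ) : ∃ η > 0, ∀ y y' : Y,
    ρ ≤ ‖S.H t y - S.H t x‖ → ρ ≤ ‖S.H t y' - S.H t x‖ → ‖S.H t y - S.H t y'‖ < η →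
      |(lam (y, t)).im - (lam (y', t)).im| < Real.pi / 2 := by
  have hH := S.contY t
  let A : Set Y := {y | ρ ≤ ‖S.H t y - S.H t x‖}
  have hA : IsClosed A := isClosed_le continuous_const (by fun_prop)
  have hAx : A ⊆ {x}ᶜ := by
    rintro y hy rfl
    have hy : ρ ≤ ‖S.H t y - S.H t y‖ := hy
    rw [sub_self, norm_zero] at hy
    linarith
  let g : Y × Y → ℝ := fun p => |(lam (p.1, t)).im - (lam (p.2, t)).im|
  have hl := (lam_contY R t).mono hAx
  have hg : ContinuousOn g (A ×ˢ A) := by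
    have h1 : ContinuousOn (fun p : Y × Y => (lam (p.1, t)).im) (A ×ˢ A) :=
      Complex.continuous_im.comp_continuousOn (hl.comp continuousOn_fst fun p hp => hp.1)
    have h2 : ContinuousOn (fun p : Y × Y => (lam (p.2, t)).im) (A ×ˢ A) :=
      Complex.continuous_im.comp_continuousOn (hl.comp continuousOn_snd fun p hp => hp.2)
    exact (h1.sub h2).abs
  let B : Set (Y × Y) := (A ×ˢ A) ∩ g ⁻¹' (Ici (Real.pi / 2))
  have hB : IsCompact B := (hg.preimage_isClosed_of_isClosed (hA.prod hA) isClosed_Ici).isCompact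
  rcases B.eq_empty_or_nonempty with he | hne
  · refine ⟨1, one_pos, fun y y' h1 h2 _ => ?_⟩
    by_contra h3
    have : (y, y') ∈ B := ⟨⟨h1, h2⟩, not_lt.1 h3⟩
    rw [he] at this
    exact this
  · obtain ⟨p, hp, hmin⟩ := hB.exists_isMinOn hne
      (f := fun p => ‖S.H t p.1 - S.H t p.2‖) (by fun_prop)
    refine ⟨‖S.H t p.1 - S.H t p.2‖, ?_, fun y y' h1 h2 h3 => ?_⟩
    · refine norm_pos_iff.2 (sub_ne_zero.2 fun he => ?_)
      have h4 := S.inj t he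
      have h5 : Real.pi / 2 ≤ g p := hp.2
      simp only [g] at h5
      rw [h4, sub_self, abs_zero] at h5
      linarith [Real.pi_pos]
    · by_contra h6
      have h7 : ‖S.H t p.1 - S.H t p.2‖ ≤ ‖S.H t y - S.H t y'‖ := hmin (show (y, y') ∈ B from ⟨⟨h1, h2⟩, not_lt.1 h6⟩)
      linarith

theorem ang_lands [PreconnectedSpace Y] (C : S.IsCore x Φ) (R : S.Ray x c T γ lam) {t : ℝ} (ht : 0 ≤ t) :
    Lands (S.φ t) (ang x Φ lam t) (S.H t x) := by
  have hrm := S.rm t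
  set a := ang x Φ lam t with ha
  set q := S.H t x with hq
  set f := S.φ t with hf
  unfold Lands
  rw [Metric.tendsto_nhds]
  intro ρ0 hρ0
  obtain ⟨ρ, hρ, hρρ⟩ : ∃ ρ > 0, ρ < ρ0 := ⟨ρ0 / 2, by positivity, by linarith⟩
  obtain ⟨η0, hη0, hunif⟩ := R.unif t (ρ := ρ / 4) (by positivity)
  set η := min (η0 / 4) (ρ / 16) with hη
  have hηp : 0 < η := lt_min (by positivity) (by positivity)
  have hη1 : 4 * η ≤ η0 := by
    have : η ≤ η0 / 4 := min_le_left _ _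
    linarith
  have hη2 : 16 * η ≤ ρ := by
    have : η ≤ ρ / 16 := min_le_right _ _
    linarith
  filter_upwards [hrm.box_select (ae_ends C R ht) a hηp, self_mem_nhdsWithin] with δ hδ hδ0
  have hδ0 : 0 < δ := hδ0
  obtain ⟨c₁, hc₁, c₂, hc₂, u₁, hu₁, u₂, hu₂, ⟨-, N1, y1, hl1, he1⟩, ⟨-, N2, y2, hl2, he2⟩, hs1, hs2, hv1, hv2⟩ := hδ
  have hN1 := lt_ang C R ht he1 (by linarith [hc₁.2])
  have hN2 := ang_lt C R ht he2 (by linarith [hc₂.1])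
  have hu1p : 0 < u₁ := by linarith [hu₁.1]
  have hu2p : 0 < u₂ := by linarith [hu₂.1]
  have hu1δ : u₁ < 2 * δ := by linarith [hu₁.2]
  have hu2δ : u₂ < 2 * δ := hu₂.2
  have hca : a ∈ Icc c₁ c₂ := ⟨by linarith [hc₁.2], by linarith [hc₂.1]⟩
  have hc1m : c₁ ∈ Icc c₁ c₂ := left_mem_Icc.2 (hca.1.trans hca.2)
  have hc2m : c₂ ∈ Icc c₁ c₂ := right_mem_Icc.2 (hca.1.trans hca.2)
  have hh1 : ∀ u v, 0 < u → u < 2 * δ → 0 < v → v < 2 * δ → dist (psi f ⟨u, c₁⟩) (psi f ⟨v, c₁⟩) < η := by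
    intro u v a1 a2 a3 a4
    rw [← edist_lt_ofReal]
    exact (hrm.var_len a3 a1 a4 a2).trans_lt hs1
  have hh2 : ∀ u v, 0 < u → u < 2 * δ → 0 < v → v < 2 * δ → dist (psi f ⟨u, c₂⟩) (psi f ⟨v, c₂⟩) < η := by
    intro u v a1 a2 a3 a4
    rw [← edist_lt_ofReal]
    exact (hrm.var_len a3 a1 a4 a2).trans_lt hs2
  have hd1 : dist (psi f ⟨u₁, c₁⟩) (S.H t y1) < η := by
    rw [← edist_lt_ofReal]
    exact (hrm.lands_dist hl1 hu1p hu1δ).trans_lt hs1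
  have hd2 : dist (psi f ⟨u₁, c₂⟩) (S.H t y2) < η := by
    rw [← edist_lt_ofReal]
    exact (hrm.lands_dist hl2 hu1p hu1δ).trans_lt hs2
  -- the crosscut is near q
  have near : dist (psi f ⟨u₁, a⟩) q < ρ / 2 := by
    by_contra hfar
    have hfar := not_lt.1 hfar
    have hw0 : (⟨u₁, a⟩ : ℂ) ∈ HP := hu1p
    have ex0 := C.exp t _ hw0
    have exn : ρ / 2 ≤ ‖Complex.exp (Φ t ⟨u₁, a⟩)‖ := by
      rw [ex0, ← dist_eq_norm]
      exact hfar
    have close : ∀ w ∈ HP, dist (psi f w) (psi f ⟨u₁, a⟩) < ρ / 2 →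
        ‖Complex.exp (Φ t w) - Complex.exp (Φ t ⟨u₁, a⟩)‖ < ‖Complex.exp (Φ t ⟨u₁, a⟩)‖ := by
      intro w hw hd
      rw [C.exp t w hw, ex0, sub_sub_sub_cancel_right, ← ex0, ← dist_eq_norm]
      exact hd.trans_le exn
    have ver : ∀ c' ∈ Icc c₁ c₂, |(Φ t ⟨u₁, c'⟩).im - (Φ t ⟨u₁, a⟩).im| < Real.pi / 2 := by
      refine close_im isPreconnected_Icc (G := fun c' => Φ t ⟨u₁, c'⟩) ?_ ?_ hca (by simp [Real.pi_pos])
      · exact (C.cont1 t).comp (continuous_ver u₁).continuousOn fun _ _ => hu1p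
      · intro c' hc'
        exact close _ hu1p ((hv1 c' hc' a hca).trans_le (by linarith))
    have hor : ∀ c' ∈ Icc c₁ c₂, (∀ u v, 0 < u → u < 2 * δ → 0 < v → v < 2 * δ →
        dist (psi f ⟨u, c'⟩) (psi f ⟨v, c'⟩) < η) → ∀ N y, Ends x Φ lam t c' N y →
        |(lam (y, t)).im + N * (2 * Real.pi) - (Φ t ⟨u₁, a⟩).im| ≤ Real.pi / 2 := by
      intro c' hc' hd N y hE
      have h1 : ∀ u ∈ Ioc 0 u₁, |(Φ t ⟨u, c'⟩).im - (Φ t ⟨u₁, a⟩).im| < Real.pi / 2 := by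
        refine close_im isPreconnected_Ioc (G := fun u : ℝ => Φ t ⟨u, c'⟩) ?_ ?_
          (right_mem_Ioc.2 hu1p) (ver c' hc')
        · exact (C.cont_hor t c').mono Ioc_subset_Ioi_self
        · intro u hu
          refine close _ hu.1 ?_
          have h2 := hd u u₁ hu.1 (hu.2.trans_lt hu1δ) hu1p hu1δ
          have h3 := hv1 c' hc' a hca
          have := dist_triangle (psi f ⟨u, c'⟩) (psi f ⟨u₁, c'⟩) (psi f ⟨u₁, a⟩)
          linarith
      have h2 : Tendsto (fun u : ℝ => |(Φ t ⟨u, c'⟩).im - (Φ t ⟨u₁, a⟩).im|) (𝓝[>] 0)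
          (𝓝 |(lam (y, t) + N * (2 * Real.pi * Complex.I)).im - (Φ t ⟨u₁, a⟩).im|) :=
        (((Complex.continuous_im.tendsto _).comp hE.2).sub_const _).abs
      have h3 : (lam (y, t) + N * (2 * Real.pi * Complex.I)).im = (lam (y, t)).im + N * (2 * Real.pi) := by
        simp
      rw [h3] at h2
      refine le_of_tendsto h2 ?_
      filter_upwards [Ioc_mem_nhdsGT hu1p] with u hu
      exact (h1 u hu).le
    have k1 := hor c₁ hc1m hh1 N1 y1 he1
    have k2 := hor c₂ hc2m hh2 N2 y2 he2
    have d1 := hv1 c₁ hc1m a hca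
    have d2 := hv1 c₂ hc2m a hca
    have far : ∀ (c' : ℝ) (y : Y), dist (psi f ⟨u₁, c'⟩) (S.H t y) < η →
        dist (psi f ⟨u₁, c'⟩) (psi f ⟨u₁, a⟩) < η → ρ / 4 ≤ ‖S.H t y - q‖ := by
      intro c' y e1 e2
      rw [← dist_eq_norm]
      have := dist_triangle4 (psi f ⟨u₁, a⟩) (psi f ⟨u₁, c'⟩) (S.H t y) q
      rw [dist_comm (psi f ⟨u₁, a⟩) (psi f ⟨u₁, c'⟩)] at this
      linarith
    have k3 := hunif y1 y2 (far c₁ y1 hd1 d1) (far c₂ y2 hd2 d2) (by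
      rw [← dist_eq_norm]
      have := dist_triangle4 (S.H t y1) (psi f ⟨u₁, c₁⟩) (psi f ⟨u₁, c₂⟩) (S.H t y2)
      rw [dist_comm (S.H t y1) (psi f ⟨u₁, c₁⟩)] at this
      have := hv1 c₁ hc1m c₂ hc2m
      linarith)
    have hNN : (N1 : ℝ) + 1 ≤ N2 := by exact_mod_cast (by omega : N1 + 1 ≤ N2)
    rw [abs_le] at k1 k2
    rw [abs_lt] at k3
    nlinarith [Real.pi_pos, mul_le_mul_of_nonneg_right hNN Real.pi_pos.le]
  -- box boundary
  have b1 : ∀ c' ∈ Icc c₁ c₂, dist (psi f ⟨u₁, c'⟩) q ≤ ρ / 2 + η := by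
    intro c' hc'
    have := dist_triangle (psi f ⟨u₁, c'⟩) (psi f ⟨u₁, a⟩) q
    linarith [hv1 c' hc' a hca]
  have b2 : ∀ u, 0 < u → u < 2 * δ → dist (psi f ⟨u, c₁⟩) q ≤ ρ / 2 + 2 * η ∧ dist (psi f ⟨u, c₂⟩) q ≤ ρ / 2 + 2 * η := by
    intro u e1 e2
    have f1 := dist_triangle (psi f ⟨u, c₁⟩) (psi f ⟨u₁, c₁⟩) q
    have f2 := dist_triangle (psi f ⟨u, c₂⟩) (psi f ⟨u₁, c₂⟩) q
    have f3 := hh1 u u₁ e1 e2 hu1p hu1δ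
    have f4 := hh2 u u₁ e1 e2 hu1p hu1δ
    have f5 := b1 c₁ hc1m
    have f6 := b1 c₂ hc2m
    constructor <;> linarith
  have b3 : ∀ c' ∈ Icc c₁ c₂, dist (psi f ⟨u₂, c'⟩) q ≤ ρ / 2 + 3 * η := by
    intro c' hc'
    have := dist_triangle (psi f ⟨u₂, c'⟩) (psi f ⟨u₂, c₁⟩) q
    linarith [hv2 c' hc' c₁ hc1m, (b2 u₂ hu2p hu2δ).1]
  have fin := hrm.box_max (u₁ := u₁) (u₂ := u₂) (c₁ := c₁) (c₂ := c₂) hu1p (q := q) (ρ := ρ)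
    (fun c' hc' => by
      rw [← dist_eq_norm, ← dist_eq_norm]
      exact ⟨(b1 c' hc').trans (by linarith), (b3 c' hc').trans (by linarith)⟩)
    (fun u hu => by
      rw [← dist_eq_norm, ← dist_eq_norm]
      have := b2 u (hu1p.trans_le hu.1) (hu.2.trans_lt hu2δ)
      exact ⟨this.1.trans (by linarith), this.2.trans (by linarith)⟩)
    (u := δ) (c := a) ⟨by linarith [hu₁.2], hu₂.1⟩ ⟨by linarith [hc₁.2], by linarith [hc₂.1]⟩
  rw [dist_eq_norm]
  linarith

end Sys


theorem RM.int_len {K : Set ℂ} {f : ℂ → ℂ} {M : ℝ} (h : RM K f M) {α β u : ℝ} (hβ : β ≤ α + 2 * Real.pi)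
    (hu : u ≤ 1) : ∫⁻ c in Ioo α β, len f c u ≤
      areaBd M ^ (1/2 : ℝ) * (ENNReal.ofReal u * ENNReal.ofReal (β - α)) ^ (1/2 : ℝ) := by
  rw [fubini_len]
  refine (cs_lintegral f _).trans ?_
  gcongr
  · exact (MeasureTheory.lintegral_mono_set (prod_mono (Ioo_subset_Ioo_right hu) (Ioo_subset_Ioo_right hβ))).trans
      (h.area α)
  · rw [MeasureTheory.Measure.volume_eq_prod, MeasureTheory.Measure.prod_prod, Real.volume_Ioo, Real.volume_Ioo,
      sub_zero]

theorem bound_tendsto (A L : ENNReal) (hA : A ≠ ⊤) (hL : L ≠ ⊤) :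
    Tendsto (fun u : ℝ => A ^ (1/2 : ℝ) * (ENNReal.ofReal u * L) ^ (1/2 : ℝ)) (𝓝[>] 0) (𝓝 0) := by
  have h1 : Tendsto (fun u : ℝ => ENNReal.ofReal u * L) (𝓝[>] 0) (𝓝 0) := by
    have : Tendsto (fun u : ℝ => ENNReal.ofReal u) (𝓝[>] 0) (𝓝 0) := by
      have := (ENNReal.continuous_ofReal.tendsto 0).mono_left (nhdsWithin_le_nhds (s := Ioi 0))
      simpa using this
    simpa using ENNReal.Tendsto.mul_const this (Or.inr hL)
  have h2 := (ENNReal.continuous_rpow_const (y := (1/2:ℝ))).tendsto 0 |>.comp h1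
  have h3 := ENNReal.Tendsto.const_mul (a := A ^ (1/2:ℝ)) h2
    (Or.inr (ENNReal.rpow_lt_top_of_nonneg (by norm_num) hA).ne)
  simpa [Function.comp_def] using h3

namespace Sys
variable {Y : Type*} [TopologicalSpace Y] [CompactSpace Y] [Nontrivial Y] {S : Sys Y}
variable {x : Y} {c T : ℝ} {γ : ℝ → ℂ} {lam : Y × ℝ → ℂ} {Φ : ℝ → ℂ → ℂ}

theorem tendsto_pt (S : Sys Y) {ι : Type*} {l : Filter ι} {t : ι → ℝ} {y : ι → Y} {s : ℝ} {y0 : Y}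
    (ht : Tendsto t l (𝓝 s)) (hy : Tendsto (fun i => S.H (t i) (y i)) l (𝓝 (S.H s y0))) :
    Tendsto y l (𝓝 y0) := by
  rw [tendsto_iff_ultrafilter]
  intro g hg
  obtain ⟨y', -, hy'⟩ := isCompact_univ.ultrafilter_le_nhds (g.map y) (by simp)
  have h1 : Tendsto y g (𝓝 y') := hy'
  have h2 : Tendsto (fun i => S.H (t i) (y i)) g (𝓝 (S.H s y')) :=
    (S.cont.tendsto (s, y')).comp ((ht.mono_left hg).prodMk_nhds h1)
  have h3 := tendsto_nhds_unique h2 (hy.mono_left hg)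
  rwa [S.inj s h3] at h1

theorem same_sheet [PreconnectedSpace Y] (C : S.IsCore x Φ) (R : S.Ray x c T γ lam) {s : ℝ} (hs : 0 ≤ s)
    {α β : ℝ} (hαβ : α < β) (hβ : β ≤ α + 2 * Real.pi) :
    ∀ᶠ t in 𝓝[Ici 0] s, ∃ c' ∈ Ioo α β, ∃ N y y', Ends x Φ lam s c' N y ∧ Ends x Φ lam t c' N y' := by
  by_contra hcon
  rw [not_eventually] at hcon
  have hpi := Real.pi_pos
  -- choose u
  have hu : ∀ m : ℕ, ∃ u : ℝ, 0 < u ∧ u < 1 / ((m : ℝ) + 1) ∧ 2 * u ≤ 1 ∧ ∀ t,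
      ∫⁻ c' in Ioo α β, len (S.φ t) c' (2 * u) ≤ (1/2 : ENNReal) ^ m := by
    intro m
    have h1 : Tendsto (fun u : ℝ => 2 * u) (𝓝[>] 0) (𝓝[>] 0) := by
      refine tendsto_nhdsWithin_of_tendsto_nhds_of_eventually_within _ ?_ ?_
      · have : Continuous fun u : ℝ => 2 * u := by fun_prop
        simpa using (this.tendsto 0).mono_left (nhdsWithin_le_nhds (s := Ioi 0))
      · filter_upwards [self_mem_nhdsWithin] with u hu
        have hu : 0 < u := hu
        show 0 < 2 * u
        positivity
    have h2 := (bound_tendsto (areaBd S.M) (ENNReal.ofReal (β - α)) (areaBd_lt _).ne ENNReal.ofReal_ne_top).comp h1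
    have h3 : (0 : ENNReal) < (1/2) ^ m := by
      apply ENNReal.pow_pos
      simp
    have h4 := h2.eventually (gt_mem_nhds h3)
    have hp : (0:ℝ) < min (1 / ((m:ℝ) + 1)) (1/2) := lt_min (by positivity) (by norm_num)
    obtain ⟨u, hu1, hu2⟩ := (h4.and (Ioo_mem_nhdsGT hp)).exists
    have hu3 : 2 * u ≤ 1 := by
      have := hu2.2.trans_le (min_le_right _ _)
      linarith
    exact ⟨u, hu2.1, hu2.2.trans_le (min_le_left _ _), hu3,
      fun t => ((S.rm t).int_len hβ hu3).trans hu1.le⟩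
  choose u hu0 hu1 hu2 hu3 using hu
  have htm : ∀ m : ℕ, ∃ t : ℝ, 0 ≤ t ∧ dist t s < 1 / ((m : ℝ) + 1) ∧
      (∀ c' ∈ Icc α β, ‖Φ t ⟨u m, c'⟩ - Φ s ⟨u m, c'⟩‖ < 1 / ((m : ℝ) + 1)) ∧
      ¬ ∃ c' ∈ Ioo α β, ∃ N y y', Ends x Φ lam s c' N y ∧ Ends x Φ lam t c' N y' := by
    intro m
    have hm : (0:ℝ) < 1 / ((m : ℝ) + 1) := by positivity
    have h1 : ∀ᶠ t in 𝓝 s, ∀ c' ∈ Icc α β, ‖Φ t ⟨u m, c'⟩ - Φ s ⟨u m, c'⟩‖ < 1 / ((m : ℝ) + 1) := by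
      have hc : Continuous fun p : ℝ × ℝ => ‖Φ p.1 ⟨u m, p.2⟩ - Φ s ⟨u m, p.2⟩‖ := by
        have e1 : Continuous fun p : ℝ × ℝ => (p.1, (⟨u m, p.2⟩ : ℂ)) :=
          continuous_fst.prodMk ((continuous_ver (u m)).comp continuous_snd)
        have e2 : Continuous fun p : ℝ × ℝ => (s, (⟨u m, p.2⟩ : ℂ)) :=
          continuous_const.prodMk ((continuous_ver (u m)).comp continuous_snd)
        have f1 := C.cont.comp_continuous e1 fun p => ⟨mem_univ _, hu0 m⟩
        have f2 := C.cont.comp_continuous e2 fun p => ⟨mem_univ _, hu0 m⟩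
        exact (f1.sub f2).norm
      refine isCompact_Icc.eventually_forall_of_forall_eventually fun c' _ => ?_
      refine (hc.tendsto (s, c')).eventually (gt_mem_nhds ?_)
      simpa using hm
    have h6 : ∀ᶠ t in 𝓝[Ici 0] s, dist t s < 1 / ((m : ℝ) + 1) := nhdsWithin_le_nhds (ball_mem_nhds s hm)
    have h7 : ∀ᶠ t in 𝓝[Ici (0:ℝ)] s, 0 ≤ t := self_mem_nhdsWithin
    obtain ⟨t, h2, h3, h4, h5⟩ := (hcon.and_eventually ((h1.filter_mono nhdsWithin_le_nhds).and (h6.and h7))).exists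
    exact ⟨t, h5, h4, h3, h2⟩
  choose t ht0 ht1 ht2 ht3 using htm
  have h1m : Tendsto (fun m : ℕ => 1 / ((m : ℝ) + 1)) atTop (𝓝 0) := tendsto_one_div_add_atTop_nhds_zero_nat
  have htt : Tendsto t atTop (𝓝 s) :=
    tendsto_iff_dist_tendsto_zero.2 (squeeze_zero (fun _ => dist_nonneg) (fun m => (ht1 m).le) h1m)
  have hut : Tendsto u atTop (𝓝[>] 0) := by
    refine tendsto_nhdsWithin_of_tendsto_nhds_of_eventually_within _ ?_ (Eventually.of_forall hu0)
    exact squeeze_zero (fun m => (hu0 m).le) (fun m => (hu1 m).le) h1m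
  -- a good c'
  have hsum : ∀ᵐ c' ∂(MeasureTheory.volume.restrict (Ioo α β)), Tendsto (fun m => len (S.φ (t m)) c' (2 * u m)) atTop (𝓝 0) := by
    have e1 : ∫⁻ c' in Ioo α β, ∑' m, len (S.φ (t m)) c' (2 * u m) ≠ ⊤ := by
      rw [MeasureTheory.lintegral_tsum fun m => (len_meas _ _).aemeasurable]
      refine ((ENNReal.tsum_le_tsum fun m => hu3 m (t m)).trans_lt ?_).ne
      rw [ENNReal.tsum_geometric]
      simp
    have e2 := MeasureTheory.ae_lt_top (Measurable.ennreal_tsum fun m => len_meas _ _) e1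
    filter_upwards [e2] with c' hc'
    exact ENNReal.tendsto_atTop_zero_of_tsum_ne_top hc'.ne
  rw [MeasureTheory.ae_restrict_iff' measurableSet_Ioo] at hsum
  have hall := MeasureTheory.ae_all_iff.2 fun m => ae_ends C R (ht0 m)
  obtain ⟨c', hc', hlen, ⟨-, Ns, ys, -, hEs⟩, hgood⟩ := ae_dense (hsum.and ((ae_ends C R hs).and hall)) hαβ
  have hlen := hlen hc'
  choose hg0 N y hland hE using hgood
  set g := lam (ys, s) + Ns * (2 * Real.pi * Complex.I) with hg
  have hexpg : Complex.exp g = S.H s ys - S.H s x := by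
    rw [hg, Complex.exp_add, Complex.exp_int_mul_two_pi_mul_I, mul_one, R.lam_exp' hs hEs.1]
  have G1 : Tendsto (fun m => Φ s ⟨u m, c'⟩) atTop (𝓝 g) := hEs.2.comp hut
  have G2 : Tendsto (fun m => Φ (t m) ⟨u m, c'⟩) atTop (𝓝 g) := by
    have e1 : Tendsto (fun m => Φ (t m) ⟨u m, c'⟩ - Φ s ⟨u m, c'⟩) atTop (𝓝 0) :=
      squeeze_zero_norm (fun m => (ht2 m c' (Ioo_subset_Icc_self hc')).le) h1m
    simpa using e1.add G1
  have G3 : Tendsto (fun m => psi (S.φ (t m)) ⟨u m, c'⟩) atTop (𝓝 (S.H s ys)) := by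
    have e1 := (Complex.continuous_exp.tendsto g).comp G2
    have e2 : Tendsto (fun m => S.H (t m) x) atTop (𝓝 (S.H s x)) :=
      (S.cont.tendsto (s, x)).comp (htt.prodMk_nhds tendsto_const_nhds)
    have e3 := e1.add e2
    rw [hexpg, sub_add_cancel] at e3
    refine e3.congr fun m => ?_
    simp only [Function.comp]
    rw [C.exp _ _ (hu0 m), sub_add_cancel]
  have G4 : Tendsto (fun m => S.H (t m) (y m)) atTop (𝓝 (S.H s ys)) := by
    have e1 : Tendsto (fun m => edist (psi (S.φ (t m)) ⟨u m, c'⟩) (S.H (t m) (y m))) atTop (𝓝 0) :=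
      tendsto_of_tendsto_of_tendsto_of_le_of_le tendsto_const_nhds hlen (fun _ => zero_le)
        fun m => (S.rm (t m)).lands_dist (hland m) (hu0 m) (by linarith [hu0 m])
    exact (tendsto_iff_of_dist (by
      have := (ENNReal.tendsto_toReal ENNReal.zero_ne_top).comp e1
      simpa [Function.comp_def, ← dist_edist] using this)).1 G3
  have G5 : Tendsto y atTop (𝓝 ys) := S.tendsto_pt htt G4
  have G6 : Tendsto (fun m => lam (y m, t m)) atTop (𝓝 (lam (ys, s))) := by
    have := R.lam_cont (ys, s) (Or.inl hEs.1)
    refine this.tendsto.comp (tendsto_nhdsWithin_of_tendsto_nhds_of_eventually_within _ (G5.prodMk_nhds htt) ?_)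
    exact Eventually.of_forall fun m => Or.inl (hE m).1
  have hgn : 0 < ‖Complex.exp g‖ := norm_pos_iff.2 (Complex.exp_ne_zero _)
  have A1 : ∀ᶠ m in atTop, len (S.φ (t m)) c' (2 * u m) < ENNReal.ofReal (‖Complex.exp g‖ / 2) :=
    hlen.eventually (gt_mem_nhds (by simpa using hgn))
  have A2 : ∀ᶠ m in atTop, dist (Complex.exp (Φ (t m) ⟨u m, c'⟩)) (Complex.exp g) < ‖Complex.exp g‖ / 2 :=
    ((Complex.continuous_exp.tendsto g).comp G2).eventually (ball_mem_nhds _ (by positivity))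
  have A3 : ∀ᶠ m in atTop, dist (Φ (t m) ⟨u m, c'⟩) g < Real.pi / 2 :=
    G2.eventually (ball_mem_nhds _ (by positivity))
  have A4 : ∀ᶠ m in atTop, dist (lam (y m, t m)) (lam (ys, s)) < Real.pi / 2 :=
    G6.eventually (ball_mem_nhds _ (by positivity))
  obtain ⟨m, a1, a2, a3, a4⟩ := (A1.and (A2.and (A3.and A4))).exists
  have key : ∀ v ∈ Ioc 0 (u m), |(Φ (t m) ⟨v, c'⟩).im - g.im| < Real.pi / 2 := by
    refine close_im isPreconnected_Ioc (G := fun v : ℝ => Φ (t m) ⟨v, c'⟩)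
      ((C.cont_hor (t m) c').mono Ioc_subset_Ioi_self) (fun v hv => ?_) (right_mem_Ioc.2 (hu0 m)) ?_
    · have e1 : dist (Complex.exp (Φ (t m) ⟨v, c'⟩)) (Complex.exp (Φ (t m) ⟨u m, c'⟩)) < ‖Complex.exp g‖ / 2 := by
        rw [C.exp _ _ hv.1, C.exp _ _ (hu0 m), dist_sub_right, ← edist_lt_ofReal]
        exact ((S.rm (t m)).var_len (hu0 m) hv.1 (by linarith [hu0 m]) (by linarith [hu0 m, hv.2])).trans_lt a1
      rw [← dist_eq_norm]
      have := dist_triangle (Complex.exp (Φ (t m) ⟨v, c'⟩)) (Complex.exp (Φ (t m) ⟨u m, c'⟩)) (Complex.exp g)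
      linarith
    · rw [dist_eq_norm] at a3
      have := Complex.abs_im_le_norm (Φ (t m) ⟨u m, c'⟩ - g)
      rw [Complex.sub_im] at this
      exact this.trans_lt a3
  have lim : |(lam (y m, t m) + N m * (2 * Real.pi * Complex.I)).im - g.im| ≤ Real.pi / 2 := by
    have h2 : Tendsto (fun v : ℝ => |(Φ (t m) ⟨v, c'⟩).im - g.im|) (𝓝[>] 0)
        (𝓝 |(lam (y m, t m) + N m * (2 * Real.pi * Complex.I)).im - g.im|) :=
      (((Complex.continuous_im.tendsto _).comp (hE m).2).sub_const _).abs
    refine le_of_tendsto h2 ?_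
    filter_upwards [Ioc_mem_nhdsGT (hu0 m)] with v hv
    exact (key v hv).le
  have a5 : |(lam (y m, t m)).im - (lam (ys, s)).im| < Real.pi / 2 := by
    rw [dist_eq_norm] at a4
    have := Complex.abs_im_le_norm (lam (y m, t m) - lam (ys, s))
    rw [Complex.sub_im] at this
    exact this.trans_lt a4
  have hNN : N m = Ns := by
    have e1 : (lam (y m, t m) + N m * (2 * Real.pi * Complex.I)).im = (lam (y m, t m)).im + N m * (2 * Real.pi) := by
      simp
    have e2 : g.im = (lam (ys, s)).im + Ns * (2 * Real.pi) := by
      simp [hg]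
    rw [e1, e2, abs_le] at lim
    rw [abs_lt] at a5
    rcases lt_trichotomy (N m) Ns with h | h | h
    · have h' : (N m : ℝ) + 1 ≤ Ns := by exact_mod_cast h
      nlinarith
    · exact h
    · have h' : (Ns : ℝ) + 1 ≤ N m := by exact_mod_cast h
      nlinarith
  have := hE m
  rw [hNN] at this
  exact ht3 m ⟨c', hc', Ns, ys, y m, hEs, this⟩

theorem ang_cont [PreconnectedSpace Y] (C : S.IsCore x Φ) (R : S.Ray x c T γ lam) :
    ContinuousOn (ang x Φ lam) (Ici 0) := by
  intro s hs
  have hpi := Real.pi_gt_three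
  refine tendsto_order.2 ⟨fun b hb => ?_, fun b hb => ?_⟩
  · have := same_sheet C R hs (α := max b (ang x Φ lam s - 1)) (β := ang x Φ lam s) (max_lt hb (by linarith))
      (by linarith [le_max_right b (ang x Φ lam s - 1)])
    filter_upwards [this, self_mem_nhdsWithin] with t ht ht0
    obtain ⟨c', hc', N, y, y', h1, h2⟩ := ht
    have hN := lt_ang C R hs h1 hc'.2
    exact ((le_max_left _ _).trans_lt hc'.1).trans_le (le_ang C R ht0 h2 hN)
  · have := same_sheet C R hs (α := ang x Φ lam s) (β := min b (ang x Φ lam s + 1)) (lt_min hb (by linarith))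
      (by linarith [min_le_right b (ang x Φ lam s + 1)])
    filter_upwards [this, self_mem_nhdsWithin] with t ht ht0
    obtain ⟨c', hc', N, y, y', h1, h2⟩ := ht
    have hN := ang_lt C R hs h1 hc'.1
    exact (ang_le C R ht0 h2 hN).trans_lt (hc'.2.trans_le (min_le_left _ _))

/-- core theorem: the landing angle moves continuously -/
theorem core [PreconnectedSpace Y] (S : Sys Y) {x : Y} {c : ℝ} (hl : Lands (S.φ 0) c (S.H 0 x)) :
    ∃ a : ℝ → ℝ, ContinuousOn a (Ici 0) ∧ a 0 = c ∧ ∀ t, 0 ≤ t → Lands (S.φ t) (a t) (S.H t x) := by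
  obtain ⟨Φ, C⟩ := S.exists_core x
  obtain ⟨T, γ, lam, R⟩ := S.exists_ray hl
  exact ⟨ang x Φ lam, ang_cont C R, ang_zero C R, fun t ht => ang_lands C R ht⟩

end Sys


theorem Lands.shift {f : ℂ → ℂ} {c : ℝ} {p : ℂ} (h : Lands f c p) (n : ℤ) : Lands f (c + n * (2 * Real.pi)) p := by
  refine h.congr fun u => ?_
  unfold psi
  congr 1
  rw [Complex.exp_eq_exp_iff_exists_int]
  refine ⟨n, ?_⟩
  apply Complex.ext <;> simp

namespace Sys
variable {Y : Type*} [TopologicalSpace Y] [CompactSpace Y] [Nontrivial Y] {S : Sys Y}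

/-- time change -/
def reparam (S : Sys Y) (g : ℝ → ℝ) (hg : Continuous g) : Sys Y where
  H := fun t => S.H (g t)
  φ := fun t => S.φ (g t)
  M := S.M
  cont := S.cont.comp (by fun_prop : Continuous fun p : ℝ × Y => (g p.1, p.2))
  inj := fun t => S.inj (g t)
  pos := S.pos
  bdd := fun t => S.bdd (g t)
  riem := fun t => S.riem (g t)

/-- a track: a continuous choice of angles following a landing ray -/
structure Track (S : Sys Y) (a : ℝ → ℝ) (y : Y) : Prop where
  cont : Continuous a
  lands : ∀ t, Lands (S.φ t) (a t) (S.H t y)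

theorem Track.shift {a : ℝ → ℝ} {y : Y} (h : S.Track a y) (n : ℤ) : S.Track (fun t => a t + n * (2 * Real.pi)) y :=
  ⟨h.cont.add continuous_const, fun t => (h.lands t).shift n⟩

theorem exists_track [PreconnectedSpace Y] (S : Sys Y) {s c : ℝ} {y : Y} (hl : Lands (S.φ s) c (S.H s y)) :
    ∃ a, S.Track a y ∧ a s = c := by
  obtain ⟨a, ha, ha0, hal⟩ := (S.reparam (fun t => s + t) (by fun_prop)).core (x := y) (c := c)
    (by simpa [reparam] using hl)
  obtain ⟨b, hb, hb0, hbl⟩ := (S.reparam (fun t => s - t) (by fun_prop)).core (x := y) (c := c)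
    (by simpa [reparam] using hl)
  refine ⟨fun t => a (max (t - s) 0) + b (max (s - t) 0) - c, ⟨?_, fun t => ?_⟩, by simp [ha0, hb0]⟩
  · have e1 : Continuous fun t : ℝ => a (max (t - s) 0) := ha.comp_continuous (by fun_prop) fun t => mem_Ici.2 (le_max_right _ _)
    have e2 : Continuous fun t : ℝ => b (max (s - t) 0) := hb.comp_continuous (by fun_prop) fun t => mem_Ici.2 (le_max_right _ _)
    exact (e1.add e2).sub continuous_const
  · rcases le_total s t with h | h
    · have := hal (t - s) (by linarith)
      simp only [reparam, add_sub_cancel] at this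
      rw [max_eq_left (by linarith), max_eq_right (by linarith), hb0]
      simpa using this
    · have := hbl (s - t) (by linarith)
      simp only [reparam, sub_sub_cancel] at this
      rw [max_eq_right (by linarith), max_eq_left (by linarith), ha0]
      simpa using this

theorem exists_track_between [PreconnectedSpace Y] (S : Sys Y) (s : ℝ) {p q : ℝ} (hpq : p < q) (x : Y) :
    ∃ a y, S.Track a y ∧ y ≠ x ∧ a s ∈ Ioo p q := by
  obtain ⟨c, hc, h1, h2⟩ := ae_dense ((S.rm s).ae_len.and ((S.rm s).ae_not_lands (mem_range_self x))) hpq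
  obtain ⟨k, hk⟩ := (S.rm s).lands_of_len one_pos h1
  obtain ⟨y, rfl⟩ := (S.rm s).lands_mem hk
  obtain ⟨a, ha, rfl⟩ := S.exists_track hk
  exact ⟨a, y, ha, fun e => h2 (e ▸ hk), hc⟩

theorem Track.lt_of_ne {a b : ℝ → ℝ} {y z : Y} (ha : S.Track a y) (hb : S.Track b z) (hyz : y ≠ z) {s : ℝ}
    (hs : a s < b s) (t : ℝ) : a t < b t := by
  by_contra hcon
  have hc : Continuous fun t => b t - a t := hb.cont.sub ha.cont
  have h0 : (0:ℝ) ∈ Icc ((fun t => b t - a t) t) ((fun t => b t - a t) s) := ⟨by simp only; linarith, by simp only; linarith⟩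
  obtain ⟨r, hr⟩ := mem_range_of_exists_le_of_exists_ge hc ⟨t, h0.1⟩ ⟨s, h0.2⟩
  have hr : b r = a r := by simp only at hr; linarith
  have h1 := hb.lands r
  rw [hr] at h1
  exact hyz (S.inj r (tendsto_nhds_unique (ha.lands r) h1))

theorem Track.lt [PreconnectedSpace Y] {a b : ℝ → ℝ} {y z : Y} (ha : S.Track a y) (hb : S.Track b z) {s : ℝ}
    (hs : a s < b s) (t : ℝ) : a t < b t := by
  by_cases hyz : y = z
  · subst hyz
    obtain ⟨d, w, hd, hw, h⟩ := S.exists_track_between s hs y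
    exact (ha.lt_of_ne hd hw.symm h.1 t).trans (hd.lt_of_ne hb hw h.2 t)
  · exact ha.lt_of_ne hb hyz hs t

theorem Track.le [PreconnectedSpace Y] {a b : ℝ → ℝ} {y z : Y} (ha : S.Track a y) (hb : S.Track b z) {s : ℝ}
    (hs : a s ≤ b s) (t : ℝ) : a t ≤ b t := by
  by_contra h
  exact absurd (hb.lt ha (not_le.1 h) s) (not_lt.2 hs)

/-- values of tracks -/
def tset (S : Sys Y) (c t : ℝ) : Set ℝ := {v | ∃ a y, S.Track a y ∧ a 0 ≤ c ∧ a t = v}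

/-- the lifted isotopy of the circle -/
noncomputable def lift (S : Sys Y) (c t : ℝ) : ℝ := sSup (S.tset c t)

section
variable [PreconnectedSpace Y]

theorem tset_ne (S : Sys Y) (c t : ℝ) : (S.tset c t).Nonempty := by
  obtain ⟨y⟩ : Nonempty Y := inferInstance
  obtain ⟨a, z, ha, -, h⟩ := S.exists_track_between 0 (sub_one_lt c) y
  exact ⟨a t, a, z, ha, h.2.le, rfl⟩

theorem tset_ub (S : Sys Y) {a : ℝ → ℝ} {y : Y} (ha : S.Track a y) {c : ℝ} (hc : c ≤ a 0) (t : ℝ) :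
    ∀ v ∈ S.tset c t, v ≤ a t := by
  rintro v ⟨b, z, hb, h, rfl⟩
  exact hb.le ha (h.trans hc) t

theorem lift_le {a : ℝ → ℝ} {y : Y} (ha : S.Track a y) {c : ℝ} (hc : c ≤ a 0) (t : ℝ) : S.lift c t ≤ a t :=
  csSup_le (S.tset_ne c t) (S.tset_ub ha hc t)

theorem tset_bdd (S : Sys Y) (c t : ℝ) : BddAbove (S.tset c t) := by
  obtain ⟨y⟩ : Nonempty Y := inferInstance
  obtain ⟨a, z, ha, -, h⟩ := S.exists_track_between 0 (lt_add_one c) y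
  exact ⟨a t, S.tset_ub ha h.1.le t⟩

theorem le_lift {a : ℝ → ℝ} {y : Y} (ha : S.Track a y) {c : ℝ} (hc : a 0 ≤ c) (t : ℝ) : a t ≤ S.lift c t :=
  le_csSup (S.tset_bdd c t) ⟨a, y, ha, hc, rfl⟩

theorem lift_track {a : ℝ → ℝ} {y : Y} (ha : S.Track a y) (t : ℝ) : S.lift (a 0) t = a t :=
  le_antisymm (lift_le ha le_rfl t) (le_lift ha le_rfl t)

theorem lift_strictMono (S : Sys Y) (t : ℝ) : StrictMono fun c => S.lift c t := by
  intro c c' hcc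
  obtain ⟨y⟩ : Nonempty Y := inferInstance
  obtain ⟨a, z, ha, -, h⟩ := S.exists_track_between 0 hcc y
  obtain ⟨b, w, hb, -, h'⟩ := S.exists_track_between 0 h.2 y
  exact (lift_le ha h.1.le t).trans_lt ((ha.lt hb h'.1 t).trans_le (le_lift hb h'.2.le t))

theorem lift_zero (S : Sys Y) (c : ℝ) : S.lift c 0 = c := by
  obtain ⟨y⟩ : Nonempty Y := inferInstance
  apply le_antisymm
  · refine csSup_le (S.tset_ne c 0) ?_
    rintro v ⟨b, z, hb, h, rfl⟩
    exact h
  · refine le_of_forall_lt_imp_le_of_dense fun b hb => ?_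
    obtain ⟨a, z, ha, -, h⟩ := S.exists_track_between 0 hb y
    exact h.1.le.trans (le_lift ha h.2.le 0)

theorem lift_shift (S : Sys Y) (c t : ℝ) (n : ℤ) : S.lift (c + n * (2 * Real.pi)) t = S.lift c t + n * (2 * Real.pi) := by
  have key : ∀ (c : ℝ) (n : ℤ), S.lift c t + n * (2 * Real.pi) ≤ S.lift (c + n * (2 * Real.pi)) t := by
    intro c n
    rw [← le_sub_iff_add_le]
    refine csSup_le (S.tset_ne c t) ?_
    rintro v ⟨b, z, hb, h, rfl⟩
    have := le_lift (hb.shift n) (c := c + n * (2 * Real.pi)) (by simpa using h) t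
    linarith
  refine le_antisymm ?_ (key c n)
  have := key (c + n * (2 * Real.pi)) (-n)
  push_cast at this
  rw [show c + n * (2 * Real.pi) + -(n:ℝ) * (2 * Real.pi) = c by ring] at this
  linarith

theorem lift_cont (S : Sys Y) : Continuous fun p : ℝ × ℝ => S.lift p.1 p.2 := by
  obtain ⟨y⟩ : Nonempty Y := inferInstance
  rw [continuous_iff_continuousAt]
  rintro ⟨c, t⟩
  refine tendsto_order.2 ⟨fun v hv => ?_, fun v hv => ?_⟩
  · obtain ⟨a, z, ha, -, h⟩ := S.exists_track_between t hv y
    obtain ⟨_, ⟨b, w, hb, hb0, rfl⟩, hlt⟩ := exists_lt_of_lt_csSup (S.tset_ne c t) h.2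
    have h0 : a 0 < c := (ha.lt hb hlt 0).trans_le hb0
    have e1 : ∀ᶠ p : ℝ × ℝ in 𝓝 (c, t), a 0 < p.1 := continuous_fst.continuousAt.eventually (lt_mem_nhds h0)
    have e2 : ∀ᶠ p : ℝ × ℝ in 𝓝 (c, t), v < a p.2 :=
      (ha.cont.comp continuous_snd).continuousAt.eventually (lt_mem_nhds h.1)
    filter_upwards [e1, e2] with p h1 h2
    exact h2.trans_le (le_lift ha h1.le _)
  · obtain ⟨a, z, ha, -, h⟩ := S.exists_track_between t hv y
    have h0 : c < a 0 := by
      by_contra hc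
      exact absurd (le_lift ha (not_lt.1 hc) t) (not_le.2 h.1)
    have e1 : ∀ᶠ p : ℝ × ℝ in 𝓝 (c, t), p.1 < a 0 := continuous_fst.continuousAt.eventually (gt_mem_nhds h0)
    have e2 : ∀ᶠ p : ℝ × ℝ in 𝓝 (c, t), a p.2 < v :=
      (ha.cont.comp continuous_snd).continuousAt.eventually (gt_mem_nhds h.2)
    filter_upwards [e1, e2] with p h1 h2
    exact (lift_le ha h1.le _).trans_lt h2

theorem lift_lands (S : Sys Y) {c : ℝ} {y : Y} (hl : Lands (S.φ 0) c (S.H 0 y)) (t : ℝ) :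
    Lands (S.φ t) (S.lift c t) (S.H t y) := by
  obtain ⟨a, ha, rfl⟩ := S.exists_track hl
  rw [lift_track ha]
  exact ha.lands t
end

end Sys


namespace RM
variable {K : Set ℂ} {f : ℂ → ℂ} {M : ℝ} (h : RM K f M)
include h

theorem inner_far {k : ℂ} (hk : k ∈ K) {ρ : ℝ} (hρ : ρ < 1) : ∃ δ > 0, ∀ z : ℂ, z ≠ 0 → ‖z‖ ≤ ρ → δ ≤ ‖f z - k‖ := by
  have hc : ContinuousOn (pf f k) (closedBall 0 ρ) :=
    (h.p_diff hk).continuousOn.mono (closedBall_subset_ball hρ)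
  obtain ⟨B, hB⟩ := (isCompact_closedBall (0:ℂ) ρ).exists_bound_of_continuousOn hc
  refine ⟨(|B| + 1)⁻¹, by positivity, fun z hz0 hz => ?_⟩
  have h1 := hB z (by simpa using hz)
  have hz1 : z ∈ ball (0:ℂ) 1 := by simpa using hz.trans_lt hρ
  have h2 : 0 < ‖f z - k‖ := norm_pos_iff.2 (sub_ne_zero.2 (h.f_ne hz1 hz0 hk))
  rw [p_ne hz0, norm_inv] at h1
  rw [inv_le_comm₀ (by positivity) h2]
  exact h1.trans (by linarith [le_abs_self B])

theorem strip_in (hcl : K ⊆ closure (unbddComp K)) {V W : Set ℂ} (hW : IsOpen W) (hd : Disjoint V W)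
    {r : ℝ} (hr : 0 < r) (hV : ∀ w : ℂ, 0 < w.re → w.re < r → psi f w ∈ V) {k : ℂ} (hk : k ∈ K) : k ∉ W := by
  intro hkW
  have hρ : Real.exp (-r) < 1 := by simpa using hr
  obtain ⟨δ, hδ, hfar⟩ := h.inner_far hk hρ
  obtain ⟨w, ⟨hwW, hwb⟩, hwU⟩ := mem_closure_iff_nhds.1 (hcl hk) _
    (inter_mem (hW.mem_nhds hkW) (ball_mem_nhds k hδ))
  rw [← h.nrm.2.2.1] at hwU
  obtain ⟨z, ⟨hz1, hz0⟩, rfl⟩ := hwU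
  have hz0 : z ≠ 0 := hz0
  have hz1 : ‖z‖ < 1 := by simpa using hz1
  by_cases hz : ‖z‖ ≤ Real.exp (-r)
  · have := hfar z hz0 hz
    rw [mem_ball, dist_eq_norm] at hwb
    linarith
  · have h1 : psi f (-Complex.log z) ∈ V := by
      apply hV
      · rw [Complex.neg_re, Complex.log_re]
        linarith [Real.log_neg (norm_pos_iff.2 hz0) hz1]
      · rw [Complex.neg_re, Complex.log_re]
        have := (Real.lt_log_iff_exp_lt (norm_pos_iff.2 hz0)).2 (not_le.1 hz)
        linarith
    rw [psi, neg_neg, Complex.exp_log hz0] at h1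
    exact disjoint_left.1 hd h1 hwW

theorem strip_sub {V : Set ℂ} (hV : IsOpen V) (hKV : K ⊆ V) :
    ∃ r > 0, ∀ w : ℂ, 0 < w.re → w.re < r → psi f w ∈ V := by
  by_contra hcon
  push Not at hcon
  have hm : ∀ m : ℕ, ∃ w : ℂ, 0 < w.re ∧ w.re < 1 / ((m : ℝ) + 1) ∧ psi f w ∉ V := fun m =>
    hcon _ (by positivity)
  choose w hw0 hw1 hwV using hm
  have hw : Tendsto (fun m => (w m).re) atTop (𝓝 0) :=
    squeeze_zero (fun m => (hw0 m).le) (fun m => (hw1 m).le) tendsto_one_div_add_atTop_nhds_zero_nat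
  obtain ⟨r, hr1, hr⟩ := h.outer one_pos
  have hz : Tendsto (fun m => ‖Complex.exp (-(w m))‖) atTop (𝓝 1) := by
    have := (Real.continuous_exp.tendsto (-0)).comp hw.neg
    simpa [Function.comp_def, Complex.norm_exp] using this
  obtain ⟨m0, hm0⟩ := (hz.eventually (lt_mem_nhds hr1)).exists_forall_of_atTop
  have hb : ∀ m, psi f (w (m + m0)) ∈ closedBall (0:ℂ) (M + 1) := by
    intro m
    rw [mem_closedBall_zero_iff]
    exact hr _ (exp_mem (hw0 _)) (hm0 _ (by omega)) (Complex.exp_ne_zero _)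
  obtain ⟨k, -, σ, hσ, hk⟩ := (isCompact_closedBall (0:ℂ) (M + 1)).tendsto_subseq hb
  have hkK : k ∈ K := by
    refine h.psi_bdry (l := atTop) (z := fun i => w (σ i + m0)) (Eventually.of_forall fun i => hw0 _) ?_ hk
    exact hw.comp ((tendsto_add_atTop_nat m0).comp hσ.tendsto_atTop)
  have : k ∈ Vᶜ := hV.isClosed_compl.mem_of_tendsto hk (Eventually.of_forall fun i => hwV _)
  exact this (hKV hkK)

theorem preconn (hcl : K ⊆ closure (unbddComp K)) : IsPreconnected K := by
  rw [isPreconnected_iff_subset_of_fully_disjoint_closed h.cpt.isClosed]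
  intro u v hu hv huv hd
  obtain ⟨V, W, hV, hW, huV, hvW, hVW⟩ := normal_separation hu hv hd
  obtain ⟨r, hr, hin⟩ := h.strip_sub (hV.union hW) (huv.trans (union_subset_union huV hvW))
  have hpre : IsPreconnected (psi f '' {w : ℂ | 0 < w.re ∧ w.re < r}) := by
    refine IsPreconnected.image ?_ _ (h.psi_diff.continuousOn.mono fun w hw => hw.1)
    exact ((convex_halfSpace_re_gt 0).inter (convex_halfSpace_re_lt r)).isPreconnected
  have := hpre.subset_or_subset hV hW hVW (by
    rintro _ ⟨w, hw, rfl⟩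
    exact hin w hw.1 hw.2)
  rcases this with h1 | h1
  · left
    intro k hk
    refine (huv hk).resolve_right fun hkv => ?_
    exact h.strip_in hcl hW hVW hr (fun w a b => h1 ⟨w, ⟨a, b⟩, rfl⟩) hk (hvW hkv)
  · right
    intro k hk
    refine (huv hk).resolve_left fun hku => ?_
    exact h.strip_in hcl hV hVW.symm hr (fun w a b => h1 ⟨w, ⟨a, b⟩, rfl⟩) hk (huV hku)

theorem nontriv : K.Nontrivial := by
  by_contra hcon
  rw [not_nontrivial_iff] at hcon
  obtain ⟨k, hk⟩ := h.ne
  obtain ⟨c, -, h1, h2⟩ := ae_dense (h.ae_len.and (h.ae_not_lands hk)) zero_lt_one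
  obtain ⟨p, hp⟩ := h.lands_of_len one_pos h1
  exact h2 (hcon (h.lands_mem hp) hk ▸ hp)

end RM


theorem lands_iff {f : ℂ → ℂ} {θ : ℝ} {p : ℂ} :
    Tendsto (fun r : ℝ => f ((r : ℂ) * Complex.exp ((θ : ℂ) * Complex.I))) (𝓝[<] 1) (𝓝 p) ↔ Lands f (-θ) p := by
  have key : ∀ u : ℝ, psi f ⟨u, -θ⟩ = f (((Real.exp (-u) : ℝ) : ℂ) * Complex.exp ((θ : ℂ) * Complex.I)) := by
    intro u
    rw [psi, Complex.ofReal_exp, ← Complex.exp_add]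
    congr 2
    apply Complex.ext <;> simp
  constructor
  · intro h
    have h1 : Tendsto (fun u : ℝ => Real.exp (-u)) (𝓝[>] 0) (𝓝[<] 1) := by
      refine tendsto_nhdsWithin_of_tendsto_nhds_of_eventually_within _ ?_ ?_
      · have : Continuous fun u : ℝ => Real.exp (-u) := by fun_prop
        simpa using (this.tendsto 0).mono_left (nhdsWithin_le_nhds (s := Ioi 0))
      · filter_upwards [self_mem_nhdsWithin] with u hu
        have hu : 0 < u := hu
        simpa using hu
    refine (h.comp h1).congr fun u => ?_
    rw [key]
    rfl
  · intro h
    have h1 : Tendsto (fun r : ℝ => -Real.log r) (𝓝[<] 1) (𝓝[>] 0) := by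
      refine tendsto_nhdsWithin_of_tendsto_nhds_of_eventually_within _ ?_ ?_
      · have := (Real.continuousAt_log (one_ne_zero)).neg.tendsto.mono_left (nhdsWithin_le_nhds (s := Iio (1:ℝ)))
        rw [Pi.neg_apply, Real.log_one, neg_zero] at this
        exact this
      · filter_upwards [Ioo_mem_nhdsLT (zero_lt_one (α := ℝ))] with r hr
        have := Real.log_neg hr.1 hr.2
        show 0 < -Real.log r
        linarith
    refine (h.comp h1).congr' ?_
    filter_upwards [Ioo_mem_nhdsLT (zero_lt_one (α := ℝ))] with r hr
    simp only [Function.comp]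
    rw [key, neg_neg, Real.exp_log hr.1]

namespace Sys
variable {Y : Type*} [TopologicalSpace Y] [CompactSpace Y] [Nontrivial Y] [PreconnectedSpace Y]

/-- the isotopy in the exponential coordinate -/
noncomputable def circ (S : Sys Y) (θ t : ℝ) : ℂ := Complex.exp (((-(S.lift (-θ) t) : ℝ) : ℂ) * Complex.I)

theorem circ_cont (S : Sys Y) : Continuous fun p : ℝ × ℝ => S.circ p.1 p.2 := by
  unfold circ
  have h1 : Continuous fun p : ℝ × ℝ => S.lift (-p.1) p.2 :=
    S.lift_cont.comp (by fun_prop : Continuous fun p : ℝ × ℝ => (-p.1, p.2))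
  fun_prop

theorem circ_per (S : Sys Y) {θ θ' : ℝ} (he : Complex.exp ((θ : ℂ) * Complex.I) = Complex.exp ((θ' : ℂ) * Complex.I))
    (t : ℝ) : S.circ θ t = S.circ θ' t := by
  obtain ⟨n, hn⟩ := Complex.exp_eq_exp_iff_exists_int.1 he
  have h1 : θ = θ' + n * (2 * Real.pi) := by
    have := congrArg Complex.im hn
    simpa using this
  have h2 : S.lift (-θ) t = S.lift (-θ') t - n * (2 * Real.pi) := by
    have := S.lift_shift (-θ') t (-n)
    rw [h1, show -(θ' + n * (2 * Real.pi)) = -θ' + ((-n : ℤ) : ℝ) * (2 * Real.pi) by push_cast; ring, this]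
    push_cast
    ring
  unfold circ
  rw [Complex.exp_eq_exp_iff_exists_int]
  refine ⟨n, ?_⟩
  rw [h2]
  push_cast
  ring

theorem circ_inj (S : Sys Y) {θ θ' t : ℝ} (he : S.circ θ t = S.circ θ' t) :
    Complex.exp ((θ : ℂ) * Complex.I) = Complex.exp ((θ' : ℂ) * Complex.I) := by
  unfold circ at he
  obtain ⟨n, hn⟩ := Complex.exp_eq_exp_iff_exists_int.1 he
  have h1 : -S.lift (-θ) t = -S.lift (-θ') t + n * (2 * Real.pi) := by
    have := congrArg Complex.im hn
    simpa using this
  have h2 := S.lift_shift (-θ') t (-n)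
  have h3 : S.lift (-θ) t = S.lift (-θ' + ((-n : ℤ) : ℝ) * (2 * Real.pi)) t := by
    rw [h2]
    push_cast
    linarith
  have h4 := (S.lift_strictMono t).injective h3
  rw [Complex.exp_eq_exp_iff_exists_int]
  refine ⟨n, ?_⟩
  have h5 : θ = θ' + n * (2 * Real.pi) := by
    push_cast at h4
    linarith
  rw [h5]
  push_cast
  ring

theorem exp_arg_sphere {z : ℂ} (hz : z ∈ sphere (0:ℂ) 1) : Complex.exp ((z.arg : ℂ) * Complex.I) = z := by
  have h1 : ‖z‖ = 1 := by simpa using hz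
  have := Complex.norm_mul_exp_arg_mul_I z
  rwa [h1, Complex.ofReal_one, one_mul] at this

theorem circ_arg_cont (S : Sys Y) (A : Set ℝ) :
    ContinuousOn (fun p : ℂ × ℝ => S.circ p.1.arg p.2) (sphere 0 1 ×ˢ A) := by
  rintro ⟨z0, t0⟩ ⟨hz0, ht0⟩
  have hz0' : z0 ≠ 0 := by
    rintro rfl
    simp at hz0
  have h1 : ContinuousAt (fun p : ℂ × ℝ => S.circ (z0.arg + (p.1 / z0).arg) p.2) (z0, t0) := by
    have e0 : ContinuousAt Complex.arg (z0 / z0) := by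
      rw [div_self hz0']
      exact Complex.continuousAt_arg (by simp)
    have e1 : ContinuousAt (fun p : ℂ × ℝ => (p.1 / z0).arg) (z0, t0) :=
      ContinuousAt.comp (f := fun p : ℂ × ℝ => p.1 / z0) (g := Complex.arg) e0 (by fun_prop)
    exact ContinuousAt.comp (f := fun p : ℂ × ℝ => (z0.arg + (p.1 / z0).arg, p.2))
      (g := fun p : ℝ × ℝ => S.circ p.1 p.2) S.circ_cont.continuousAt (by fun_prop)
  refine h1.continuousWithinAt.congr_of_mem ?_ ⟨hz0, ht0⟩
  rintro ⟨z, t⟩ ⟨hz, -⟩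
  apply S.circ_per
  have h2 : z / z0 ∈ sphere (0:ℂ) 1 := by
    simp only [mem_sphere_zero_iff_norm] at *
    rw [norm_div, hz, hz0, div_one]
  have h3 := exp_arg_sphere h2
  have h4 := exp_arg_sphere hz0
  rw [exp_arg_sphere hz]
  push_cast
  rw [add_mul, Complex.exp_add, h3, h4]
  field_simp

theorem circ_zero (S : Sys Y) (θ : ℝ) : S.circ θ 0 = Complex.exp ((θ : ℂ) * Complex.I) := by
  unfold circ
  rw [S.lift_zero, neg_neg]

theorem circ_norm (S : Sys Y) (θ t : ℝ) : S.circ θ t ∈ sphere (0:ℂ) 1 := by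
  unfold circ
  rw [mem_sphere_zero_iff_norm, Complex.norm_exp_ofReal_mul_I]

theorem circ_lands (S : Sys Y) {θ : ℝ} {y : Y}
    (hl : Tendsto (fun r : ℝ => S.φ 0 ((r : ℂ) * Complex.exp ((θ : ℂ) * Complex.I))) (𝓝[<] 1) (𝓝 (S.H 0 y))) (t : ℝ) :
    Tendsto (fun r : ℝ => S.φ t ((r : ℂ) * S.circ θ t)) (𝓝[<] 1) (𝓝 (S.H t y)) := by
  have h1 := S.lift_lands (lands_iff.1 hl) t
  unfold circ
  apply lands_iff.2
  rwa [neg_neg]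

end Sys

theorem main_aux
    (X : Set ℂ) (hXne : X.Nonempty) (hXcpt : IsCompact X)
    (hXns : IsConnected Xᶜ)
    (h : ℂ → ℝ → ℂ)
    (hcont : ContinuousOn (fun p : ℂ × ℝ => h p.1 p.2) (frontier X ×ˢ Set.Icc 0 1))
    (hinj : ∀ t ∈ Set.Icc (0:ℝ) 1, Set.InjOn (fun z => h z t) (frontier X))
    (hid : ∀ z ∈ frontier X, h z 0 = z)
    (φ : ℝ → ℂ → ℂ)
    (hφ : ∀ t ∈ Set.Icc (0:ℝ) 1,
      IsNormalizedRiemannMap (unbddComp ((fun z => h z t) '' frontier X)) (φ t)) :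
    ∃ α : ℂ → ℝ → ℂ,
      ContinuousOn (fun p : ℂ × ℝ => α p.1 p.2) (Metric.sphere 0 1 ×ˢ Set.Icc 0 1) ∧
      (∀ z ∈ Metric.sphere (0:ℂ) 1, ∀ t ∈ Set.Icc (0:ℝ) 1,
        α z t ∈ Metric.sphere (0:ℂ) 1) ∧
      (∀ t ∈ Set.Icc (0:ℝ) 1, Set.InjOn (fun z => α z t) (Metric.sphere 0 1)) ∧
      (∀ z ∈ Metric.sphere (0:ℂ) 1, α z 0 = z) ∧
      (∀ θ : ℝ, ∀ x ∈ frontier X,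
        Filter.Tendsto (fun r : ℝ => φ 0 ((r : ℂ) * Complex.exp ((θ : ℂ) * Complex.I)))
          (𝓝[<] 1) (𝓝 x) →
        ∀ t ∈ Set.Icc (0:ℝ) 1,
          Filter.Tendsto
            (fun r : ℝ => φ t ((r : ℂ) * α (Complex.exp ((θ : ℂ) * Complex.I)) t))
            (𝓝[<] 1) (𝓝 (h x t))) := by
  have hFc : IsCompact (frontier X) :=
    hXcpt.of_isClosed_subset isClosed_frontier hXcpt.isClosed.frontier_subset
  obtain ⟨B, hB⟩ := (hFc.prod (isCompact_Icc (a := (0:ℝ)) (b := 1))).exists_bound_of_continuousOn hcont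
  have hFne : (frontier X).Nonempty := by
    rw [nonempty_iff_ne_empty]
    intro he
    have hcl : IsClopen X := isClopen_iff_frontier_eq_empty.2 he
    rcases isClopen_iff.1 hcl with h1 | h1
    · exact hXne.ne_empty h1
    · obtain ⟨z, hz⟩ := hXns.nonempty
      rw [h1] at hz
      exact hz (mem_univ _)
  have hid' : (fun z => h z 0) '' frontier X = frontier X := by
    ext w
    constructor
    · rintro ⟨z, hz, rfl⟩
      simp only
      rwa [hid z hz]
    · intro hw
      exact ⟨w, hw, hid w hw⟩
  have h01 : (0:ℝ) ∈ Icc (0:ℝ) 1 := ⟨le_rfl, zero_le_one⟩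
  have hrm0 : RM (frontier X) (φ 0) (|B| + 1) := by
    refine ⟨hFc, hFne, by positivity, fun k hk => ?_, ?_⟩
    · have := hB (k, 0) ⟨hk, h01⟩
      simp only at this
      rw [hid k hk] at this
      linarith [le_abs_self B]
    · have := hφ 0 h01
      rwa [hid'] at this
  have hub : Xᶜ ⊆ unbddComp (frontier X) := by
    refine unbddComp_of_mem hXns.isPreconnected (compl_subset_compl.2 hXcpt.isClosed.frontier_subset) ?_
    intro hb
    have h1 := hb.union hXcpt.isBounded
    rw [compl_union_self] at h1
    exact NormedSpace.unbounded_univ ℂ ℂ h1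
  have hcl : frontier X ⊆ closure (unbddComp (frontier X)) := by
    intro z hz
    rw [← frontier_compl] at hz
    exact closure_mono hub (frontier_subset_closure hz)
  let Y := frontier X
  have i1 : CompactSpace Y := isCompact_iff_compactSpace.1 hFc
  have i2 : PreconnectedSpace Y := Subtype.preconnectedSpace (hrm0.preconn hcl)
  have i3 : Nontrivial Y := nontrivial_coe_sort.2 hrm0.nontriv
  let S : Sys Y := {
    H := fun t y => h y (projIcc (0:ℝ) 1 zero_le_one t)
    φ := fun t => φ (projIcc (0:ℝ) 1 zero_le_one t)
    M := |B| + 1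
    cont := by
      refine hcont.comp_continuous (f := fun p : ℝ × Y => ((p.2 : ℂ), ((projIcc (0:ℝ) 1 zero_le_one p.1 : Icc (0:ℝ) 1) : ℝ))) ?_ ?_
      · exact (continuous_subtype_val.comp continuous_snd).prodMk
          (continuous_subtype_val.comp (continuous_projIcc.comp continuous_fst))
      · exact fun p => ⟨p.2.2, Subtype.prop _⟩
    inj := by
      intro t y y' he
      exact Subtype.ext (hinj _ (Subtype.prop _) y.2 y'.2 he)
    pos := by positivity
    bdd := by
      intro t y
      have := hB (y, _) ⟨y.2, Subtype.prop (projIcc (0:ℝ) 1 zero_le_one t)⟩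
      exact this.trans (by linarith [le_abs_self B])
    riem := by
      intro t
      have := hφ _ (Subtype.prop (projIcc (0:ℝ) 1 zero_le_one t))
      rwa [image_eq_range] at this }
  have hSφ : ∀ t ∈ Icc (0:ℝ) 1, S.φ t = φ t := by
    intro t ht
    simp only [S, projIcc_of_mem zero_le_one ht]
  have hSH : ∀ t ∈ Icc (0:ℝ) 1, ∀ y : Y, S.H t y = h y t := by
    intro t ht y
    simp only [S, projIcc_of_mem zero_le_one ht]
  refine ⟨fun z t => S.circ z.arg t, S.circ_arg_cont _, fun z _ t _ => S.circ_norm _ _, ?_, ?_, ?_⟩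
  · intro t _ z hz w hw he
    have := S.circ_inj he
    rwa [Sys.exp_arg_sphere hz, Sys.exp_arg_sphere hw] at this
  · intro z hz
    simp only
    rw [S.circ_zero, Sys.exp_arg_sphere hz]
  · intro θ x hx hl t ht
    have h1 : S.H 0 ⟨x, hx⟩ = x := by rw [hSH 0 h01, hid x hx]
    have h2 := S.circ_lands (θ := θ) (y := ⟨x, hx⟩) (by rwa [hSφ 0 h01, h1]) t
    rw [hSφ t ht, hSH t ht] at h2
    have h3 : S.circ (Complex.exp ((θ : ℂ) * Complex.I)).arg t = S.circ θ t := by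
      apply S.circ_per
      apply Sys.exp_arg_sphere
      rw [mem_sphere_zero_iff_norm, Complex.norm_exp_ofReal_mul_I]
    simp only [h3]
    exact h2

/-- the continuous angle isotopy: there is an isotopy `α` of the unit
circle, starting at the identity, such that whenever the external ray of `X⁰` at
`e^{iθ}` lands at `x`, the external ray of `X^t` at `α^t(e^{iθ})` lands at `h^t(x)`. -/
theorem continuous_angle_isotopy
    (X : Set ℂ) (hXne : X.Nonempty) (hXcpt : IsCompact X) (hXconn : IsConnected X)
    (hXns : IsConnected Xᶜ)
    (h : ℂ → ℝ → ℂ)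
    (hcont : ContinuousOn (fun p : ℂ × ℝ => h p.1 p.2) (frontier X ×ˢ Set.Icc 0 1))
    (hinj : ∀ t ∈ Set.Icc (0:ℝ) 1, Set.InjOn (fun z => h z t) (frontier X))
    (hid : ∀ z ∈ frontier X, h z 0 = z)
    (φ : ℝ → ℂ → ℂ)
    (hφ : ∀ t ∈ Set.Icc (0:ℝ) 1,
      IsNormalizedRiemannMap (unbddComp ((fun z => h z t) '' frontier X)) (φ t)) :
    ∃ α : ℂ → ℝ → ℂ,
      ContinuousOn (fun p : ℂ × ℝ => α p.1 p.2) (Metric.sphere 0 1 ×ˢ Set.Icc 0 1) ∧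
      (∀ z ∈ Metric.sphere (0:ℂ) 1, ∀ t ∈ Set.Icc (0:ℝ) 1,
        α z t ∈ Metric.sphere (0:ℂ) 1) ∧
      (∀ t ∈ Set.Icc (0:ℝ) 1, Set.InjOn (fun z => α z t) (Metric.sphere 0 1)) ∧
      (∀ z ∈ Metric.sphere (0:ℂ) 1, α z 0 = z) ∧
      (∀ θ : ℝ, ∀ x ∈ frontier X,
        Filter.Tendsto (fun r : ℝ => φ 0 ((r : ℂ) * Complex.exp ((θ : ℂ) * Complex.I)))
          (𝓝[<] 1) (𝓝 x) →
        ∀ t ∈ Set.Icc (0:ℝ) 1,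
          Filter.Tendsto
            (fun r : ℝ => φ t ((r : ℂ) * α (Complex.exp ((θ : ℂ) * Complex.I)) t))
            (𝓝[<] 1) (𝓝 (h x t))) := by
  exact main_aux X hXne hXcpt hXns h hcont hinj hid φ hφ
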